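/- arXiv:1409.0801 — 2 statements merged into one kernel-verified Lean document; each statement's English description precedes it below -/
import Mathlib

section
/- Let ⟨·⟩ be a stationary ensemble on Ω that satisfies (SG) for some constants ρ > 0 and ℓ < ∞. Then ⟨·⟩ is ergodic, i.e. every E ∈ 𝓕 with τ_z⁻¹E = E for all z ∈ ℝ^d satisfies ⟨𝟙_E⟩ ∈ {0,1}; indeed, the following quantitative form holds: for every X ∈ L¹(Ω,𝓕,⟨·⟩), writing X̄(y,A) := X(τ_y A) for its stationary extension, lim_{R↑∞} ⟨|⨍_{B_R} X̄(y,·) dy − ⟨X⟩|⟩ = 0. -/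
open MeasureTheory Filter Metric Matrix ENNReal

noncomputable section

namespace GO

/-- Euclidean space `ℝ^d`. -/
abbrev E (d : ℕ) : Type := EuclideanSpace ℝ (Fin d)

/-- The set `Ω₀` of bounded elliptic matrices: `|A₀ξ| ≤ |ξ|` and `ξ·A₀ξ ≥ λ|ξ|²`. -/
def IsEllipticMatrix (d : ℕ) (lam : ℝ) (M : Matrix (Fin d) (Fin d) ℝ) : Prop :=
  (∀ ξ : Fin d → ℝ, (M.mulVec ξ) ⬝ᵥ (M.mulVec ξ) ≤ ξ ⬝ᵥ ξ) ∧
  (∀ ξ : Fin d → ℝ, lam * (ξ ⬝ᵥ ξ) ≤ ξ ⬝ᵥ (M.mulVec ξ))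

instance matrixMeasurableSpace (d : ℕ) : MeasurableSpace (Matrix (Fin d) (Fin d) ℝ) :=
  MeasurableSpace.pi

/-- `Ω` : Lebesgue-measurable coefficient fields with values in `Ω₀`. -/
structure CoeffField (d : ℕ) (lam : ℝ) : Type where
  A : E d → Matrix (Fin d) (Fin d) ℝ
  measurable : Measurable A
  elliptic : ∀ x, IsEllipticMatrix d lam (A x)

/-- Smooth compactly supported test functions. -/
def IsTestFun (d : ℕ) (χ : E d → ℝ) : Prop :=
  ContDiff ℝ (⊤ : ℕ∞) χ ∧ HasCompactSupport χ

/-- The σ-algebra `𝓕` generated by the maps `A ↦ ∫ A_{ij} χ`. -/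
def ensembleSigma (d : ℕ) (lam : ℝ) : MeasurableSpace (CoeffField d lam) :=
  ⨆ (i : Fin d) (j : Fin d) (χ : E d → ℝ) (_ : IsTestFun d χ),
    MeasurableSpace.comap (fun W => ∫ x : E d, W.A x i j * χ x) inferInstance

instance (d : ℕ) (lam : ℝ) : MeasurableSpace (CoeffField d lam) := ensembleSigma d lam

/-- The shift `τ_z A = A(· + z)`. -/
def shift {d : ℕ} {lam : ℝ} (z : E d) (W : CoeffField d lam) : CoeffField d lam where
  A := fun x => W.A (x + z)
  measurable := W.measurable.comp (measurable_add_const z)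
  elliptic := fun x => W.elliptic (x + z)

/-- Stationarity of an ensemble. -/
def IsStationary {d : ℕ} {lam : ℝ} (μ : Measure (CoeffField d lam)) : Prop :=
  ∀ z : E d, μ.map (shift z) = μ

/-- `W'` agrees with `W` outside `U`. -/
def agreesOff {d : ℕ} {lam : ℝ} (U : Set (E d)) (W W' : CoeffField d lam) : Prop :=
  ∀ x ∉ U, W'.A x = W.A x

/-- The oscillation `osc_{A|U} X` (with values in `ℝ≥0∞`). -/
def osc {d : ℕ} {lam : ℝ} (U : Set (E d)) (X : CoeffField d lam → ℝ)
    (W : CoeffField d lam) : ℝ≥0∞ :=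
  ⨆ (W₁ : CoeffField d lam) (_ : agreesOff U W W₁) (W₂ : CoeffField d lam)
    (_ : agreesOff U W W₂), ENNReal.ofReal (X W₁ - X W₂)

/-- Outer expectation of a (possibly non-measurable) nonnegative quantity. -/
def outerE {d : ℕ} {lam : ℝ} (μ : Measure (CoeffField d lam))
    (f : CoeffField d lam → ℝ≥0∞) : ℝ≥0∞ :=
  ⨅ (g : CoeffField d lam → ℝ≥0∞) (_ : Measurable g) (_ : ∀ W, f W ≤ g W), ∫⁻ W, g W ∂μ

/-- Expectation `⟨X⟩`. -/
def ensMean {d : ℕ} {lam : ℝ} (μ : Measure (CoeffField d lam))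
    (X : CoeffField d lam → ℝ) : ℝ :=
  ∫ W, X W ∂μ

/-- Variance `var[X]` (with values in `ℝ≥0∞`). -/
def ensVar {d : ℕ} {lam : ℝ} (μ : Measure (CoeffField d lam))
    (X : CoeffField d lam → ℝ) : ℝ≥0∞ :=
  ∫⁻ W, ENNReal.ofReal ((X W - ensMean μ X) ^ 2) ∂μ

/-- The spectral gap estimate (SG) with constants `ρ` and `ℓ`. -/
def SpectralGap {d : ℕ} {lam : ℝ} (μ : Measure (CoeffField d lam)) (ρ ℓ : ℝ) : Prop :=
  ∀ X : CoeffField d lam → ℝ, Measurable X →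
    ensVar μ X ≤ ENNReal.ofReal ρ⁻¹ *
      outerE μ (fun W => ∫⁻ z : E d, (osc (ball z ℓ) X W) ^ 2)

/-- The gradient of a test function, as a vector of `ℝ^d`. -/
def gradAt {d : ℕ} (χ : E d → ℝ) (x : E d) : Fin d → ℝ :=
  fun i => fderiv ℝ χ x (EuclideanSpace.single i 1)

/-- `φ ∈ H¹_loc(ℝ^d)` with weak gradient `Dφ`. -/
def IsWeakH1Loc {d : ℕ} (φ : E d → ℝ) (Dφ : E d → Fin d → ℝ) : Prop :=
  (∀ R : ℝ, 0 < R →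
    IntegrableOn (fun x => (φ x) ^ 2) (ball (0:E d) R) volume ∧
    IntegrableOn (fun x => Dφ x ⬝ᵥ Dφ x) (ball (0:E d) R) volume) ∧
  (∀ χ : E d → ℝ, IsTestFun d χ → ∀ i : Fin d,
    ∫ x : E d, φ x * gradAt χ x i = - ∫ x : E d, Dφ x i * χ x)

/-- The uniqueness class: `limsup_{t↑∞} ⨍_{B_t} (φ² + |∇φ|²) < ∞`. -/
def GrowthClass {d : ℕ} (φ : E d → ℝ) (Dφ : E d → Fin d → ℝ) : Prop :=
  Filter.limsup (fun t : ℝ =>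
      (∫⁻ x in ball (0:E d) t, ENNReal.ofReal ((φ x) ^ 2 + Dφ x ⬝ᵥ Dφ x)) /
        volume (ball (0:E d) t)) Filter.atTop < ⊤

/-- The modified corrector: distributional solution of `T⁻¹φ_T − ∇·A(ξ+∇φ_T) = 0`
in the growth class. -/
def IsModifiedCorrector {d : ℕ} {lam : ℝ} (W : CoeffField d lam) (T : ℝ) (ξ : Fin d → ℝ)
    (φ : E d → ℝ) (Dφ : E d → Fin d → ℝ) : Prop :=
  IsWeakH1Loc φ Dφ ∧ GrowthClass φ Dφ ∧
  ∀ χ : E d → ℝ, IsTestFun d χ →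
    ∫ x : E d, (T⁻¹ * φ x * χ x + gradAt χ x ⬝ᵥ (W.A x).mulVec (ξ + Dφ x)) = 0

/-- The modified adjoint corrector (with `A` replaced by its pointwise transpose `A*`). -/
def IsModifiedAdjointCorrector {d : ℕ} {lam : ℝ} (W : CoeffField d lam) (T : ℝ)
    (ξ' : Fin d → ℝ) (φ : E d → ℝ) (Dφ : E d → Fin d → ℝ) : Prop :=
  IsWeakH1Loc φ Dφ ∧ GrowthClass φ Dφ ∧
  ∀ χ : E d → ℝ, IsTestFun d χ →
    ∫ x : E d, (T⁻¹ * φ x * χ x + gradAt χ x ⬝ᵥ ((W.A x).transpose).mulVec (ξ' + Dφ x)) = 0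

/-- The solution `ψ_T` of `T⁻¹ψ_T − ∇·A∇ψ_T = φ_T` in the growth class. -/
def IsPsiSolution {d : ℕ} {lam : ℝ} (W : CoeffField d lam) (T : ℝ) (φ : E d → ℝ)
    (ψ : E d → ℝ) (Dψ : E d → Fin d → ℝ) : Prop :=
  IsWeakH1Loc ψ Dψ ∧ GrowthClass ψ Dψ ∧
  ∀ χ : E d → ℝ, IsTestFun d χ →
    ∫ x : E d, (T⁻¹ * ψ x * χ x + gradAt χ x ⬝ᵥ (W.A x).mulVec (Dψ x)) = ∫ x : E d, φ x * χ x

/-- The pointwise bound `g_T` for the Green function. -/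
def gBound (d : ℕ) (c T r : ℝ) : ℝ :=
  Real.exp (-(c * r) / Real.sqrt T) *
    (if d = 2 then Real.log (2 + Real.sqrt T / r) else r ^ ((2:ℝ) - (d:ℝ)))

/-- `Df` is the weak gradient of `f`. -/
def HasWeakGrad {d : ℕ} (f : E d → ℝ) (Df : E d → Fin d → ℝ) : Prop :=
  ∀ χ : E d → ℝ, IsTestFun d χ → ∀ i : Fin d,
    ∫ x : E d, f x * gradAt χ x i = - ∫ x : E d, Df x i * χ x

/-- The defining properties of the Green function `G_T` (with constants `c`, `C`). -/
def GreenProps {d : ℕ} {lam : ℝ} (W : CoeffField d lam) (T : ℝ) (c C : ℝ)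
    (G : E d → E d → ℝ) (DxG DyG : E d → E d → Fin d → ℝ) : Prop :=
  (∀ x y : E d, 0 ≤ G x y) ∧
  ContinuousOn (fun p : E d × E d => G p.1 p.2) {p : E d × E d | p.1 ≠ p.2} ∧
  (∀ x y : E d, x ≠ y → G x y ≤ C * gBound d c T (dist x y)) ∧
  (∀ y : E d, HasWeakGrad (fun x => G x y) (fun x => DxG x y)) ∧
  (∀ x : E d, HasWeakGrad (fun y => G x y) (fun y => DyG x y)) ∧
  (∀ y : E d, ∀ R : ℝ, 0 < R →
    IntegrableOn (fun x => G x y) (ball (0:E d) R) volume ∧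
    ∀ i : Fin d, IntegrableOn (fun x => DxG x y i) (ball (0:E d) R) volume) ∧
  (∀ x : E d, ∀ R : ℝ, 0 < R →
    IntegrableOn (fun y => G x y) (ball (0:E d) R) volume ∧
    ∀ i : Fin d, IntegrableOn (fun y => DyG x y i) (ball (0:E d) R) volume) ∧
  (∀ y : E d, ∀ R : ℝ, 0 < R →
    (∫⁻ x in {x : E d | R < dist x y ∧ dist x y < 2*R}, ENNReal.ofReal (DxG x y ⬝ᵥ DxG x y)) ≤
      ENNReal.ofReal ((C * Real.exp (-(c*R) / Real.sqrt T) * R ^ ((1:ℝ) - (d:ℝ))) ^ 2 * R ^ d)) ∧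
  (∀ x : E d, ∀ R : ℝ, 0 < R →
    (∫⁻ y in {y : E d | R < dist y x ∧ dist y x < 2*R}, ENNReal.ofReal (DyG x y ⬝ᵥ DyG x y)) ≤
      ENNReal.ofReal ((C * Real.exp (-(c*R) / Real.sqrt T) * R ^ ((1:ℝ) - (d:ℝ))) ^ 2 * R ^ d)) ∧
  (∀ y : E d, ∀ χ : E d → ℝ, IsTestFun d χ →
    ∫ x : E d, (T⁻¹ * G x y * χ x + gradAt χ x ⬝ᵥ (W.A x).mulVec (DxG x y)) = χ y) ∧
  (∀ x : E d, ∀ χ : E d → ℝ, IsTestFun d χ →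
    ∫ y : E d, (T⁻¹ * G x y * χ y + gradAt χ y ⬝ᵥ ((W.A y).transpose).mulVec (DyG x y)) = χ x)

/-- `G` is the Green function of `W`, with gradients `DxG`, `DyG`
(for some admissible constants `c`, `C`). -/
def IsGreenFunction {d : ℕ} {lam : ℝ} (W : CoeffField d lam) (T : ℝ)
    (G : E d → E d → ℝ) (DxG DyG : E d → E d → Fin d → ℝ) : Prop :=
  ∃ c C : ℝ, 0 < c ∧ 0 < C ∧ GreenProps W T c C G DxG DyG

/-- `DDG` is the mixed second gradient `∇∇G` of the Green function. -/
def IsMixedGrad {d : ℕ} (DxG : E d → E d → Fin d → ℝ)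
    (DDG : E d → E d → Fin d → Fin d → ℝ) : Prop :=
  ∀ (y : E d) (j : Fin d), HasWeakGrad (fun x => DxG y x j) (fun x => DDG y x j)

/-- The quantity `h_T(z,x)` built from the Green function gradient. -/
def hTval (d : ℕ) (R : ℝ) (DxG : E d → E d → Fin d → ℝ) (z x : E d) : ℝ :=
  if dist z x < 2*R then 1
  else Real.sqrt ((∫⁻ y in ball z R, ENNReal.ofReal (DxG y x ⬝ᵥ DxG y x)).toReal)

/-- `ν_d(T)`. -/
def nud (d : ℕ) (T : ℝ) : ℝ :=
  if d = 2 then T * Real.log T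
  else if d = 3 then Real.sqrt T
  else if d = 4 then Real.log T
  else 1

end GO

namespace GO

/-- The deviation in `L¹` of the average of `X` over a ball from its expectation. -/
def deviation {d : ℕ} {lam : ℝ} (μ : Measure (CoeffField d lam)) (X : CoeffField d lam → ℝ)
    (R : ℝ) : ℝ :=
  ∫ W, |(⨍ y in ball (0:E d) R, X (shift y W) ∂volume) - ensMean μ X| ∂μ

/-- The event `S` depends only on the restriction of the field to some ball. -/
def IsLocalEvent {d : ℕ} {lam : ℝ} (S : Set (CoeffField d lam)) : Prop :=
  ∃ r : ℝ, ∀ W W' : CoeffField d lam, (∀ x ∈ ball (0 : E d) r, W.A x = W'.A x) →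
    (W ∈ S ↔ W' ∈ S)

section Measurability

variable {d : ℕ} {lam : ℝ}

lemma abs_entry_le_one {M : Matrix (Fin d) (Fin d) ℝ} (hM : IsEllipticMatrix d lam M)
    (i j : Fin d) : |M i j| ≤ 1 := by
  have h := hM.1 (Pi.single j 1)
  simp only [Matrix.mulVec_single_one, dotProduct_single, Pi.single_eq_same, mul_one] at h
  have h2 : M i j * M i j ≤ (M.col j) ⬝ᵥ (M.col j) := by
    unfold dotProduct
    exact Finset.single_le_sum (f := fun k => M.col j k * M.col j k)
      (fun k _ => mul_self_nonneg _) (Finset.mem_univ i)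
  rw [← abs_one, ← sq_le_sq]
  nlinarith

lemma measurable_entry (W : CoeffField d lam) (i j : Fin d) : Measurable fun x => W.A x i j :=
  (measurable_pi_apply j).comp ((measurable_pi_apply i).comp W.measurable)

lemma locallyIntegrable_entry (W : CoeffField d lam) (i j : Fin d) :
    LocallyIntegrable (fun x => W.A x i j) (volume : Measure (E d)) := by
  refine (locallyIntegrable_const (1 : ℝ)).mono (measurable_entry W i j).aestronglyMeasurable ?_
  filter_upwards with x
  simpa using abs_entry_le_one (W.elliptic x) i j

lemma measurable_testIntegral (i j : Fin d) {χ : E d → ℝ} (hχ : IsTestFun d χ) :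
    Measurable fun W : CoeffField d lam => ∫ x : E d, W.A x i j * χ x := by
  rw [measurable_iff_comap_le]
  exact le_iSup_of_le i (le_iSup_of_le j (le_iSup_of_le χ (le_iSup_of_le hχ le_rfl)))

lemma measurable_of_testIntegral {α : Type*} [MeasurableSpace α] {f : α → CoeffField d lam}
    (h : ∀ (i j : Fin d) (χ : E d → ℝ), IsTestFun d χ →
      Measurable fun a => ∫ x : E d, (f a).A x i j * χ x) : Measurable f := by
  rw [measurable_iff_comap_le]
  change MeasurableSpace.comap f (ensembleSigma d lam) ≤ _
  simp only [ensembleSigma, MeasurableSpace.comap_iSup, MeasurableSpace.comap_comp]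
  exact iSup_le fun i => iSup_le fun j => iSup_le fun χ => iSup_le fun hχ =>
    (measurable_iff_comap_le.1 (h i j χ hχ))

lemma IsTestFun.comp_sub_right {χ : E d → ℝ} (hχ : IsTestFun d χ) (y : E d) :
    IsTestFun d fun x => χ (x - y) := by
  refine ⟨hχ.1.comp (contDiff_id.sub contDiff_const), ?_⟩
  simpa [sub_eq_add_neg, Function.comp_def] using
    hχ.2.comp_homeomorph (Homeomorph.addRight (-y))

lemma testIntegral_shift (W : CoeffField d lam) (y : E d) (i j : Fin d) (χ : E d → ℝ) :
    ∫ x : E d, (shift y W).A x i j * χ x = ∫ x : E d, W.A x i j * χ (x - y) := by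
  rw [← integral_add_right_eq_self (μ := volume) (fun x => W.A x i j * χ (x - y)) y]
  simp [shift]

lemma continuous_testIntegral_shift (W : CoeffField d lam) (i j : Fin d) {χ : E d → ℝ}
    (hχ : IsTestFun d χ) :
    Continuous fun y : E d => ∫ x : E d, (shift y W).A x i j * χ x := by
  have hc : HasCompactSupport fun u : E d => χ (-u) := by
    simpa [Function.comp_def] using hχ.2.comp_homeomorph (Homeomorph.neg (E d))
  have := hc.continuous_convolution_right (ContinuousLinearMap.mul ℝ ℝ) (μ := volume)
    (locallyIntegrable_entry W i j) (hχ.1.continuous.comp continuous_neg)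
  convert this using 2 with y
  rw [testIntegral_shift]
  simp [convolution]

/-- The shift is jointly measurable in the field and the translation vector. -/
lemma measurable_shift_uncurry :
    Measurable fun p : CoeffField d lam × E d => shift p.2 p.1 := by
  refine measurable_of_testIntegral fun i j χ hχ => ?_
  have := measurable_uncurry_of_continuous_of_measurable
    (u := fun (y : E d) (W : CoeffField d lam) => ∫ x : E d, (shift y W).A x i j * χ x)
    (fun W => continuous_testIntegral_shift W i j hχ) (fun y => by
      simp only [testIntegral_shift]
      exact measurable_testIntegral i j (hχ.comp_sub_right y))
  exact this.comp measurable_swap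

lemma measurable_shift (y : E d) : Measurable (shift y : CoeffField d lam → _) :=
  measurable_shift_uncurry.comp measurable_prodMk_right

end Measurability

section Average

variable {d : ℕ} {lam : ℝ} {μ : Measure (CoeffField d lam)}

lemma isProbabilityMeasure_cond_ball {R : ℝ} (hR : 0 < R) :
    IsProbabilityMeasure (ProbabilityTheory.cond (volume : Measure (E d)) (ball 0 R)) :=
  ProbabilityTheory.cond_isProbabilityMeasure_of_finite (measure_ball_pos _ _ hR).ne'
    measure_ball_lt_top.ne

lemma setAverage_eq_integral_cond (f : E d → ℝ) (s : Set (E d)) :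
    ⨍ y in s, f y ∂volume = ∫ y, f y ∂(ProbabilityTheory.cond volume s) := by
  simp [average, ProbabilityTheory.cond]

lemma deviation_nonneg (X : CoeffField d lam → ℝ) (R : ℝ) : 0 ≤ deviation μ X R :=
  integral_nonneg fun _ => abs_nonneg _

lemma deviation_const_mul (c : ℝ) (X : CoeffField d lam → ℝ) (R : ℝ) :
    deviation μ (fun W => c * X W) R = |c| * deviation μ X R := by
  simp only [deviation, setAverage_eq_integral_cond, ensMean, integral_const_mul, ← mul_sub,
    abs_mul]

lemma tendsto_deviation_const_mul (c : ℝ) {X : CoeffField d lam → ℝ}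
    (hX' : Tendsto (deviation μ X) atTop (nhds 0)) :
    Tendsto (deviation μ fun W => c * X W) atTop (nhds 0) := by
  have := hX'.const_mul |c|
  rw [mul_zero] at this
  exact this.congr fun R => (deviation_const_mul c X R).symm

variable [IsProbabilityMeasure μ]

lemma integrable_indicator_one {S : Set (CoeffField d lam)} (hS : MeasurableSet S) :
    Integrable (S.indicator (1 : CoeffField d lam → ℝ)) μ :=
  (integrable_const (1 : ℝ)).indicator hS

lemma measurePreserving_shift_prod (hstat : IsStationary μ) (ν : Measure (E d))
    [IsProbabilityMeasure ν] :
    MeasurePreserving (fun p : CoeffField d lam × E d => shift p.2 p.1) (μ.prod ν) μ := by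
  refine ⟨measurable_shift_uncurry, ?_⟩
  ext s hs
  rw [Measure.map_apply measurable_shift_uncurry hs,
    Measure.prod_apply_symm (measurable_shift_uncurry hs)]
  have : ∀ y : E d, μ ((fun W => (W, y)) ⁻¹'
      ((fun p : CoeffField d lam × E d => shift p.2 p.1) ⁻¹' s)) = μ s := fun y => by
    conv_rhs => rw [← hstat y, Measure.map_apply (measurable_shift y) hs]
    rfl
  simp [this]

lemma integrable_shift_prod (hstat : IsStationary μ) (ν : Measure (E d))
    [IsProbabilityMeasure ν] {X : CoeffField d lam → ℝ} (hX : Integrable X μ) :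
    Integrable (fun p : CoeffField d lam × E d => X (shift p.2 p.1)) (μ.prod ν) :=
  (measurePreserving_shift_prod hstat ν).integrable_comp_of_integrable hX

lemma integral_integral_shift (hstat : IsStationary μ) (ν : Measure (E d))
    [IsProbabilityMeasure ν] {X : CoeffField d lam → ℝ} (hX : Integrable X μ) :
    ∫ W, ∫ y, X (shift y W) ∂ν ∂μ = ∫ W, X W ∂μ := by
  have hmp := measurePreserving_shift_prod hstat ν
  rw [integral_integral (f := fun W y => X (shift y W)) (integrable_shift_prod hstat ν hX)]
  have h := integral_map (μ := μ.prod ν) hmp.measurable.aemeasurable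
    (f := X) (by rw [hmp.map_eq]; exact hX.1)
  rw [hmp.map_eq] at h
  exact h.symm

lemma integral_abs_integral_shift_le (hstat : IsStationary μ) (ν : Measure (E d))
    [IsProbabilityMeasure ν] {X : CoeffField d lam → ℝ} (hX : Integrable X μ) :
    ∫ W, |∫ y, X (shift y W) ∂ν| ∂μ ≤ ∫ W, |X W| ∂μ := by
  rw [← integral_integral_shift hstat ν hX.abs]
  exact integral_mono (integrable_shift_prod hstat ν hX).integral_prod_left.abs
    (integrable_shift_prod hstat ν hX.abs).integral_prod_left
    fun W => abs_integral_le_integral_abs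

lemma integrable_average (hstat : IsStationary μ) {X : CoeffField d lam → ℝ}
    (hX : Integrable X μ) {R : ℝ} (hR : 0 < R) :
    Integrable (fun W => ⨍ y in ball (0:E d) R, X (shift y W) ∂volume) μ := by
  have := isProbabilityMeasure_cond_ball (d := d) hR
  simp only [setAverage_eq_integral_cond]
  exact (integrable_shift_prod hstat _ hX).integral_prod_left

lemma deviation_le_two_mul (hstat : IsStationary μ) {X : CoeffField d lam → ℝ}
    (hX : Integrable X μ) {R : ℝ} (hR : 0 < R) :
    deviation μ X R ≤ 2 * ∫ W, |X W| ∂μ := by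
  have := isProbabilityMeasure_cond_ball (d := d) hR
  have hI := integrable_average hstat hX hR
  calc deviation μ X R
      ≤ ∫ W, (|⨍ y in ball (0:E d) R, X (shift y W) ∂volume| + |ensMean μ X|) ∂μ :=
        integral_mono (hI.sub (integrable_const _)).abs (hI.abs.add (integrable_const _))
          fun W => abs_sub _ _
    _ = ∫ W, |⨍ y in ball (0:E d) R, X (shift y W) ∂volume| ∂μ + |ensMean μ X| := by
        rw [integral_add hI.abs (integrable_const _)]; simp
    _ ≤ ∫ W, |X W| ∂μ + ∫ W, |X W| ∂μ := by
        refine add_le_add ?_ abs_integral_le_integral_abs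
        simp only [setAverage_eq_integral_cond]
        exact integral_abs_integral_shift_le hstat _ hX
    _ = 2 * ∫ W, |X W| ∂μ := by ring

lemma deviation_add_le (hstat : IsStationary μ) {X Y : CoeffField d lam → ℝ}
    (hX : Integrable X μ) (hY : Integrable Y μ) {R : ℝ} (hR : 0 < R) :
    deviation μ (X + Y) R ≤ deviation μ X R + deviation μ Y R := by
  have := isProbabilityMeasure_cond_ball (d := d) hR
  have hIX := (integrable_average hstat hX hR).sub (integrable_const (ensMean μ X))
  have hIY := (integrable_average hstat hY hR).sub (integrable_const (ensMean μ Y))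
  have hIXY := (integrable_average hstat (hX.add hY) hR).sub
    (integrable_const (ensMean μ (X + Y)))
  refine le_of_le_of_eq ?_ (integral_add hIX.abs hIY.abs)
  refine integral_mono_ae hIXY.abs (hIX.abs.add hIY.abs) ?_
  filter_upwards [(integrable_shift_prod hstat
      (ProbabilityTheory.cond volume (ball (0:E d) R)) hX).prod_right_ae,
    (integrable_shift_prod hstat
      (ProbabilityTheory.cond volume (ball (0:E d) R)) hY).prod_right_ae] with W h1 h2
  simp only [Pi.add_apply, setAverage_eq_integral_cond, ensMean]
  rw [integral_add h1 h2, integral_add hX hY]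
  refine le_trans (le_of_eq ?_) (abs_add_le _ _)
  congr 1
  ring

lemma tendsto_deviation_add (hstat : IsStationary μ) {X Y : CoeffField d lam → ℝ}
    (hX : Integrable X μ) (hY : Integrable Y μ)
    (hX' : Tendsto (deviation μ X) atTop (nhds 0)) (hY' : Tendsto (deviation μ Y) atTop (nhds 0)) :
    Tendsto (deviation μ (X + Y)) atTop (nhds 0) := by
  have h := hX'.add hY'
  rw [add_zero] at h
  refine tendsto_of_tendsto_of_tendsto_of_le_of_le' tendsto_const_nhds h
    (.of_forall fun R => deviation_nonneg _ R) ?_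
  filter_upwards [eventually_gt_atTop 0] with R hR
  exact deviation_add_le hstat hX hY hR

/-- The functions with vanishing deviation are closed in `L¹`. -/
lemma tendsto_deviation_of_approx (hstat : IsStationary μ) {X : CoeffField d lam → ℝ}
    (hX : Integrable X μ)
    (h : ∀ ε > 0, ∃ Y, Integrable Y μ ∧ Tendsto (deviation μ Y) atTop (nhds 0) ∧
      ∫ W, |X W - Y W| ∂μ ≤ ε) :
    Tendsto (deviation μ X) atTop (nhds 0) := by
  rw [Metric.tendsto_nhds]
  intro ε hε
  obtain ⟨Y, hY, hYt, hXY⟩ := h (ε / 4) (by positivity)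
  filter_upwards [hYt.eventually_lt_const (show (0:ℝ) < ε / 2 by positivity),
    eventually_gt_atTop 0] with R hR hR0
  rw [Real.dist_0_eq_abs, abs_of_nonneg (deviation_nonneg _ _)]
  have h1 := deviation_add_le hstat hY (hX.sub hY) hR0
  have h2 := deviation_le_two_mul hstat (hX.sub hY) hR0
  simp only [Pi.sub_apply] at h2
  rw [add_sub_cancel] at h1
  linarith

end Average

section LocalEvents

variable {d : ℕ} {lam : ℝ}

lemma isLocalEvent_univ : IsLocalEvent (Set.univ : Set (CoeffField d lam)) := ⟨0, by simp⟩

lemma isLocalEvent_empty : IsLocalEvent (∅ : Set (CoeffField d lam)) := ⟨0, by simp⟩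

lemma IsLocalEvent.inter {S T : Set (CoeffField d lam)} (hS : IsLocalEvent S)
    (hT : IsLocalEvent T) : IsLocalEvent (S ∩ T) := by
  obtain ⟨r, hr⟩ := hS
  obtain ⟨s, hs⟩ := hT
  refine ⟨max r s, fun W W' h => and_congr (hr W W' fun x hx => h x ?_)
    (hs W W' fun x hx => h x ?_)⟩
  · exact ball_subset_ball (le_max_left r s) hx
  · exact ball_subset_ball (le_max_right r s) hx

lemma isLocalEvent_testIntegral_preimage (i j : Fin d) {χ : E d → ℝ} (hχ : IsTestFun d χ)
    (t : Set ℝ) :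
    IsLocalEvent ((fun W : CoeffField d lam => ∫ x : E d, W.A x i j * χ x) ⁻¹' t) := by
  obtain ⟨r, hr⟩ := hχ.2.isCompact.isBounded.subset_ball (0 : E d)
  refine ⟨r, fun W W' h => ?_⟩
  have : ∫ x : E d, W.A x i j * χ x = ∫ x : E d, W'.A x i j * χ x := by
    congr 1 with x
    by_cases hx : x ∈ tsupport χ
    · rw [h x (hr hx)]
    · simp [image_eq_zero_of_notMem_tsupport hx]
  simp [this]

lemma eq_generateFrom_localEvents :
    (inferInstance : MeasurableSpace (CoeffField d lam)) =
      MeasurableSpace.generateFrom {S | MeasurableSet S ∧ IsLocalEvent S} := by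
  refine le_antisymm ?_ (MeasurableSpace.generateFrom_le fun S hS => hS.1)
  refine iSup_le fun i => iSup_le fun j => iSup_le fun χ => iSup_le fun hχ => ?_
  rintro _ ⟨t, ht, rfl⟩
  exact MeasurableSpace.measurableSet_generateFrom
    ⟨measurable_testIntegral i j hχ ht, isLocalEvent_testIntegral_preimage i j hχ t⟩

lemma isPiSystem_localEvents :
    IsPiSystem {S : Set (CoeffField d lam) | MeasurableSet S ∧ IsLocalEvent S} :=
  fun _ hS _ hT _ => ⟨hS.1.inter hT.1, hS.2.inter hT.2⟩

/-- Averages of indicator functions of a local event have small oscillations. -/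
lemma exists_osc_average_le {S : Set (CoeffField d lam)} (hSm : MeasurableSet S)
    (hS : IsLocalEvent S) (ℓ : ℝ) :
    ∃ s > 0, ∀ R > 0, ∀ (z : E d) (W : CoeffField d lam),
      osc (ball z ℓ) (fun W => ⨍ y in ball (0:E d) R, S.indicator 1 (shift y W) ∂volume) W ≤
        (ball (0 : E d) (R + s)).indicator
          (fun _ => volume (ball (0 : E d) s) / volume (ball (0 : E d) R)) z := by
  obtain ⟨r, hr⟩ := hS
  refine ⟨|r| + |ℓ| + 1, by positivity, fun R hR z W => ?_⟩
  set s := |r| + |ℓ| + 1 with hs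
  have := isProbabilityMeasure_cond_ball (d := d) hR
  set ν := ProbabilityTheory.cond (volume : Measure (E d)) (ball 0 R) with hν
  have hint : ∀ W' : CoeffField d lam,
      Integrable (fun y => S.indicator (1 : CoeffField d lam → ℝ) (shift y W')) ν := fun W' => by
    refine Integrable.of_bound (C := 1) ?_ (.of_forall fun y => ?_)
    · exact ((measurable_one.indicator hSm).comp
        (measurable_shift_uncurry.comp measurable_prodMk_left)).aestronglyMeasurable
    · refine (norm_indicator_le_norm_self _ _).trans (by simp)
  unfold osc
  refine iSup_le fun W₁ => iSup_le fun h₁ => iSup_le fun W₂ => iSup_le fun h₂ => ?_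
  have hloc : ∀ y ∉ ball z s, S.indicator (1 : CoeffField d lam → ℝ) (shift y W₁) =
      S.indicator 1 (shift y W₂) := by
    intro y hy
    have hiff := hr (shift y W₁) (shift y W₂) fun x hx => by
      have hxz : x + y ∉ ball z ℓ := by
        intro hxy
        apply hy
        rw [mem_ball, dist_eq_norm] at *
        have : y - z = (x + y - z) - (x - 0) := by abel
        rw [this]
        have := norm_sub_le (x + y - z) (x - 0)
        linarith [le_abs_self r, le_abs_self ℓ]
      change W₁.A (x + y) = W₂.A (x + y)
      rw [h₁ _ hxz, h₂ _ hxz]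
    by_cases h : shift y W₁ ∈ S
    · simp [h, hiff.1 h]
    · simp [h, mt hiff.2 h]
  simp only [setAverage_eq_integral_cond, ← hν]
  rw [← integral_sub (hint W₁) (hint W₂)]
  have hle : ∫ y, (S.indicator (1 : CoeffField d lam → ℝ) (shift y W₁) - S.indicator 1 (shift y W₂)) ∂ν ≤
      ν.real (ball z s) := by
    rw [← integral_indicator_one measurableSet_ball]
    refine integral_mono ((hint W₁).sub (hint W₂))
      ((integrable_const (1 : ℝ)).indicator measurableSet_ball) fun y => ?_
    by_cases hy : y ∈ ball z s
    · simp only [Set.indicator_of_mem hy, Pi.one_apply]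
      have h1 : S.indicator (1 : CoeffField d lam → ℝ) (shift y W₁) ≤ 1 :=
        Set.indicator_le_self' (by simp) _
      have h2 : 0 ≤ S.indicator (1 : CoeffField d lam → ℝ) (shift y W₂) :=
        Set.indicator_nonneg (by simp) _
      linarith
    · simp only [Set.indicator_of_notMem hy, hloc y hy, sub_self, le_refl]
  refine (ENNReal.ofReal_le_ofReal hle).trans ?_
  rw [measureReal_def, ENNReal.ofReal_toReal (measure_ne_top _ _), hν,
    ProbabilityTheory.cond_apply measurableSet_ball, ENNReal.div_eq_inv_mul]
  by_cases hz : z ∈ ball (0 : E d) (R + s)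
  · rw [Set.indicator_of_mem hz]
    refine mul_le_mul' le_rfl ?_
    refine (measure_mono Set.inter_subset_right).trans ?_
    rw [Measure.addHaar_ball_center]
  · have : ball (0 : E d) R ∩ ball z s = ∅ := by
      rw [← Set.disjoint_iff_inter_eq_empty]
      refine ball_disjoint_ball ?_
      rw [mem_ball, not_lt, dist_comm] at hz
      exact hz
    simp [this]

lemma tendsto_volume_ball_atTop (hd : d ≠ 0) :
    Tendsto (fun R : ℝ => volume (ball (0 : E d) R)) atTop (nhds ∞) := by
  have : NeZero d := ⟨hd⟩
  have h : ∀ᶠ R : ℝ in atTop, ENNReal.ofReal (R ^ d) * volume (ball (0 : E d) 1) =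
      volume (ball (0 : E d) R) := by
    filter_upwards [eventually_ge_atTop 0] with R hR
    rw [Measure.addHaar_ball _ _ hR]
    simp
  refine Tendsto.congr' h ?_
  have h1 : Tendsto (fun R : ℝ => ENNReal.ofReal (R ^ d)) atTop (nhds ∞) :=
    ENNReal.tendsto_ofReal_atTop.comp (tendsto_pow_atTop hd)
  have h2 := ENNReal.Tendsto.mul_const (b := volume (ball (0 : E d) 1)) h1 (.inl ENNReal.top_ne_zero)
  rwa [ENNReal.top_mul (measure_ball_pos _ _ one_pos).ne'] at h2

variable {μ : Measure (CoeffField d lam)} [IsProbabilityMeasure μ]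

lemma tendsto_ensVar_average (hd : d ≠ 0) {ρ ℓ : ℝ} (hSG : SpectralGap μ ρ ℓ)
    {S : Set (CoeffField d lam)} (hSm : MeasurableSet S) (hS : IsLocalEvent S) :
    Tendsto (fun R : ℝ => ensVar μ
      fun W => ⨍ y in ball (0:E d) R, S.indicator 1 (shift y W) ∂volume) atTop (nhds 0) := by
  have : NeZero d := ⟨hd⟩
  obtain ⟨s, hs, hosc⟩ := exists_osc_average_le hSm hS ℓ
  set K := volume (ball (0 : E d) s) with hK
  have hKtop : K ≠ ∞ := measure_ball_lt_top.ne
  have hlim : Tendsto (fun R : ℝ => ENNReal.ofReal ρ⁻¹ *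
      (K ^ 2 * 2 ^ d * (volume (ball (0 : E d) R))⁻¹)) atTop (nhds 0) := by
    have h1 := tendsto_inv_iff.2 (tendsto_volume_ball_atTop hd)
    rw [ENNReal.inv_top] at h1
    have h2 := ENNReal.Tendsto.const_mul (a := K ^ 2 * 2 ^ d) h1
      (.inr (ENNReal.mul_ne_top (ENNReal.pow_ne_top hKtop) (by simp)))
    rw [mul_zero] at h2
    have h3 := ENNReal.Tendsto.const_mul (a := ENNReal.ofReal ρ⁻¹) h2 (.inr ENNReal.ofReal_ne_top)
    rwa [mul_zero] at h3
  refine tendsto_of_tendsto_of_tendsto_of_le_of_le' tendsto_const_nhds hlim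
    (.of_forall fun R => zero_le) ?_
  filter_upwards [eventually_ge_atTop s] with R hR
  have hR0 : 0 < R := hs.trans_le hR
  have := isProbabilityMeasure_cond_ball (d := d) hR0
  have hmeas : Measurable fun W : CoeffField d lam =>
      ⨍ y in ball (0:E d) R, S.indicator (1 : CoeffField d lam → ℝ) (shift y W) ∂volume := by
    simp only [setAverage_eq_integral_cond]
    exact (((measurable_one.indicator hSm).comp
      measurable_shift_uncurry).stronglyMeasurable.integral_prod_right').measurable
  refine (hSG _ hmeas).trans ?_
  gcongr
  set V := volume (ball (0 : E d) R) with hV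
  have hV0 : V ≠ 0 := (measure_ball_pos _ _ hR0).ne'
  have hVtop : V ≠ ∞ := measure_ball_lt_top.ne
  unfold outerE
  refine iInf_le_of_le (fun _ => K ^ 2 * 2 ^ d * V⁻¹) (iInf_le_of_le measurable_const
    (iInf_le_of_le (fun W => ?_) (by simp)))
  calc ∫⁻ z : E d, (osc (ball z ℓ)
        (fun W => ⨍ y in ball (0:E d) R, S.indicator 1 (shift y W) ∂volume) W) ^ 2
      ≤ ∫⁻ z : E d, (ball (0 : E d) (R + s)).indicator (fun _ => (K / V) ^ 2) z := by
        refine lintegral_mono fun z => (pow_le_pow_left' (hosc R hR0 z W) 2).trans ?_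
        by_cases hz : z ∈ ball (0 : E d) (R + s)
        · simp only [Set.indicator_of_mem hz, hV, le_refl]
        · simp only [Set.indicator_of_notMem hz]; simp
    _ = (K / V) ^ 2 * volume (ball (0 : E d) (R + s)) := by
        rw [lintegral_indicator_const measurableSet_ball]
    _ ≤ (K / V) ^ 2 * (2 ^ d * V) := by
        gcongr
        refine (measure_mono (ball_subset_ball (show R + s ≤ 2 * R by linarith))).trans ?_
        rw [Measure.addHaar_ball_mul _ _ zero_le_two]
        simp [ENNReal.ofReal_pow, hV]
    _ = K ^ 2 * 2 ^ d * (V⁻¹ * (V⁻¹ * V)) := by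
        rw [ENNReal.div_eq_inv_mul]; ring
    _ = K ^ 2 * 2 ^ d * V⁻¹ := by rw [ENNReal.inv_mul_cancel hV0 hVtop, mul_one]

lemma tendsto_deviation_localEvent (hd : d ≠ 0) (hstat : IsStationary μ) {ρ ℓ : ℝ}
    (hSG : SpectralGap μ ρ ℓ) {S : Set (CoeffField d lam)} (hSm : MeasurableSet S)
    (hS : IsLocalEvent S) :
    Tendsto (deviation μ (S.indicator 1)) atTop (nhds 0) := by
  have hint : Integrable (S.indicator (1 : CoeffField d lam → ℝ)) μ := integrable_indicator_one hSm
  rw [Metric.tendsto_nhds]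
  intro ε hε
  filter_upwards [(tendsto_ensVar_average hd hSG hSm hS).eventually_lt_const
    (show (0 : ℝ≥0∞) < ENNReal.ofReal ((ε / 4) ^ 2) by positivity),
    eventually_gt_atTop 0] with R hvar hR
  have := isProbabilityMeasure_cond_ball (d := d) hR
  have hI := (integrable_average hstat hint hR).sub
    (integrable_const (ensMean μ (S.indicator 1)))
  have hmean : ensMean μ (fun W => ⨍ y in ball (0:E d) R, S.indicator 1 (shift y W) ∂volume) =
      ensMean μ (S.indicator 1) := by
    simp only [ensMean, setAverage_eq_integral_cond]
    exact integral_integral_shift hstat _ hint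
  rw [ensVar, hmean] at hvar
  rw [Real.dist_0_eq_abs, abs_of_nonneg (deviation_nonneg _ _)]
  set Y : CoeffField d lam → ℝ := fun W =>
    (⨍ y in ball (0:E d) R, S.indicator 1 (shift y W) ∂volume) - ensMean μ (S.indicator 1)
  have hsq : Integrable (fun W => Y W ^ 2) μ := by
    refine ⟨hI.1.pow 2, ?_⟩
    rw [hasFiniteIntegral_iff_ofReal (.of_forall fun W => sq_nonneg _)]
    exact hvar.trans ENNReal.ofReal_lt_top
  have hsq' : ∫ W, Y W ^ 2 ∂μ < (ε / 4) ^ 2 := by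
    rw [← ofReal_integral_eq_lintegral_ofReal hsq (.of_forall fun W => sq_nonneg _)] at hvar
    exact (ENNReal.ofReal_lt_ofReal_iff (by positivity)).1 hvar
  calc ∫ W, |Y W| ∂μ ≤ ∫ W, (ε / 4 + (ε / 4)⁻¹ * Y W ^ 2) ∂μ := by
        refine integral_mono hI.abs ((integrable_const _).add (hsq.const_mul _)) fun W => ?_
        change |Y W| ≤ ε / 4 + (ε / 4)⁻¹ * Y W ^ 2
        rw [← sq_abs (Y W), inv_mul_eq_div, ← sub_le_iff_le_add', le_div_iff₀ (by positivity)]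
        nlinarith [sq_nonneg (|Y W| - ε / 4), abs_nonneg (Y W)]
    _ = ε / 4 + (ε / 4)⁻¹ * ∫ W, Y W ^ 2 ∂μ := by
        rw [integral_add (integrable_const _) (hsq.const_mul _), integral_const_mul]; simp
    _ ≤ ε / 4 + (ε / 4)⁻¹ * (ε / 4) ^ 2 := by gcongr
    _ = ε / 2 := by field_simp; ring
    _ < ε := by linarith

end LocalEvents

section MeanErgodic

variable {d : ℕ} {lam : ℝ} {μ : Measure (CoeffField d lam)} [IsProbabilityMeasure μ]

lemma tendsto_deviation_indicator_union (hstat : IsStationary μ) {S T : Set (CoeffField d lam)}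
    (hSm : MeasurableSet S) (hTm : MeasurableSet T) (hST : Disjoint S T)
    (hS : Tendsto (deviation μ (S.indicator 1)) atTop (nhds 0))
    (hT : Tendsto (deviation μ (T.indicator 1)) atTop (nhds 0)) :
    Tendsto (deviation μ ((S ∪ T).indicator 1)) atTop (nhds 0) := by
  have := tendsto_deviation_add hstat (integrable_indicator_one hSm)
    (integrable_indicator_one hTm) hS hT
  convert this using 2
  exact Set.indicator_union_of_disjoint hST _

lemma tendsto_deviation_indicator (hd : d ≠ 0) (hstat : IsStationary μ) {ρ ℓ : ℝ}
    (hSG : SpectralGap μ ρ ℓ) {S : Set (CoeffField d lam)} (hSm : MeasurableSet S) :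
    Tendsto (deviation μ (S.indicator 1)) atTop (nhds 0) := by
  induction S, hSm using MeasurableSpace.induction_on_inter eq_generateFrom_localEvents
    isPiSystem_localEvents with
  | empty => exact tendsto_deviation_localEvent hd hstat hSG .empty isLocalEvent_empty
  | basic S hS => exact tendsto_deviation_localEvent hd hstat hSG hS.1 hS.2
  | compl S hSm ih =>
    have h := tendsto_deviation_add hstat
      (integrable_indicator_one MeasurableSet.univ)
      ((integrable_indicator_one hSm).const_mul (-1))
      (tendsto_deviation_localEvent hd hstat hSG .univ isLocalEvent_univ)
      (tendsto_deviation_const_mul (-1) ih)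
    convert h using 2
    ext W
    by_cases hW : W ∈ S <;> simp [hW]
  | iUnion f hdisj hfm ih =>
    have haccm : ∀ n, MeasurableSet (Set.accumulate f n) := fun n =>
      MeasurableSet.biUnion (Set.to_countable _) fun i _ => hfm i
    have hacc : ∀ n, Tendsto (deviation μ ((Set.accumulate f n).indicator 1)) atTop (nhds 0) := by
      intro n
      induction n with
      | zero => simpa [Set.accumulate_zero_nat] using ih 0
      | succ n ihn =>
        rw [Set.accumulate_succ]
        refine tendsto_deviation_indicator_union hstat (haccm n) (hfm _) ?_ ihn (ih _)
        exact Set.disjoint_accumulate hdisj (Nat.lt_succ_self n)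
    have hUm : MeasurableSet (⋃ i, f i) := MeasurableSet.iUnion hfm
    refine tendsto_deviation_of_approx hstat (integrable_indicator_one hUm)
      fun ε hε => ?_
    have hlim : Tendsto (fun n => μ.real (Set.accumulate f n)) atTop (nhds (μ.real (⋃ i, f i))) :=
      (ENNReal.tendsto_toReal (measure_ne_top _ _)).comp tendsto_measure_iUnion_accumulate
    obtain ⟨n, hn⟩ := (hlim.eventually_const_lt
      (show μ.real (⋃ i, f i) - ε < μ.real (⋃ i, f i) by linarith)).exists
    refine ⟨(Set.accumulate f n).indicator 1, integrable_indicator_one (haccm n),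
      hacc n, ?_⟩
    have hsub : Set.accumulate f n ⊆ ⋃ i, f i := Set.accumulate_subset_iUnion n
    have heq : ∀ W, |(⋃ i, f i).indicator (1 : CoeffField d lam → ℝ) W - (Set.accumulate f n).indicator 1 W| =
        (⋃ i, f i).indicator (1 : CoeffField d lam → ℝ) W - (Set.accumulate f n).indicator 1 W := fun W =>
      abs_of_nonneg (sub_nonneg.2 (Set.indicator_le_indicator_of_subset hsub (by simp) W))
    simp only [heq]
    rw [integral_sub (integrable_indicator_one hUm)
      (integrable_indicator_one (haccm n)), integral_indicator_one hUm,
      integral_indicator_one (haccm n)]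
    linarith

lemma tendsto_deviation (hd : d ≠ 0) (hstat : IsStationary μ) {ρ ℓ : ℝ}
    (hSG : SpectralGap μ ρ ℓ) {X : CoeffField d lam → ℝ} (hX : Integrable X μ) :
    Tendsto (deviation μ X) atTop (nhds 0) := by
  refine Integrable.induction (fun X => Tendsto (deviation μ X) atTop (nhds 0))
    ?_ ?_ ?_ ?_ hX
  · intro c S hSm _
    convert tendsto_deviation_const_mul c (tendsto_deviation_indicator hd hstat hSG hSm) using 2
    ext W
    by_cases hW : W ∈ S <;> simp [hW]
  · intro X Y _ hX hY hX' hY'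
    exact tendsto_deviation_add hstat hX hY hX' hY'
  · refine isClosed_of_closure_subset fun X hX => ?_
    refine tendsto_deviation_of_approx hstat (L1.integrable_coeFn X) fun ε hε => ?_
    obtain ⟨Y, hY, hXY⟩ := Metric.mem_closure_iff.1 hX ε hε
    refine ⟨Y, L1.integrable_coeFn Y, hY, ?_⟩
    rw [L1.dist_eq_integral_dist] at hXY
    simpa [Real.dist_eq] using hXY.le
  · intro X Y hXY hX hX'
    refine tendsto_deviation_of_approx hstat (hX.congr hXY) fun ε hε => ⟨X, hX, hX', ?_⟩
    rw [integral_eq_zero_of_ae (by filter_upwards [hXY] with W hW; simp [hW])]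
    exact hε.le

/-- Mean convergence of spatial averages implies triviality of invariant events. -/
lemma measure_eq_zero_or_one_of_tendsto_deviation {S : Set (CoeffField d lam)}
    (hSm : MeasurableSet S) (hinv : ∀ z : E d, shift z ⁻¹' S = S)
    (hS : Tendsto (deviation μ (S.indicator 1)) atTop (nhds 0)) : μ S = 0 ∨ μ S = 1 := by
  have hind : ∀ (y : E d) (W : CoeffField d lam),
      S.indicator (1 : CoeffField d lam → ℝ) (shift y W) = S.indicator 1 W := fun y W => by
    conv_rhs => rw [← hinv y]
    rfl
  have hconst : ∀ᶠ R in atTop,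
      ∫ W, |S.indicator (1 : CoeffField d lam → ℝ) W - μ.real S| ∂μ = deviation μ (S.indicator 1) R := by
    filter_upwards [eventually_gt_atTop 0] with R hR
    have := isProbabilityMeasure_cond_ball (d := d) hR
    simp only [deviation, setAverage_eq_integral_cond, hind, ensMean,
      integral_indicator_one hSm]
    simp
  have hzero : ∫ W, |S.indicator (1 : CoeffField d lam → ℝ) W - μ.real S| ∂μ = 0 :=
    tendsto_nhds_unique tendsto_const_nhds (hS.congr' (hconst.mono fun _ h => h.symm))
  obtain ⟨W, hW⟩ := ((integral_eq_zero_iff_of_nonneg (fun _ => abs_nonneg _)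
    ((integrable_indicator_one hSm).sub (integrable_const _)).abs).1 hzero).exists
  have hW' : S.indicator (1 : CoeffField d lam → ℝ) W = μ.real S := sub_eq_zero.1 (abs_eq_zero.1 hW)
  by_cases h : W ∈ S
  · right
    rw [Set.indicator_of_mem h, Pi.one_apply, measureReal_def] at hW'
    exact (ENNReal.toReal_eq_one_iff _).1 hW'.symm
  · left
    rw [Set.indicator_of_notMem h] at hW'
    exact (measureReal_eq_zero_iff).1 hW'.symm

end MeanErgodic

/-- Lemma: (SG) implies ergodicity.
If a stationary ensemble satisfies (SG) with constants `ρ > 0` and `ℓ < ∞`, then it is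
ergodic: every shift-invariant event has probability `0` or `1`, and quantitatively, for every
`X ∈ L¹`, the spatial averages `⨍_{B_R} X̄(y,·) dy` of the stationary extension converge to
`⟨X⟩` in `L¹(⟨·⟩)` as `R ↑ ∞`. -/
theorem statement0 (d : ℕ) (hd : 2 ≤ d) (lam : ℝ) (hlam : 0 < lam) (hlam' : lam ≤ 1)
    (μ : Measure (CoeffField d lam)) (hprob : IsProbabilityMeasure μ)
    (hstat : IsStationary μ) (ρ ℓ : ℝ) (hρ : 0 < ρ) (hSG : SpectralGap μ ρ ℓ) :
    (∀ Ev : Set (CoeffField d lam), MeasurableSet Ev →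
      (∀ z : E d, shift z ⁻¹' Ev = Ev) → μ Ev = 0 ∨ μ Ev = 1) ∧
    (∀ X : CoeffField d lam → ℝ, Integrable X μ →
      Filter.Tendsto
        (fun R : ℝ =>
          ∫ W, |(⨍ y in ball (0:E d) R, X (shift y W) ∂volume) - ensMean μ X| ∂μ)
        Filter.atTop (nhds 0)) := by
  have hd0 : d ≠ 0 := by lia
  exact ⟨fun Ev hEv hinv => measure_eq_zero_or_one_of_tendsto_deviation hEv hinv
    (tendsto_deviation_indicator hd0 hstat hSG hEv),
    fun X hX => tendsto_deviation hd0 hstat hSG hX⟩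

end GO
end
end

section
/- Let A ∈ Ω, T > 0, fix R ≥ 1 (constants depending only on d, λ, R), and let x, z ∈ ℝ^d with |x−z| > R. Then for every Ã ∈ Ω with Ã = A on ℝ^d∖B_R(z), the Green functions satisfy ∫_{B_R(z)} |∇_y G_T(y,x;Ã)|² dy ≤ C ∫_{B_R(z)} |∇_y G_T(y,x;A)|² dy; i.e. the supremum of the left-hand side over all such Ã is controlled by the right-hand side. -/
open MeasureTheory Filter Metric Matrix ENNReal

noncomputable section

namespace GO

open scoped Convolution Topology

theorem continuous_integral_mul_comp_sub {d : ℕ} {g f : E d → ℝ} (hg : MemLp g 2)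
    (hf : MemLp f 2) : Continuous fun t : E d => ∫ ξ, g ξ * f (ξ - t) := by
  have hmp (t : E d) : MeasurePreserving (fun ξ : E d => ξ - t) volume volume :=
    measurePreserving_sub_right volume t
  let τ : E d → C(E d, E d) := fun t => ⟨fun ξ => ξ - t, by fun_prop⟩
  have hτ : Continuous τ :=
    ContinuousMap.continuous_of_continuous_uncurry _ (by
      change Continuous fun p : E d × E d => p.2 - p.1
      fun_prop)
  have hcont : Continuous fun t : E d =>
      Lp.compMeasurePreserving (fun ξ : E d => ξ - t) (hmp t) (hf.toLp f) :=
    continuous_const.compMeasurePreservingLp hτ hmp (by norm_num)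
  have hinner : Continuous fun t : E d =>
      inner ℝ (Lp.compMeasurePreserving (fun ξ : E d => ξ - t) (hmp t) (hf.toLp f))
        (hg.toLp g) := hcont.inner continuous_const
  refine hinner.congr fun t => ?_
  rw [L2.inner_def]
  refine integral_congr_ae ?_
  filter_upwards [Lp.coeFn_compMeasurePreserving (hf.toLp f) (hmp t), hg.coeFn_toLp,
    (hmp t).quasiMeasurePreserving.ae_eq_comp hf.coeFn_toLp] with ξ h1 h2 h3
  rw [h1, h2]
  simp only [Function.comp_apply] at h3 ⊢
  rw [h3]
  simp

theorem integral_mul_mollify {d : ℕ} {g f ρ : E d → ℝ} (hg : MemLp g 2) (hf : MemLp f 2)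
    (hρ : Continuous ρ) (hρc : HasCompactSupport ρ) :
    (Integrable fun ξ => g ξ * ∫ t, ρ t * f (ξ - t)) ∧
    ∫ ξ, g ξ * ∫ t, ρ t * f (ξ - t) = ∫ t, ρ t * ∫ ξ, g ξ * f (ξ - t) := by
  have hρi : Integrable ρ := hρ.integrable_of_hasCompactSupport hρc
  have hshift (t : E d) : MemLp (fun ξ => f (ξ - t)) 2 :=
    hf.comp_measurePreserving (measurePreserving_sub_right volume t)
  have hmeas : AEStronglyMeasurable (fun p : E d × E d => g p.2 * (ρ p.1 * f (p.2 - p.1)))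
      (volume.prod volume) := by
    have h1 : AEStronglyMeasurable (fun p : E d × E d => f (p.2 - p.1)) (volume.prod volume) :=
      hf.1.comp_quasiMeasurePreserving
        (quasiMeasurePreserving_sub_of_right_invariant volume volume |>.comp
          Measure.measurePreserving_swap.quasiMeasurePreserving)
    exact hg.1.comp_snd.mul ((hρ.aestronglyMeasurable.comp_fst).mul h1)
  have hint : Integrable (fun p : E d × E d => g p.2 * (ρ p.1 * f (p.2 - p.1)))
      (volume.prod volume) := by
    rw [integrable_prod_iff hmeas]
    constructor
    · refine Eventually.of_forall fun t => ?_
      have := ((hg.integrable_mul (hshift t)).const_mul (ρ t))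
      refine this.congr (Eventually.of_forall fun ξ => ?_)
      simp only [Pi.mul_apply]; ring
    · have hc := continuous_integral_mul_comp_sub hg.norm hf.norm
      have : Integrable fun t => ‖ρ t‖ * ∫ ξ, ‖g ξ‖ * ‖f (ξ - t)‖ :=
        (hρ.norm.mul hc).integrable_of_hasCompactSupport (hρc.norm.mul_right)
      refine this.congr (Eventually.of_forall fun t => ?_)
      simp only [← integral_const_mul, norm_mul]
      refine integral_congr_ae (Eventually.of_forall fun ξ => ?_)
      simp only; ring
  constructor
  · have := hint.integral_prod_right
    refine this.congr (Eventually.of_forall fun ξ => ?_)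
    simp only [integral_const_mul]
  · simp only [← integral_const_mul]
    rw [← integral_integral_swap (f := fun t ξ => g ξ * (ρ t * f (ξ - t))) hint]
    refine integral_congr_ae (Eventually.of_forall fun t => ?_)
    refine integral_congr_ae (Eventually.of_forall fun ξ => ?_)
    simp only; ring

theorem HasWeakGrad.gradAt_convolution {d : ℕ} {f : E d → ℝ} {Df : E d → Fin d → ℝ}
    (h : HasWeakGrad f Df) (hf : LocallyIntegrable f) {ρ : E d → ℝ} (hρ : IsTestFun d ρ)
    (ξ : E d) (i : Fin d) :
    gradAt (fun η => ∫ t, ρ t * f (η - t)) ξ i = ∫ t, ρ t * Df (ξ - t) i := by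
  have hρ1 : ContDiff ℝ 1 ρ := hρ.1.of_le (by exact_mod_cast le_top)
  have hd := hρ.2.hasFDerivAt_convolution_left (ContinuousLinearMap.lsmul ℝ ℝ) hρ1 hf ξ
  have he : (ρ ⋆[ContinuousLinearMap.lsmul ℝ ℝ, volume] f) = fun η => ∫ t, ρ t * f (η - t) := by
    ext η; simp [convolution_def]
  rw [he] at hd
  unfold gradAt
  rw [hd.fderiv, convolution_eq_swap]
  have hex : Integrable fun t => ((ContinuousLinearMap.lsmul ℝ ℝ :
      ℝ →L[ℝ] ℝ →L[ℝ] ℝ).precompL (E d)) (fderiv ℝ ρ (ξ - t)) (f t) := by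
    have := (hρ.2.fderiv ℝ).convolutionExists_left
      ((ContinuousLinearMap.lsmul ℝ ℝ : ℝ →L[ℝ] ℝ →L[ℝ] ℝ).precompL (E d))
      (hρ1.continuous_fderiv one_ne_zero) hf ξ
    exact this.integrable_swap
  rw [ContinuousLinearMap.integral_apply hex]
  have hχ : IsTestFun d fun s => ρ (ξ - s) := by
    refine ⟨hρ.1.comp (contDiff_const.sub contDiff_id), ?_⟩
    exact hρ.2.comp_homeomorph (Homeomorph.subLeft ξ)
  have hgrad (s : E d) : gradAt (fun s => ρ (ξ - s)) s i
      = - fderiv ℝ ρ (ξ - s) (EuclideanSpace.single i 1) := by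
    unfold gradAt
    have h1 : HasFDerivAt (fun s => ρ (ξ - s))
        ((fderiv ℝ ρ (ξ - s)).comp (- ContinuousLinearMap.id ℝ (E d))) s := by
      refine HasFDerivAt.comp s ((hρ1.differentiable one_ne_zero) (ξ - s)).hasFDerivAt ?_
      exact (hasFDerivAt_id s).const_sub ξ
    rw [h1.fderiv]; simp
  have hw := h _ hχ i
  simp only [hgrad, mul_neg, integral_neg, neg_inj] at hw
  rw [show (∫ t, ρ t * Df (ξ - t) i) = ∫ s, Df s i * ρ (ξ - s) by
    rw [← integral_sub_left_eq_self _ volume ξ]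
    simp [mul_comm]]
  rw [← hw]
  refine integral_congr_ae (Eventually.of_forall fun s => ?_)
  simp [ContinuousLinearMap.precompL_apply, mul_comm]

/-- A weak equation that holds for smooth test functions supported near the support of `f` may be
tested with `f` itself, if `f` and its weak gradient are square integrable. -/
theorem HasWeakGrad.test_eq_zero {d : ℕ} {f : E d → ℝ} {Df : E d → Fin d → ℝ}
    (h : HasWeakGrad f Df) (hf : MemLp f 2) (hDf : ∀ i, MemLp (fun ξ => Df ξ i) 2)
    (hfc : HasCompactSupport f) {g : E d → ℝ} {F : E d → Fin d → ℝ} (hg : MemLp g 2)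
    (hF : ∀ i, MemLp (fun ξ => F ξ i) 2) {ε : ℝ} (hε : 0 < ε)
    (heq : ∀ χ, IsTestFun d χ → (∀ ξ, χ ξ ≠ 0 → ∃ η ∈ tsupport f, dist ξ η < ε) →
      ∫ ξ, (g ξ * χ ξ + gradAt χ ξ ⬝ᵥ F ξ) = 0) :
    ∫ ξ, (g ξ * f ξ + Df ξ ⬝ᵥ F ξ) = 0 := by
  have hfl : LocallyIntegrable f := hf.locallyIntegrable (by norm_num)
  let φ : ℕ → ContDiffBump (0 : E d) := fun n =>
    ⟨ε / 2 / (n + 2), ε / (n + 2), by positivity, by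
      have : (0:ℝ) < ε / (n+2) := by positivity
      rw [div_right_comm]; linarith⟩
  have hφr : Tendsto (fun n => (φ n).rOut) atTop (𝓝 0) := by
    change Tendsto (fun n : ℕ => ε / ((n : ℝ) + 2)) atTop (𝓝 0)
    exact tendsto_const_nhds.div_atTop
      (tendsto_atTop_add_const_right _ _ tendsto_natCast_atTop_atTop)
  let ρ : ℕ → E d → ℝ := fun n => (φ n).normed volume
  have hρ (n) : IsTestFun d (ρ n) := ⟨(φ n).contDiff_normed, (φ n).hasCompactSupport_normed⟩
  have hlim {a b : E d → ℝ} (ha : MemLp a 2) (hb : MemLp b 2) :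
      Tendsto (fun n => ∫ ξ, a ξ * ∫ t, ρ n t * b (ξ - t)) atTop (𝓝 (∫ ξ, a ξ * b ξ)) := by
    have hc := (continuous_integral_mul_comp_sub ha hb).comp continuous_neg
    have := ContDiffBump.convolution_tendsto_right_of_continuous (μ := volume) hφr hc 0
    simp only [Function.comp_apply, neg_zero, sub_zero] at this
    refine this.congr fun n => ?_
    rw [(integral_mul_mollify ha hb (hρ n).1.continuous (hρ n).2).2]
    simp [convolution_def, ρ]
  have hL : Tendsto (fun n => (∫ ξ, g ξ * ∫ t, ρ n t * f (ξ - t)) +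
      ∑ i, ∫ ξ, F ξ i * ∫ t, ρ n t * Df (ξ - t) i) atTop
      (𝓝 ((∫ ξ, g ξ * f ξ) + ∑ i, ∫ ξ, F ξ i * Df ξ i)) :=
    (hlim hg hf).add (tendsto_finsetSum _ fun i _ => hlim (hF i) (hDf i))
  have hz (n : ℕ) : (∫ ξ, g ξ * ∫ t, ρ n t * f (ξ - t)) +
      ∑ i, ∫ ξ, F ξ i * ∫ t, ρ n t * Df (ξ - t) i = 0 := by
    have he : ((ρ n) ⋆[ContinuousLinearMap.lsmul ℝ ℝ, volume] f)
        = fun η => ∫ t, ρ n t * f (η - t) := by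
      ext η; simp [convolution_def]
    have hχ : IsTestFun d fun η => ∫ t, ρ n t * f (η - t) := by
      rw [← he]
      exact ⟨(hρ n).2.contDiff_convolution_left _ (hρ n).1 hfl, (hρ n).2.convolution _ hfc⟩
    have := heq _ hχ (by
      intro ξ hξ
      have hξ' : ((ρ n) ⋆[ContinuousLinearMap.lsmul ℝ ℝ, volume] f) ξ ≠ 0 := by
        rw [he]; exact hξ
      obtain ⟨s, hs, η, hη, rfl⟩ := support_convolution_subset _ hξ'
      refine ⟨η, subset_tsupport _ hη, ?_⟩
      have hs' : s ∈ ball (0 : E d) (φ n).rOut := by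
        rw [← (φ n).support_normed_eq (μ := volume)]; exact hs
      have h1 : (φ n).rOut < ε := by
        change ε / ((n : ℝ) + 2) < ε
        apply div_lt_self hε; linarith [(Nat.cast_nonneg n : (0:ℝ) ≤ n)]
      rw [dist_eq_norm]
      change ‖s + η - η‖ < ε
      rw [add_sub_cancel_right]
      exact (mem_ball_zero_iff.1 hs').trans h1)
    rw [← this, ← integral_finsetSum _ fun i _ =>
      (integral_mul_mollify (hF i) (hDf i) (hρ n).1.continuous (hρ n).2).1,
      ← integral_add (integral_mul_mollify hg hf (hρ n).1.continuous (hρ n).2).1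
        (integrable_finsetSum _ fun i _ =>
      (integral_mul_mollify (hF i) (hDf i) (hρ n).1.continuous (hρ n).2).1)]
    refine integral_congr_ae (Eventually.of_forall fun ξ => ?_)
    simp only [dotProduct, h.gradAt_convolution hfl (hρ n)]
    exact congrArg _ (Finset.sum_congr rfl fun i _ => mul_comm _ _)
  have h0 := tendsto_nhds_unique hL (by simp only [hz]; exact tendsto_const_nhds)
  have hFD (i : Fin d) : Integrable fun ξ => F ξ i * Df ξ i := (hF i).integrable_mul (hDf i)
  have hgf : Integrable fun ξ => g ξ * f ξ := hg.integrable_mul hf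
  rw [← h0, ← integral_finsetSum _ fun i _ => hFD i,
    ← integral_add hgf (integrable_finsetSum _ fun i _ => hFD i)]
  refine integral_congr_ae (Eventually.of_forall fun ξ => ?_)
  exact congrArg _ (Finset.sum_congr rfl fun i _ => mul_comm _ _)

section Gradients

variable {d : ℕ} {χ ψ : E d → ℝ}

theorem IsTestFun.differentiable (h : IsTestFun d χ) : Differentiable ℝ χ :=
  h.1.differentiable (by simp)

theorem IsTestFun.continuous (h : IsTestFun d χ) : Continuous χ := h.1.continuous

theorem IsTestFun.mul (h : IsTestFun d χ) (h' : IsTestFun d ψ) :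
    IsTestFun d fun ξ => χ ξ * ψ ξ :=
  ⟨h.1.mul h'.1, h.2.mul_right⟩

theorem IsTestFun.sub (h : IsTestFun d χ) (h' : IsTestFun d ψ) :
    IsTestFun d fun ξ => χ ξ - ψ ξ := by
  refine ⟨h.1.sub h'.1, HasCompactSupport.intro (h.2.isCompact.union h'.2.isCompact) ?_⟩
  intro ξ hξ
  rw [Set.mem_union, not_or] at hξ
  simp [image_eq_zero_of_notMem_tsupport hξ.1, image_eq_zero_of_notMem_tsupport hξ.2]

theorem IsTestFun.const_mul (c : ℝ) (h : IsTestFun d χ) : IsTestFun d fun ξ => c * χ ξ :=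
  ⟨contDiff_const.mul h.1, h.2.mul_left⟩

theorem gradAt_mul (h : IsTestFun d χ) (h' : IsTestFun d ψ) (ξ : E d) :
    gradAt (fun ξ => χ ξ * ψ ξ) ξ = χ ξ • gradAt ψ ξ + ψ ξ • gradAt χ ξ := by
  ext i
  simp [gradAt, fderiv_fun_mul (h.differentiable ξ) (h'.differentiable ξ)]

theorem gradAt_sub (h : IsTestFun d χ) (h' : IsTestFun d ψ) (ξ : E d) :
    gradAt (fun ξ => χ ξ - ψ ξ) ξ = gradAt χ ξ - gradAt ψ ξ := by
  ext i
  simp [gradAt, fderiv_fun_sub (h.differentiable ξ) (h'.differentiable ξ)]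

theorem gradAt_const_mul (c : ℝ) (h : IsTestFun d χ) (ξ : E d) :
    gradAt (fun ξ => c * χ ξ) ξ = c • gradAt χ ξ := by
  ext i
  simp [gradAt, fderiv_const_mul (h.differentiable ξ)]

theorem gradAt_eq_zero_of_eventuallyEq {c : ℝ} {ξ : E d} (h : χ =ᶠ[𝓝 ξ] fun _ => c) :
    gradAt χ ξ = 0 := by
  ext i
  simp [gradAt, h.fderiv_eq]

theorem gradAt_eq_zero_of_notMem_tsupport {ξ : E d} (h : ξ ∉ tsupport χ) : gradAt χ ξ = 0 :=
  gradAt_eq_zero_of_eventuallyEq (notMem_tsupport_iff_eventuallyEq.1 h)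

theorem IsTestFun.continuous_gradAt (h : IsTestFun d χ) (i : Fin d) :
    Continuous fun ξ => gradAt χ ξ i :=
  (h.1.continuous_fderiv (by simp)).clm_apply continuous_const

theorem IsTestFun.hasCompactSupport_gradAt (h : IsTestFun d χ) (i : Fin d) :
    HasCompactSupport fun ξ => gradAt χ ξ i := by
  refine HasCompactSupport.intro h.2 fun ξ hξ => ?_
  rw [gradAt_eq_zero_of_notMem_tsupport hξ]; rfl

theorem IsTestFun.integrable_mul (h : IsTestFun d χ) {f : E d → ℝ} (hf : LocallyIntegrable f) :
    Integrable fun ξ => f ξ * χ ξ := by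
  simpa [mul_comm] using hf.integrable_smul_left_of_hasCompactSupport h.continuous h.2

theorem IsTestFun.integrable_mul_gradAt (h : IsTestFun d χ) {f : E d → ℝ}
    (hf : LocallyIntegrable f) (i : Fin d) : Integrable fun ξ => f ξ * gradAt χ ξ i := by
  simpa [mul_comm] using
    hf.integrable_smul_left_of_hasCompactSupport (h.continuous_gradAt i)
      (h.hasCompactSupport_gradAt i)

theorem HasWeakGrad.mul_test {f : E d → ℝ} {Df : E d → Fin d → ℝ} (h : HasWeakGrad f Df)
    (hf : LocallyIntegrable f) (hDf : ∀ i, LocallyIntegrable fun ξ => Df ξ i)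
    (hχ : IsTestFun d χ) :
    HasWeakGrad (fun ξ => χ ξ * f ξ) (fun ξ => χ ξ • Df ξ + f ξ • gradAt χ ξ) := by
  intro ψ hψ i
  have h1 := h _ (hχ.mul hψ) i
  have hi1 : Integrable fun ξ => f ξ * gradAt (fun ξ => χ ξ * ψ ξ) ξ i :=
    (hχ.mul hψ).integrable_mul_gradAt hf i
  have hi2 : Integrable fun ξ => f ξ * (gradAt χ ξ i * ψ ξ) := by
    simpa [mul_comm] using hf.integrable_smul_left_of_hasCompactSupport
      ((hχ.continuous_gradAt i).mul hψ.continuous) hψ.2.mul_left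
  have hi3 : Integrable fun ξ => Df ξ i * (χ ξ * ψ ξ) := (hχ.mul hψ).integrable_mul (hDf i)
  calc ∫ ξ, χ ξ * f ξ * gradAt ψ ξ i
      = ∫ ξ, (f ξ * gradAt (fun ξ => χ ξ * ψ ξ) ξ i - f ξ * (gradAt χ ξ i * ψ ξ)) := by
        refine integral_congr_ae (Eventually.of_forall fun ξ => ?_)
        simp only [gradAt_mul hχ hψ, Pi.add_apply, Pi.smul_apply, smul_eq_mul]; ring
    _ = -((∫ ξ, Df ξ i * (χ ξ * ψ ξ)) + ∫ ξ, f ξ * (gradAt χ ξ i * ψ ξ)) := by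
        rw [integral_sub hi1 hi2, h1]; ring
    _ = _ := by
        rw [← integral_add hi3 hi2]
        congr 1
        refine integral_congr_ae (Eventually.of_forall fun ξ => ?_)
        simp only [Pi.add_apply, Pi.smul_apply, smul_eq_mul]; ring

theorem HasWeakGrad.sub {f g : E d → ℝ} {Df Dg : E d → Fin d → ℝ} (h : HasWeakGrad f Df)
    (h' : HasWeakGrad g Dg) (hf : LocallyIntegrable f)
    (hDf : ∀ i, LocallyIntegrable fun ξ => Df ξ i) (hg : LocallyIntegrable g)
    (hDg : ∀ i, LocallyIntegrable fun ξ => Dg ξ i) :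
    HasWeakGrad (fun ξ => f ξ - g ξ) (fun ξ => Df ξ - Dg ξ) := by
  intro ψ hψ i
  simp only [Pi.sub_apply, sub_mul]
  rw [integral_sub (hψ.integrable_mul_gradAt hf i) (hψ.integrable_mul_gradAt hg i),
    integral_sub (hψ.integrable_mul (hDf i)) (hψ.integrable_mul (hDg i)), h ψ hψ i, h' ψ hψ i]
  ring

end Gradients

section DotProduct

variable {d : ℕ}

theorem dotProduct_self_nonneg' (a : Fin d → ℝ) : 0 ≤ a ⬝ᵥ a :=
  Finset.sum_nonneg fun i _ => mul_self_nonneg (a i)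

theorem sq_le_dotProduct_self (a : Fin d → ℝ) (i : Fin d) : a i ^ 2 ≤ a ⬝ᵥ a := by
  rw [sq]
  exact Finset.single_le_sum (f := fun j => a j * a j) (fun j _ => mul_self_nonneg (a j))
    (Finset.mem_univ i)

theorem sq_dotProduct_le (a b : Fin d → ℝ) : (a ⬝ᵥ b) ^ 2 ≤ (a ⬝ᵥ a) * (b ⬝ᵥ b) := by
  simpa [dotProduct, sq] using Finset.sum_mul_sq_le_sq_mul_sq Finset.univ a b

theorem abs_dotProduct_le (a b : Fin d → ℝ) :
    |a ⬝ᵥ b| ≤ √(a ⬝ᵥ a) * √(b ⬝ᵥ b) := by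
  rw [← Real.sqrt_mul (dotProduct_self_nonneg' a)]
  exact Real.abs_le_sqrt (sq_dotProduct_le a b)

/-- The adjoint coefficient field. -/
def CoeffField.adjoint {lam : ℝ} (W : CoeffField d lam) : CoeffField d lam where
  A ξ := (W.A ξ)ᵀ
  measurable := by
    refine measurable_pi_lambda _ fun i => measurable_pi_lambda _ fun j => ?_
    exact (measurable_pi_apply i).comp ((measurable_pi_apply j).comp W.measurable)
  elliptic ξ := by
    obtain ⟨h1, h2⟩ := W.elliptic ξ
    refine ⟨fun a => ?_, fun a => ?_⟩
    · set b := (W.A ξ)ᵀ *ᵥ a with hb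
      have hbb : b ⬝ᵥ b = a ⬝ᵥ (W.A ξ *ᵥ b) := by
        nth_rewrite 2 [hb]
        rw [dotProduct_transpose_mulVec]
      have h3 := sq_dotProduct_le a (W.A ξ *ᵥ b)
      rw [← hbb] at h3
      have h4 := h1 b
      have ha := dotProduct_self_nonneg' a
      rcases (dotProduct_self_nonneg' b).eq_or_lt with h0 | h0
      · rw [← h0]; exact ha
      · by_contra! hc
        nlinarith
    · rw [dotProduct_transpose_mulVec, dotProduct_comm]
      exact h2 a

variable {lam : ℝ} (W : CoeffField d lam)

theorem CoeffField.measurable_apply (i j : Fin d) : Measurable fun ξ => W.A ξ i j :=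
  (measurable_pi_apply j).comp ((measurable_pi_apply i).comp W.measurable)

theorem CoeffField.abs_dotProduct_mulVec_le (ξ : E d) (a b : Fin d → ℝ) :
    |a ⬝ᵥ (W.A ξ *ᵥ b)| ≤ √(a ⬝ᵥ a) * √(b ⬝ᵥ b) :=
  (abs_dotProduct_le _ _).trans
    (mul_le_mul_of_nonneg_left (Real.sqrt_le_sqrt ((W.elliptic ξ).1 b)) (Real.sqrt_nonneg _))

end DotProduct

/-- Functions that are continuous off `p`, with a weak gradient that is locally square integrable
off `p`. -/
structure PuncturedH1 {d : ℕ} (p : E d) (f : E d → ℝ) (Df : E d → Fin d → ℝ) : Prop where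
  weakGrad : HasWeakGrad f Df
  cont : ContinuousOn f {p}ᶜ
  locInt : LocallyIntegrable f
  locIntGrad : ∀ i, LocallyIntegrable fun ξ => Df ξ i
  sqInt : ∀ K : Set (E d), IsCompact K → p ∉ K → IntegrableOn (fun ξ => Df ξ ⬝ᵥ Df ξ) K

section Punctured

variable {d : ℕ} {lam : ℝ} {p q : E d} {f : E d → ℝ} {Df : E d → Fin d → ℝ}

theorem integrableOn_mul {K : Set (E d)} {g h : E d → ℝ}
    (hg : MemLp g 2 (volume.restrict K)) (hh : MemLp h 2 (volume.restrict K)) :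
    IntegrableOn (fun ξ => g ξ * h ξ) K :=
  hg.integrable_mul hh

theorem integrable_mul_of_support {K : Set (E d)} (hK : IsCompact K) {ζ g : E d → ℝ}
    (hζ : Continuous ζ) (hs : ∀ ξ ∉ K, ζ ξ = 0) (hg : IntegrableOn g K) :
    Integrable fun ξ => ζ ξ * g ξ := by
  have h1 : IntegrableOn (fun ξ => ζ ξ * g ξ) K := hg.continuousOn_mul hζ.continuousOn hK
  refine (integrableOn_iff_integrable_of_support_subset ?_).1 h1
  intro ξ hξ
  by_contra hc
  exact hξ (by simp [hs ξ hc])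

namespace PuncturedH1

theorem aesm_grad (hf : PuncturedH1 p f Df) (i : Fin d) :
    AEStronglyMeasurable (fun ξ => Df ξ i) volume :=
  (hf.locIntGrad i).aestronglyMeasurable

theorem memLp_grad (hf : PuncturedH1 p f Df) {K : Set (E d)} (hK : IsCompact K) (hp : p ∉ K)
    (i : Fin d) :
    MemLp (fun ξ => Df ξ i) 2 (volume.restrict K) := by
  rw [memLp_two_iff_integrable_sq (hf.aesm_grad i).restrict]
  refine (hf.sqInt K hK hp).mono' ((hf.aesm_grad i).restrict.pow 2)
    (Eventually.of_forall fun ξ => ?_)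
  rw [Real.norm_of_nonneg (sq_nonneg _)]
  exact sq_le_dotProduct_self _ _

theorem memLp (hf : PuncturedH1 p f Df) {K : Set (E d)} (hK : IsCompact K) (hp : p ∉ K) :
    MemLp f 2 (volume.restrict K) := by
  have hsub : K ⊆ {p}ᶜ := fun ξ hξ h => hp (h ▸ hξ)
  have hc : ContinuousOn f K := hf.cont.mono hsub
  obtain ⟨M, hM⟩ := hK.exists_bound_of_continuousOn hc
  have : IsFiniteMeasure (volume.restrict K) := ⟨by simpa using hK.measure_lt_top⟩
  exact MemLp.of_bound (hc.aestronglyMeasurable hK.measurableSet) M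
    ((ae_restrict_iff' hK.measurableSet).2 (Eventually.of_forall hM))

theorem aesm_flux (hf : PuncturedH1 p f Df) (W : CoeffField d lam) (i : Fin d) :
    AEStronglyMeasurable (fun ξ => (W.A ξ *ᵥ Df ξ) i) volume := by
  simp only [mulVec, dotProduct]
  exact Finset.aestronglyMeasurable_fun_sum _ fun j _ =>
    (W.measurable_apply i j).aestronglyMeasurable.mul (hf.aesm_grad j)

theorem memLp_flux (hf : PuncturedH1 p f Df) (W : CoeffField d lam) {K : Set (E d)}
    (hK : IsCompact K) (hp : p ∉ K)
    (i : Fin d) : MemLp (fun ξ => (W.A ξ *ᵥ Df ξ) i) 2 (volume.restrict K) := by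
  rw [memLp_two_iff_integrable_sq (hf.aesm_flux W i).restrict]
  refine (hf.sqInt K hK hp).mono' ((hf.aesm_flux W i).restrict.pow 2)
    (Eventually.of_forall fun ξ => ?_)
  rw [Real.norm_of_nonneg (sq_nonneg _)]
  exact (sq_le_dotProduct_self _ _).trans ((W.elliptic ξ).1 _)

/-- Integrability of `∇g · A∇f` on compact sets away from the poles. -/
theorem integrableOn_dot_flux (hf : PuncturedH1 p f Df) {g : E d → ℝ} {Dg : E d → Fin d → ℝ}
    (hg : PuncturedH1 q g Dg)
    (W : CoeffField d lam) {K : Set (E d)} (hK : IsCompact K) (hp : p ∉ K) (hq : q ∉ K) :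
    IntegrableOn (fun ξ => Dg ξ ⬝ᵥ (W.A ξ *ᵥ Df ξ)) K :=
  integrable_finsetSum _ fun i _ => integrableOn_mul (hg.memLp_grad hK hq i)
    (hf.memLp_flux W hK hp i)

theorem integrable_gradAt_flux (hf : PuncturedH1 p f Df) {g : E d → ℝ} {Dg : E d → Fin d → ℝ}
    (hg : PuncturedH1 q g Dg)
    (W : CoeffField d lam) {ζ : E d → ℝ} (hζ : IsTestFun d ζ) {K : Set (E d)}
    (hK : IsCompact K) (hs : ∀ ξ ∉ K, gradAt ζ ξ = 0) (hp : p ∉ K) (hq : q ∉ K) :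
    Integrable fun ξ => g ξ * (gradAt ζ ξ ⬝ᵥ (W.A ξ *ᵥ Df ξ)) := by
  have : ∀ i, Integrable fun ξ => gradAt ζ ξ i * (g ξ * (W.A ξ *ᵥ Df ξ) i) := fun i =>
    integrable_mul_of_support hK (hζ.continuous_gradAt i) (fun ξ hξ => by rw [hs ξ hξ]; rfl)
      (integrableOn_mul (hg.memLp hK hq) (hf.memLp_flux W hK hp i))
  refine (integrable_finsetSum Finset.univ fun i _ => this i).congr
    (Eventually.of_forall fun ξ => ?_)
  simp only [dotProduct, Finset.mul_sum]
  exact Finset.sum_congr rfl fun i _ => by ring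

end PuncturedH1

/-- A fundamental solution of `T⁻¹ - ∇·A∇` with pole at `p`. -/
structure FundSol (W : CoeffField d lam) (T : ℝ) (p : E d) (f : E d → ℝ)
    (Df : E d → Fin d → ℝ) : Prop extends PuncturedH1 p f Df where
  eqn : ∀ χ, IsTestFun d χ →
    ∫ ξ, (T⁻¹ * f ξ * χ ξ + gradAt χ ξ ⬝ᵥ (W.A ξ).mulVec (Df ξ)) = χ p

theorem FundSol.test {W : CoeffField d lam} {T : ℝ} {u : E d → ℝ} {Du : E d → Fin d → ℝ}
    (hu : FundSol W T p u Du) (hf : PuncturedH1 q f Df) {ζ : E d → ℝ} (hζ : IsTestFun d ζ)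
    (hp : p ∉ tsupport ζ) (hq : q ∉ tsupport ζ) :
    ∫ ξ, (T⁻¹ * (ζ ξ * (u ξ * f ξ)) + ζ ξ * (Df ξ ⬝ᵥ (W.A ξ *ᵥ Du ξ)) +
      f ξ * (gradAt ζ ξ ⬝ᵥ (W.A ξ *ᵥ Du ξ))) = 0 := by
  obtain ⟨ε, hε, hεp⟩ := hζ.2.isCompact.exists_cthickening_subset_open
    (isOpen_compl_singleton (x := p)) fun ξ hξ h => hp (h ▸ hξ)
  set K := cthickening ε (tsupport ζ) with hKdef
  have hK : IsCompact K := hζ.2.isCompact.cthickening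
  have hpK : p ∉ K := fun h => hεp h rfl
  have hζK : tsupport ζ ⊆ K := self_subset_cthickening _
  have hS := hζ.2.isCompact
  have hζ0 : ∀ ξ ∉ tsupport ζ, ζ ξ = 0 := fun ξ hξ => image_eq_zero_of_notMem_tsupport hξ
  have hbd : ∀ {c h : E d → ℝ}, Continuous c → (∀ ξ ∉ tsupport ζ, c ξ = 0) →
      MemLp h 2 (volume.restrict (tsupport ζ)) → MemLp (fun ξ => c ξ * h ξ) 2 := by
    intro c h hc hc0 hh
    obtain ⟨M, hM⟩ := hS.exists_bound_of_continuousOn hc.continuousOn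
    have h1 : MemLp (fun ξ => c ξ * h ξ) 2 (volume.restrict (tsupport ζ)) := by
      refine hh.of_le_mul (c := M) (hc.aestronglyMeasurable.mul hh.1) ?_
      refine (ae_restrict_iff' hS.measurableSet).2 (Eventually.of_forall fun ξ hξ => ?_)
      rw [norm_mul]
      exact mul_le_mul_of_nonneg_right (hM ξ hξ) (norm_nonneg _)
    rw [← memLp_indicator_iff_restrict hS.measurableSet] at h1
    refine h1.ae_eq (Eventually.of_forall fun ξ => ?_)
    by_cases hξ : ξ ∈ tsupport ζ
    · simp [hξ]
    · simp [hξ, hc0 ξ hξ]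
  have hwg := hf.weakGrad.mul_test hf.locInt hf.locIntGrad hζ
  have key := hwg.test_eq_zero (g := K.indicator fun ξ => T⁻¹ * u ξ)
    (F := fun ξ i => K.indicator (fun ξ => (W.A ξ *ᵥ Du ξ) i) ξ)
    (hbd hζ.continuous hζ0 (hf.memLp hS hq))
    (fun i => (hbd hζ.continuous hζ0 (hf.memLp_grad hS hq i)).add (by
      have := hbd (hζ.continuous_gradAt i)
        (fun ξ hξ => by rw [gradAt_eq_zero_of_notMem_tsupport hξ]; rfl) (hf.memLp hS hq)
      refine this.ae_eq (Eventually.of_forall fun ξ => ?_)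
      simp [mul_comm]))
    hζ.2.mul_right
    ((memLp_indicator_iff_restrict hK.measurableSet).2 ((hu.memLp hK hpK).const_mul _))
    (fun i => (memLp_indicator_iff_restrict hK.measurableSet).2 (hu.memLp_flux W hK hpK i))
    hε ?_
  · rw [← key]
    refine integral_congr_ae (Eventually.of_forall fun ξ => ?_)
    by_cases hξ : ξ ∈ K
    · simp only [Set.indicator_of_mem hξ, add_dotProduct, smul_dotProduct, smul_eq_mul]
      ring
    · have h1 : ξ ∉ tsupport ζ := fun h => hξ (hζK h)
      simp [hζ0 ξ h1, gradAt_eq_zero_of_notMem_tsupport h1]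
  · intro χ hχ hsupp
    have hχK : tsupport χ ⊆ K := by
      refine closure_minimal ?_ isClosed_cthickening
      intro ξ hξ
      obtain ⟨η, hη, hd⟩ := hsupp ξ hξ
      exact mem_cthickening_of_dist_le ξ η ε _
        (closure_mono (Function.support_mul_subset_left _ _) hη) hd.le
    have h0 : ∀ ξ ∉ K, χ ξ = 0 := fun ξ hξ =>
      image_eq_zero_of_notMem_tsupport fun h => hξ (hχK h)
    rw [← h0 p hpK, ← hu.eqn χ hχ]
    refine integral_congr_ae (Eventually.of_forall fun ξ => ?_)
    by_cases hξ : ξ ∈ K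
    · simp only [Set.indicator_of_mem hξ]
    · simp [h0 ξ hξ, gradAt_eq_zero_of_notMem_tsupport fun h => hξ (hχK h)]

end Punctured

section Cutoff

variable {d : ℕ}

/-- A smooth radial cutoff around `p` at scale `r`. -/
def cut (p : E d) (r : ℝ) (ξ : E d) : ℝ := Real.smoothTransition (2 - ‖ξ - p‖ ^ 2 / r ^ 2)

theorem cut_nonneg (p : E d) (r : ℝ) (ξ : E d) : 0 ≤ cut p r ξ := Real.smoothTransition.nonneg _

theorem cut_le_one (p : E d) (r : ℝ) (ξ : E d) : cut p r ξ ≤ 1 := Real.smoothTransition.le_one _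

theorem cut_eq_one {p : E d} {r : ℝ} (hr : 0 < r) {ξ : E d} (h : dist ξ p ≤ r) :
    cut p r ξ = 1 := by
  apply Real.smoothTransition.one_of_one_le
  rw [dist_eq_norm] at h
  have : ‖ξ - p‖ ^ 2 / r ^ 2 ≤ 1 := by
    rw [div_le_one (by positivity)]
    exact pow_le_pow_left₀ (norm_nonneg _) h 2
  linarith

theorem cut_eq_zero {p : E d} {r : ℝ} (hr : 0 < r) {ξ : E d} (h : 3 / 2 * r ≤ dist ξ p) :
    cut p r ξ = 0 := by
  apply Real.smoothTransition.zero_of_nonpos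
  rw [dist_eq_norm] at h
  have : 2 ≤ ‖ξ - p‖ ^ 2 / r ^ 2 := by
    rw [le_div_iff₀ (by positivity)]
    nlinarith
  linarith

theorem isTestFun_cut (p : E d) {r : ℝ} (hr : 0 < r) : IsTestFun d (cut p r) := by
  constructor
  · exact Real.smoothTransition.contDiff.comp
      (contDiff_const.sub (((contDiff_id.sub contDiff_const).norm_sq ℝ).div_const _))
  · refine HasCompactSupport.intro (isCompact_closedBall p (3 / 2 * r)) fun ξ hξ => ?_
    exact cut_eq_zero hr (not_le.1 hξ).le

theorem gradAt_cut_eq_zero {p : E d} {r : ℝ} (hr : 0 < r) {ξ : E d}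
    (h : dist ξ p < r ∨ 3 / 2 * r < dist ξ p) : gradAt (cut p r) ξ = 0 := by
  rcases h with h | h
  · refine gradAt_eq_zero_of_eventuallyEq (c := 1) ?_
    filter_upwards [isOpen_ball.mem_nhds (mem_ball.2 h)] with η hη
    exact cut_eq_one hr (mem_ball.1 hη).le
  · refine gradAt_eq_zero_of_eventuallyEq (c := 0) ?_
    have : IsOpen {η : E d | 3 / 2 * r < dist η p} := isOpen_lt (by fun_prop) (by fun_prop)
    filter_upwards [this.mem_nhds h] with η hη
    exact cut_eq_zero hr (le_of_lt hη)

theorem gradAt_cut (p : E d) (r : ℝ) (ξ : E d) (i : Fin d) :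
    gradAt (cut p r) ξ i =
      deriv Real.smoothTransition (2 - ‖ξ - p‖ ^ 2 / r ^ 2) * (-(2 * (ξ - p) i / r ^ 2)) := by
  have h1 : HasFDerivAt (fun ξ : E d => ‖ξ - p‖ ^ 2) (2 • (innerSL ℝ (ξ - p))) ξ := by
    simpa using ((hasFDerivAt_id ξ).sub_const p).norm_sq
  have h2 : HasFDerivAt (fun ξ : E d => 2 - ‖ξ - p‖ ^ 2 / r ^ 2)
      (-((r ^ 2)⁻¹ • (2 • (innerSL ℝ (ξ - p))))) ξ := by
    have := (h1.const_mul (r ^ 2)⁻¹).const_sub 2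
    simpa [div_eq_inv_mul] using this
  have h3 : HasDerivAt Real.smoothTransition _ (2 - ‖ξ - p‖ ^ 2 / r ^ 2) :=
    ((Real.smoothTransition.contDiff (n := 1)).differentiable one_ne_zero _).hasDerivAt
  have h4 := h3.comp_hasFDerivAt ξ h2
  unfold gradAt
  rw [show cut p r = Real.smoothTransition ∘ fun ξ : E d => 2 - ‖ξ - p‖ ^ 2 / r ^ 2 from rfl,
    h4.fderiv]
  simp [EuclideanSpace.inner_single_right]
  left; ring

theorem exists_bound_deriv_smoothTransition : ∃ M, ∀ t, |deriv Real.smoothTransition t| ≤ M := by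
  have hc : Continuous (deriv Real.smoothTransition) :=
    (Real.smoothTransition.contDiff (n := 1)).continuous_deriv le_rfl
  obtain ⟨M, hM⟩ := isCompact_Icc.exists_bound_of_continuousOn
    (s := Set.Icc (0 : ℝ) 1) hc.continuousOn
  refine ⟨M, fun t => ?_⟩
  have hM0 : 0 ≤ M := (norm_nonneg _).trans (hM 0 (by simp))
  by_cases ht : t ∈ Set.Icc (0 : ℝ) 1
  · exact hM t ht
  · have : deriv Real.smoothTransition t = 0 := by
      rw [Set.mem_Icc, not_and_or, not_le, not_le] at ht
      rcases ht with ht | ht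
      · rw [(Filter.EventuallyEq.deriv_eq (f := fun _ => (0 : ℝ)) ?_), deriv_const]
        filter_upwards [Iio_mem_nhds ht] with s hs
        exact Real.smoothTransition.zero_of_nonpos (le_of_lt hs)
      · rw [(Filter.EventuallyEq.deriv_eq (f := fun _ => (1 : ℝ)) ?_), deriv_const]
        filter_upwards [Ioi_mem_nhds ht] with s hs
        exact Real.smoothTransition.one_of_one_le (le_of_lt hs)
    rw [this, abs_zero]; exact hM0

theorem exists_gradAt_cut_bound (d : ℕ) : ∃ K : ℝ, 0 < K ∧ ∀ (p : E d) (r : ℝ), 0 < r →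
    ∀ ξ, gradAt (cut p r) ξ ⬝ᵥ gradAt (cut p r) ξ ≤ K / r ^ 2 := by
  obtain ⟨M, hM⟩ := exists_bound_deriv_smoothTransition
  refine ⟨9 * M ^ 2 + 1, by positivity, fun p r hr ξ => ?_⟩
  by_cases h : dist ξ p < r ∨ 3 / 2 * r < dist ξ p
  · rw [gradAt_cut_eq_zero hr h]
    simp only [dotProduct_zero]; positivity
  · push Not at h
    set m := deriv Real.smoothTransition (2 - ‖ξ - p‖ ^ 2 / r ^ 2) with hm
    have h1 : gradAt (cut p r) ξ ⬝ᵥ gradAt (cut p r) ξ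
        = m ^ 2 * (4 * ‖ξ - p‖ ^ 2 / r ^ 4) := by
      simp only [dotProduct, gradAt_cut, ← hm]
      rw [EuclideanSpace.real_norm_sq_eq, Finset.mul_sum, Finset.sum_div, Finset.mul_sum]
      refine Finset.sum_congr rfl fun i _ => ?_
      field_simp
      ring
    have h2 : m ^ 2 ≤ M ^ 2 := sq_le_sq' (by linarith [(abs_le.1 (hM (2 - ‖ξ - p‖ ^ 2 / r ^ 2))).1])
      (abs_le.1 (hM _)).2
    have h3 : ‖ξ - p‖ ^ 2 ≤ (3 / 2 * r) ^ 2 := by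
      rw [dist_eq_norm] at h
      exact pow_le_pow_left₀ (norm_nonneg _) h.2 2
    rw [h1]
    calc m ^ 2 * (4 * ‖ξ - p‖ ^ 2 / r ^ 4) ≤ M ^ 2 * (4 * (3 / 2 * r) ^ 2 / r ^ 4) := by gcongr
      _ = 9 * M ^ 2 / r ^ 2 := by field_simp; ring
      _ ≤ _ := by gcongr; linarith

/-- The logarithmic cutoff: an average of dyadic cutoffs. -/
def logCut (p : E d) (r : ℝ) (m : ℕ) (ξ : E d) : ℝ :=
  (m : ℝ)⁻¹ * ∑ j ∈ Finset.range m, cut p (r / 2 ^ j) ξ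

theorem IsTestFun.sum {ι : Type*} (s : Finset ι) {χ : ι → E d → ℝ}
    (h : ∀ j ∈ s, IsTestFun d (χ j)) : IsTestFun d fun ξ => ∑ j ∈ s, χ j ξ := by
  refine ⟨ContDiff.sum fun j hj => (h j hj).1, ?_⟩
  refine HasCompactSupport.intro (s.isCompact_biUnion fun j hj => (h j hj).2.isCompact) ?_
  intro ξ hξ
  simp only [Set.mem_iUnion, not_exists] at hξ
  exact Finset.sum_eq_zero fun j hj => image_eq_zero_of_notMem_tsupport (hξ j hj)

theorem gradAt_sum {ι : Type*} (s : Finset ι) {χ : ι → E d → ℝ}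
    (h : ∀ j ∈ s, IsTestFun d (χ j)) (ξ : E d) :
    gradAt (fun ξ => ∑ j ∈ s, χ j ξ) ξ = ∑ j ∈ s, gradAt (χ j) ξ := by
  ext i
  simp only [gradAt, Finset.sum_apply]
  rw [fderiv_fun_sum fun j hj => (h j hj).differentiable ξ]
  simp

variable {p : E d} {r : ℝ} {m : ℕ} {ξ : E d}

theorem isTestFun_logCut (p : E d) (hr : 0 < r) (m : ℕ) : IsTestFun d (logCut p r m) :=
  IsTestFun.const_mul _ (IsTestFun.sum _ fun _ _ => isTestFun_cut p (by positivity))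

theorem logCut_nonneg : 0 ≤ logCut p r m ξ :=
  mul_nonneg (by positivity) (Finset.sum_nonneg fun _ _ => cut_nonneg _ _ _)

theorem logCut_le_one : logCut p r m ξ ≤ 1 := by
  have h : ∑ j ∈ Finset.range m, cut p (r / 2 ^ j) ξ ≤ m := by
    simpa using Finset.sum_le_sum fun j (_ : j ∈ Finset.range m) => cut_le_one p (r / 2 ^ j) ξ
  rcases m.eq_zero_or_pos with rfl | hm
  · simp [logCut]
  · unfold logCut
    rw [inv_mul_le_one₀ (by positivity)]
    exact h

theorem logCut_eq_one (hr : 0 < r) (hm : 0 < m) (h : dist ξ p ≤ r / 2 ^ m) :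
    logCut p r m ξ = 1 := by
  unfold logCut
  rw [Finset.sum_congr rfl (g := fun _ => (1 : ℝ))]
  · have : (m : ℝ) ≠ 0 := by positivity
    simp [this]
  · intro j hj
    refine cut_eq_one (by positivity) (h.trans ?_)
    have : j ≤ m := (Finset.mem_range.1 hj).le
    gcongr
    norm_num

theorem logCut_eq_zero (hr : 0 < r) (h : 3 / 2 * r ≤ dist ξ p) : logCut p r m ξ = 0 := by
  unfold logCut
  rw [Finset.sum_eq_zero, mul_zero]
  intro j _
  refine cut_eq_zero (by positivity) (le_trans ?_ h)
  have : r / 2 ^ j ≤ r := div_le_self hr.le (one_le_pow₀ (by norm_num))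
  linarith

theorem gradAt_logCut_eq_zero (hr : 0 < r)
    (h : dist ξ p < r / 2 ^ m ∨ 3 / 2 * r < dist ξ p) : gradAt (logCut p r m) ξ = 0 := by
  rcases m.eq_zero_or_pos with rfl | hm
  · refine gradAt_eq_zero_of_eventuallyEq (c := 0) (Eventually.of_forall fun η => ?_)
    simp [logCut]
  rcases h with h | h
  · refine gradAt_eq_zero_of_eventuallyEq (c := 1) ?_
    filter_upwards [isOpen_ball.mem_nhds (mem_ball.2 h)] with η hη
    exact logCut_eq_one hr hm (mem_ball.1 hη).le
  · refine gradAt_eq_zero_of_eventuallyEq (c := 0) ?_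
    have : IsOpen {η : E d | 3 / 2 * r < dist η p} := isOpen_lt (by fun_prop) (by fun_prop)
    filter_upwards [this.mem_nhds h] with η hη
    exact logCut_eq_zero hr (le_of_lt hη)

/-- The dyadic shells carrying the gradients of the dyadic cutoffs are disjoint. -/
theorem dyadic_shell_unique {r t : ℝ} (hr : 0 < r) {j k : ℕ}
    (hj : r / 2 ^ j ≤ t ∧ t ≤ 3 / 2 * (r / 2 ^ j)) (hk : r / 2 ^ k ≤ t ∧ t ≤ 3 / 2 * (r / 2 ^ k)) :
    j = k := by
  have key : ∀ {j k : ℕ}, r / 2 ^ j ≤ t → t ≤ 3 / 2 * (r / 2 ^ k) → k ≤ j := by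
    intro j k h1 h2
    by_contra! hc
    have h3 : (2 : ℝ) ^ (j + 1) ≤ 2 ^ k := pow_le_pow_right₀ (by norm_num) hc
    have h4 : r / 2 ^ k ≤ r / 2 ^ (j + 1) := by gcongr
    rw [pow_succ, ← div_div] at h4
    have : 0 < r / 2 ^ j := by positivity
    linarith
  exact le_antisymm (key hk.1 hj.2) (key hj.1 hk.2)

theorem gradAt_logCut_dotProduct_self (hr : 0 < r) :
    gradAt (logCut p r m) ξ ⬝ᵥ gradAt (logCut p r m) ξ =
      ((m : ℝ)⁻¹) ^ 2 * ∑ j ∈ Finset.range m,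
        gradAt (cut p (r / 2 ^ j)) ξ ⬝ᵥ gradAt (cut p (r / 2 ^ j)) ξ := by
  have hc (j : ℕ) : IsTestFun d (cut p (r / 2 ^ j)) := isTestFun_cut p (by positivity)
  have h1 : gradAt (logCut p r m) ξ =
      (m : ℝ)⁻¹ • ∑ j ∈ Finset.range m, gradAt (cut p (r / 2 ^ j)) ξ := by
    rw [← gradAt_sum _ fun j _ => hc j]
    exact gradAt_const_mul _ (IsTestFun.sum _ fun j _ => hc j) ξ
  rw [h1, smul_dotProduct, dotProduct_smul, smul_smul, smul_eq_mul, ← sq, sum_dotProduct]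
  congr 1
  refine Finset.sum_congr rfl fun j hj => ?_
  rw [dotProduct_sum]
  refine Finset.sum_eq_single_of_mem j hj fun k _ hkj => ?_
  by_contra hne
  have hshell : ∀ i, gradAt (cut p (r / 2 ^ i)) ξ ≠ 0 →
      r / 2 ^ i ≤ dist ξ p ∧ dist ξ p ≤ 3 / 2 * (r / 2 ^ i) := by
    intro i hi
    by_contra hcon
    rw [not_and_or, not_le, not_le] at hcon
    exact hi (gradAt_cut_eq_zero (by positivity) hcon)
  exact hkj (dyadic_shell_unique hr
    (hshell k fun h => hne (by rw [h, dotProduct_zero]))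
    (hshell j fun h => hne (by rw [h, zero_dotProduct])))

theorem IsTestFun.integrable_gradAt_sq {χ : E d → ℝ} (h : IsTestFun d χ) :
    Integrable fun ξ => gradAt χ ξ ⬝ᵥ gradAt χ ξ :=
  integrable_finsetSum _ fun i _ => ((h.continuous_gradAt i).mul
    (h.continuous_gradAt i)).integrable_of_hasCompactSupport
      (h.hasCompactSupport_gradAt i).mul_right

theorem exists_integral_gradAt_logCut_le (d : ℕ) (hd : 2 ≤ d) : ∃ K : ℝ, 0 < K ∧
    ∀ (p : E d) (r : ℝ), 0 < r → ∀ m : ℕ,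
      ∫ ξ, gradAt (logCut p r m) ξ ⬝ᵥ gradAt (logCut p r m) ξ ≤ K * r ^ (d - 2) / m := by
  obtain ⟨K, hK, hb⟩ := exists_gradAt_cut_bound d
  set V := (volume (ball (0 : E d) 1)).toReal with hV
  have hcut : ∀ (p : E d) (r : ℝ), 0 < r →
      ∫ ξ, gradAt (cut p r) ξ ⬝ᵥ gradAt (cut p r) ξ ≤ K * 2 ^ d * V * r ^ (d - 2) := by
    intro p r hr
    have hsub : ∀ ξ ∉ ball p (2 * r), gradAt (cut p r) ξ ⬝ᵥ gradAt (cut p r) ξ = 0 := by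
      intro ξ hξ
      rw [gradAt_cut_eq_zero hr (Or.inr (by rw [mem_ball, not_lt] at hξ; linarith)),
        dotProduct_zero]
    rw [← setIntegral_eq_integral_of_forall_compl_eq_zero hsub]
    calc ∫ ξ in ball p (2 * r), gradAt (cut p r) ξ ⬝ᵥ gradAt (cut p r) ξ
        ≤ ∫ ξ in ball p (2 * r), K / r ^ 2 :=
          setIntegral_mono (isTestFun_cut p hr).integrable_gradAt_sq.integrableOn
            (integrableOn_const measure_ball_lt_top.ne) (hb p r hr)
      _ = (2 * r) ^ d * V * (K / r ^ 2) := by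
          rw [setIntegral_const, measureReal_def, Measure.addHaar_ball_of_pos _ _ (by positivity),
            ENNReal.toReal_mul, ENNReal.toReal_ofReal (by positivity), finrank_euclideanSpace_fin,
            smul_eq_mul]
      _ = K * 2 ^ d * V * r ^ (d - 2) := by
          obtain ⟨e, rfl⟩ := Nat.exists_eq_add_of_le hd
          rw [Nat.add_sub_cancel_left, mul_pow, pow_add r]
          field_simp
  refine ⟨K * 2 ^ d * V + 1, by positivity, fun p r hr m => ?_⟩
  simp only [gradAt_logCut_dotProduct_self hr]
  have hrj (j : ℕ) : 0 < r / 2 ^ j := by positivity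
  rw [integral_const_mul, integral_finsetSum _ fun j _ =>
    (isTestFun_cut p (hrj j)).integrable_gradAt_sq]
  rcases m.eq_zero_or_pos with rfl | hm
  · simp
  have hm' : (0 : ℝ) < m := by positivity
  calc ((m : ℝ)⁻¹) ^ 2 * ∑ j ∈ Finset.range m,
        ∫ ξ, gradAt (cut p (r / 2 ^ j)) ξ ⬝ᵥ gradAt (cut p (r / 2 ^ j)) ξ
      ≤ ((m : ℝ)⁻¹) ^ 2 * ∑ j ∈ Finset.range m, (K * 2 ^ d * V + 1) * r ^ (d - 2) := by
        gcongr with j hj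
        refine (hcut p _ (hrj j)).trans ?_
        have h1 : r / 2 ^ j ≤ r := div_le_self hr.le (one_le_pow₀ (by norm_num))
        gcongr
        linarith
    _ = (K * 2 ^ d * V + 1) * r ^ (d - 2) / m := by
        rw [Finset.sum_const, Finset.card_range, nsmul_eq_mul]
        field_simp

end Cutoff

/-- The Cauchy–Schwarz inequality for integrals, under a pointwise factorization. -/
theorem sq_integral_le_of_abs_le {α : Type*} [MeasurableSpace α] {μ : Measure α}
    {φ a b : α → ℝ} (ha : Integrable a μ) (hb : Integrable b μ) (ha0 : ∀ x, 0 ≤ a x)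
    (hb0 : ∀ x, 0 ≤ b x) (h : ∀ x, |φ x| ≤ √(a x) * √(b x)) :
    (∫ x, φ x ∂μ) ^ 2 ≤ (∫ x, a x ∂μ) * ∫ x, b x ∂μ := by
  by_cases hφ : Integrable φ μ
  swap
  · rw [integral_undef hφ, sq, zero_mul]
    exact mul_nonneg (integral_nonneg ha0) (integral_nonneg hb0)
  have key : ∀ s : ℝ, 0 ≤ (∫ x, a x ∂μ) * (s * s) + (-2 * ∫ x, φ x ∂μ) * s + ∫ x, b x ∂μ := by
    intro s
    have h1 : (∫ x, a x ∂μ) * (s * s) + (-2 * ∫ x, φ x ∂μ) * s + ∫ x, b x ∂μ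
        = ∫ x, ((s * s) * a x + (-2 * s) * φ x + b x) ∂μ := by
      have h2 : Integrable (fun x => (s * s) * a x + (-2 * s) * φ x) μ :=
        (ha.const_mul _).add (hφ.const_mul _)
      rw [integral_add h2 hb, integral_add (ha.const_mul _) (hφ.const_mul _),
        integral_const_mul, integral_const_mul]
      ring
    rw [h1]
    refine integral_nonneg fun x => ?_
    have h2 : |φ x * s| ≤ √(a x) * √(b x) * |s| := by
      rw [abs_mul]; exact mul_le_mul_of_nonneg_right (h x) (abs_nonneg s)
    have h3 := (abs_le.1 h2).2
    have h4 := sq_nonneg (√(a x) * |s| - √(b x))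
    have h5 := Real.sq_sqrt (ha0 x)
    have h6 := Real.sq_sqrt (hb0 x)
    have h7 := sq_abs s
    have h8 : (√(a x) * |s| - √(b x)) ^ 2 = a x * s ^ 2 - 2 * (√(a x) * √(b x) * |s|) + b x := by
      rw [sub_sq, mul_pow, h5, h6, h7]; ring
    simp only [Pi.zero_apply]
    nlinarith
  have := discrim_le_zero key
  unfold discrim at this
  linarith

section

variable {d : ℕ} {lam : ℝ} {p q : E d} {f u : E d → ℝ} {Df Du : E d → Fin d → ℝ}

theorem PuncturedH1.integrable_sq_mul_gradAt_sq (hf : PuncturedH1 q f Df) {ζ : E d → ℝ}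
    (hζ : IsTestFun d ζ) {S : Set (E d)} (hS : IsCompact S) (hs : ∀ ξ ∉ S, gradAt ζ ξ = 0)
    (hq : q ∉ S) : Integrable fun ξ => f ξ ^ 2 * (gradAt ζ ξ ⬝ᵥ gradAt ζ ξ) := by
  have h := integrable_mul_of_support hS (ζ := fun ξ => gradAt ζ ξ ⬝ᵥ gradAt ζ ξ)
    (continuous_finsetSum _ fun i _ => (hζ.continuous_gradAt i).mul (hζ.continuous_gradAt i))
    (fun ξ hξ => by rw [hs ξ hξ, dotProduct_zero])
    ((memLp_two_iff_integrable_sq (hf.memLp hS hq).1).1 (hf.memLp hS hq))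
  simpa only [mul_comm] using h

/-- Cauchy–Schwarz for the commutator terms `∫ f ∇ζ · A∇u`. -/
theorem PuncturedH1.sq_integral_gradAt_flux_le (hu : PuncturedH1 p u Du)
    (hf : PuncturedH1 q f Df) (W : CoeffField d lam) {ζ : E d → ℝ} (hζ : IsTestFun d ζ)
    {S : Set (E d)} (hS : IsCompact S) (hs : ∀ ξ ∉ S, gradAt ζ ξ = 0) (hp : p ∉ S)
    (hq : q ∉ S) (c : ℝ) :
    (∫ ξ, (f ξ - c) * (gradAt ζ ξ ⬝ᵥ (W.A ξ *ᵥ Du ξ))) ^ 2 ≤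
      (∫ ξ, (f ξ - c) ^ 2 * (gradAt ζ ξ ⬝ᵥ gradAt ζ ξ)) * ∫ ξ in S, Du ξ ⬝ᵥ Du ξ := by
  rw [← setIntegral_eq_integral_of_forall_compl_eq_zero (s := S)
      (fun ξ hξ => by rw [hs ξ hξ, zero_dotProduct, mul_zero]),
    ← setIntegral_eq_integral_of_forall_compl_eq_zero (s := S)
      (f := fun ξ => (f ξ - c) ^ 2 * _) (fun ξ hξ => by rw [hs ξ hξ, zero_dotProduct, mul_zero])]
  have : IsFiniteMeasure (volume.restrict S) := ⟨by simpa using hS.measure_lt_top⟩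
  have hm : MemLp (fun ξ => f ξ - c) 2 (volume.restrict S) :=
    (hf.memLp hS hq).sub (memLp_const c)
  have hi := ((memLp_two_iff_integrable_sq hm.1).1 hm)
  refine sq_integral_le_of_abs_le ?_ (hu.sqInt S hS hp)
    (fun ξ => mul_nonneg (sq_nonneg _) (dotProduct_self_nonneg' _))
    (fun ξ => dotProduct_self_nonneg' _) fun ξ => ?_
  · exact IntegrableOn.mul_continuousOn hi (continuous_finsetSum _ fun i _ =>
      (hζ.continuous_gradAt i).mul (hζ.continuous_gradAt i)).continuousOn hS
  · rw [abs_mul, Real.sqrt_mul (sq_nonneg _), Real.sqrt_sq_eq_abs, mul_assoc]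
    exact mul_le_mul_of_nonneg_left (W.abs_dotProduct_mulVec_le ξ _ _) (abs_nonneg _)

theorem integral_sq_mul_gradAt_sq_le {ζ g : E d → ℝ} (hζ : IsTestFun d ζ) {M : ℝ}
    (h : ∀ ξ, gradAt ζ ξ ≠ 0 → |g ξ| ≤ M) :
    ∫ ξ, g ξ ^ 2 * (gradAt ζ ξ ⬝ᵥ gradAt ζ ξ) ≤ M ^ 2 * ∫ ξ, gradAt ζ ξ ⬝ᵥ gradAt ζ ξ := by
  rw [← integral_const_mul]
  refine integral_mono_of_nonneg (Eventually.of_forall fun ξ =>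
    mul_nonneg (sq_nonneg _) (dotProduct_self_nonneg' _)) (hζ.integrable_gradAt_sq.const_mul _)
    (Eventually.of_forall fun ξ => ?_)
  by_cases h0 : gradAt ζ ξ = 0
  · simp [h0]
  · refine mul_le_mul_of_nonneg_right ?_ (dotProduct_self_nonneg' _)
    exact sq_le_sq' (abs_le.1 (h ξ h0)).1 (abs_le.1 (h ξ h0)).2

/-- The Green function bounds around a pole `p`. -/
structure GreenBd (c C T : ℝ) (p : E d) (f : E d → ℝ) (Df : E d → Fin d → ℝ) : Prop where
  bound : ∀ ξ, ξ ≠ p → |f ξ| ≤ C * gBound d c T (dist ξ p)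
  annulus : ∀ R : ℝ, 0 < R →
    (∫⁻ ξ in {ξ : E d | R < dist ξ p ∧ dist ξ p < 2 * R}, ENNReal.ofReal (Df ξ ⬝ᵥ Df ξ)) ≤
      ENNReal.ofReal ((C * Real.exp (-(c * R) / Real.sqrt T) * R ^ ((1 : ℝ) - (d : ℝ))) ^ 2 * R ^ d)

theorem annulus_const_eq (hd : 2 ≤ d) {R : ℝ} (hR : 0 < R) (a : ℝ) :
    (a * R ^ ((1 : ℝ) - (d : ℝ))) ^ 2 * R ^ d = a ^ 2 / R ^ (d - 2) := by
  obtain ⟨e, rfl⟩ := Nat.exists_eq_add_of_le hd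
  have h : R ^ ((1 : ℝ) - ((2 + e : ℕ) : ℝ)) = (R ^ (e + 1))⁻¹ := by
    rw [← Real.rpow_natCast, ← Real.rpow_neg hR.le]
    congr 1; push_cast; ring
  rw [h, Nat.add_sub_cancel_left]
  field_simp
  ring

variable {c C T : ℝ}

theorem GreenBd.lintegral_shell_le (h : GreenBd c C T p f Df) (hd : 2 ≤ d) (hc : 0 < c)
    (n : ℕ) : ∀ R : ℝ, 0 < R →
    (∫⁻ ξ in {ξ : E d | R < dist ξ p ∧ dist ξ p < (3 / 2) ^ n * R},
      ENNReal.ofReal (Df ξ ⬝ᵥ Df ξ)) ≤ ENNReal.ofReal (n * (C ^ 2 / R ^ (d - 2))) := by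
  induction n with
  | zero =>
    intro R hR
    have : {ξ : E d | R < dist ξ p ∧ dist ξ p < (3 / 2) ^ 0 * R} = ∅ := by
      ext ξ; simp only [pow_zero, one_mul, Set.mem_ofPred_eq, Set.mem_empty_iff_false, iff_false]
      intro h; linarith [h.1, h.2]
    rw [this]; simp
  | succ n ih =>
    intro R hR
    have hsub : {ξ : E d | R < dist ξ p ∧ dist ξ p < (3 / 2) ^ (n + 1) * R} ⊆
        {ξ : E d | R < dist ξ p ∧ dist ξ p < 2 * R} ∪
        {ξ : E d | 3 / 2 * R < dist ξ p ∧ dist ξ p < (3 / 2) ^ n * (3 / 2 * R)} := by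
      rintro ξ ⟨h1, h2⟩
      by_cases h3 : dist ξ p < 2 * R
      · exact Or.inl ⟨h1, h3⟩
      · refine Or.inr ⟨by linarith, ?_⟩
        rw [pow_succ] at h2; linarith
    refine (lintegral_mono_set hsub).trans ((lintegral_union_le _ _ _).trans ?_)
    have h1 := h.annulus R hR
    rw [annulus_const_eq hd hR] at h1
    have h2 := ih (3 / 2 * R) (by positivity)
    refine (add_le_add h1 h2).trans ?_
    rw [← ENNReal.ofReal_add (by positivity) (by positivity)]
    refine ENNReal.ofReal_le_ofReal ?_
    have e1 : (C * Real.exp (-(c * R) / √T)) ^ 2 ≤ C ^ 2 := by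
      rw [mul_pow]
      refine mul_le_of_le_one_right (sq_nonneg _) (pow_le_one₀ (by positivity) ?_)
      rw [Real.exp_le_one_iff]
      exact div_nonpos_of_nonpos_of_nonneg (by nlinarith) (Real.sqrt_nonneg _)
    have e2 : C ^ 2 / (3 / 2 * R) ^ (d - 2) ≤ C ^ 2 / R ^ (d - 2) := by
      gcongr; linarith
    have e3 : (C * Real.exp (-(c * R) / √T)) ^ 2 / R ^ (d - 2) ≤ C ^ 2 / R ^ (d - 2) := by
      gcongr
    have : (0 : ℝ) ≤ n := n.cast_nonneg
    push_cast
    nlinarith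

theorem integrableOn_and_integral_le_of_lintegral_le {S : Set (E d)} {g : E d → ℝ}
    (hg : AEStronglyMeasurable g volume) (hg0 : ∀ ξ, 0 ≤ g ξ) {M : ℝ} (hM : 0 ≤ M)
    (h : ∫⁻ ξ in S, ENNReal.ofReal (g ξ) ≤ ENNReal.ofReal M) :
    IntegrableOn g S ∧ ∫ ξ in S, g ξ ≤ M := by
  constructor
  · refine ⟨hg.restrict, ?_⟩
    rw [hasFiniteIntegral_iff_ofReal (Eventually.of_forall hg0)]
    exact h.trans_lt ENNReal.ofReal_lt_top
  · rw [integral_eq_lintegral_of_nonneg_ae (Eventually.of_forall hg0) hg.restrict]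
    exact ENNReal.toReal_le_of_le_ofReal hM h

theorem aestronglyMeasurable_dotProduct_self (h : ∀ i, LocallyIntegrable fun ξ => Df ξ i) :
    AEStronglyMeasurable (fun ξ => Df ξ ⬝ᵥ Df ξ) volume :=
  Finset.aestronglyMeasurable_fun_sum _ fun i _ =>
    (h i).aestronglyMeasurable.mul (h i).aestronglyMeasurable

theorem GreenBd.shell (h : GreenBd c C T p f Df) (hd : 2 ≤ d) (hc : 0 < c)
    (hDf : ∀ i, LocallyIntegrable fun ξ => Df ξ i) (n : ℕ) {R : ℝ} (hR : 0 < R) {S : Set (E d)}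
    (hS : ∀ ξ ∈ S, R < dist ξ p ∧ dist ξ p < (3 / 2) ^ n * R) :
    IntegrableOn (fun ξ => Df ξ ⬝ᵥ Df ξ) S ∧
      ∫ ξ in S, Df ξ ⬝ᵥ Df ξ ≤ n * (C ^ 2 / R ^ (d - 2)) :=
  integrableOn_and_integral_le_of_lintegral_le (aestronglyMeasurable_dotProduct_self hDf)
    (fun ξ => dotProduct_self_nonneg' _) (by positivity)
    ((lintegral_mono_set hS).trans (h.lintegral_shell_le hd hc n R hR))

theorem GreenBd.sqInt (h : GreenBd c C T p f Df) (hd : 2 ≤ d) (hc : 0 < c)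
    (hDf : ∀ i, LocallyIntegrable fun ξ => Df ξ i) (K : Set (E d)) (hK : IsCompact K)
    (hp : p ∉ K) : IntegrableOn (fun ξ => Df ξ ⬝ᵥ Df ξ) K := by
  obtain ⟨δ, hδ, hδK⟩ := Metric.isOpen_iff.1 hK.isClosed.isOpen_compl p hp
  obtain ⟨Λ, hΛ⟩ := hK.isBounded.subset_ball p
  obtain ⟨n, hn⟩ := pow_unbounded_of_one_lt (Λ / (δ / 2)) (by norm_num : (1 : ℝ) < 3 / 2)
  refine (h.shell hd hc hDf n (R := δ / 2) (by positivity) fun ξ hξ => ⟨?_, ?_⟩).1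
  · by_contra! hc
    exact hδK (mem_ball.2 (by linarith)) hξ
  · rw [div_lt_iff₀ (by positivity)] at hn
    exact (mem_ball.1 (hΛ hξ)).trans hn

theorem locallyIntegrable_of_integrableOn_ball {g : E d → ℝ}
    (h : ∀ R : ℝ, 0 < R → IntegrableOn g (ball (0 : E d) R)) : LocallyIntegrable g := by
  intro ξ
  refine ⟨ball 0 (‖ξ‖ + 1), isOpen_ball.mem_nhds (by simp), h _ (by positivity)⟩

section GreenProps

variable {W : CoeffField d lam} {G : E d → E d → ℝ} {DxG DyG : E d → E d → Fin d → ℝ}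

theorem GreenProps.greenBd_left (h : GreenProps W T c C G DxG DyG) (x : E d) :
    GreenBd c C T x (fun ξ => G ξ x) fun ξ => DxG ξ x where
  bound ξ hξ := by rw [abs_of_nonneg (h.1 ξ x)]; exact h.2.2.1 ξ x hξ
  annulus := h.2.2.2.2.2.2.2.1 x

theorem GreenProps.greenBd_right (h : GreenProps W T c C G DxG DyG) (y : E d) :
    GreenBd c C T y (fun ξ => G y ξ) fun ξ => DyG y ξ where
  bound ξ hξ := by
    rw [abs_of_nonneg (h.1 y ξ), dist_comm]; exact h.2.2.1 y ξ hξ.symm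
  annulus := h.2.2.2.2.2.2.2.2.1 y

theorem GreenProps.fundSol_left (h : GreenProps W T c C G DxG DyG) (hd : 2 ≤ d) (hc : 0 < c)
    (x : E d) : FundSol W T x (fun ξ => G ξ x) fun ξ => DxG ξ x := by
  have hloc := locallyIntegrable_of_integrableOn_ball fun R hR => (h.2.2.2.2.2.1 x R hR).1
  have hlocg := fun i => locallyIntegrable_of_integrableOn_ball
    fun R hR => (h.2.2.2.2.2.1 x R hR).2 i
  exact
    { weakGrad := h.2.2.2.1 x
      cont := h.2.1.comp (f := fun ξ => (ξ, x)) (by fun_prop) fun ξ hξ => hξ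
      locInt := hloc
      locIntGrad := hlocg
      sqInt := (h.greenBd_left x).sqInt hd hc hlocg
      eqn := h.2.2.2.2.2.2.2.2.2.1 x }

theorem GreenProps.fundSol_right (h : GreenProps W T c C G DxG DyG) (hd : 2 ≤ d) (hc : 0 < c)
    (y : E d) : FundSol W.adjoint T y (fun ξ => G y ξ) fun ξ => DyG y ξ := by
  have hloc := locallyIntegrable_of_integrableOn_ball fun R hR => (h.2.2.2.2.2.2.1 y R hR).1
  have hlocg := fun i => locallyIntegrable_of_integrableOn_ball
    fun R hR => (h.2.2.2.2.2.2.1 y R hR).2 i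
  exact
    { weakGrad := h.2.2.2.2.1 y
      cont := h.2.1.comp (f := fun ξ => (y, ξ)) (by fun_prop) fun ξ hξ hyξ => hξ hyξ.symm
      locInt := hloc
      locIntGrad := hlocg
      sqInt := (h.greenBd_right y).sqInt hd hc hlocg
      eqn := h.2.2.2.2.2.2.2.2.2.2 y }

end GreenProps

end

theorem young_lower_bound {lam q g F H e η : ℝ} (hlam : 0 < lam) (hq : 0 ≤ q) (hg : 0 ≤ g)
    (hF : lam * q ≤ F) (hH : |H| ≤ √g * √q) :
    lam / 2 * (η ^ 2 * q) - 2 / lam * (e ^ 2 * g) ≤ η ^ 2 * F + 2 * η * e * H := by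
  have h1 : |η * e * H| ≤ (|η| * √q) * (|e| * √g) := by
    rw [abs_mul, abs_mul]
    calc |η| * |e| * |H| ≤ |η| * |e| * (√g * √q) := by gcongr
      _ = _ := by ring
  have h2 : η ^ 2 * q = (|η| * √q) ^ 2 := by rw [mul_pow, sq_abs, Real.sq_sqrt hq]
  have h3 : e ^ 2 * g = (|e| * √g) ^ 2 := by rw [mul_pow, sq_abs, Real.sq_sqrt hg]
  have h4 : η ^ 2 * (lam * q) ≤ η ^ 2 * F := mul_le_mul_of_nonneg_left hF (sq_nonneg _)
  have h5 : η ^ 2 * (lam * q) = lam * (|η| * √q) ^ 2 := by rw [← h2]; ring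
  rw [h5] at h4
  rw [h2, h3]
  set A := |η| * √q
  set B := |e| * √g
  have h6 : 2 * (A * B) ≤ lam / 2 * A ^ 2 + 2 / lam * B ^ 2 := by
    have h7 : lam / 2 * A ^ 2 + 2 / lam * B ^ 2 - 2 * (A * B)
        = (lam * A - 2 * B) ^ 2 / (2 * lam) := by field_simp; ring
    have : 0 ≤ (lam * A - 2 * B) ^ 2 / (2 * lam) := by positivity
    linarith
  have := (abs_le.1 h1).1
  linarith

section

variable {d : ℕ} {lam : ℝ} {p q : E d} {f u v : E d → ℝ} {Df Du Dv : E d → Fin d → ℝ}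
  {W : CoeffField d lam} {T : ℝ}

theorem PuncturedH1.integrable_gradAt_dot_flux (hu : PuncturedH1 p u Du) (W : CoeffField d lam)
    {ζ : E d → ℝ} (hζ : IsTestFun d ζ) {K : Set (E d)} (hK : IsCompact K)
    (hs : ∀ ξ ∉ K, gradAt ζ ξ = 0) (hp : p ∉ K) :
    Integrable fun ξ => gradAt ζ ξ ⬝ᵥ (W.A ξ *ᵥ Du ξ) := by
  have : IsFiniteMeasure (volume.restrict K) := ⟨by simpa using hK.measure_lt_top⟩
  exact integrable_finsetSum Finset.univ fun i _ =>
    integrable_mul_of_support hK (hζ.continuous_gradAt i) (fun ξ hξ => by rw [hs ξ hξ]; rfl)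
      ((hu.memLp_flux W hK hp i).integrable one_le_two)

theorem gradAt_mul_self {η : E d → ℝ} (hη : IsTestFun d η) (ξ : E d) (a : Fin d → ℝ) :
    gradAt (fun ξ => η ξ * η ξ) ξ ⬝ᵥ a = 2 * η ξ * (gradAt η ξ ⬝ᵥ a) := by
  rw [gradAt_mul hη hη, ← two_smul ℝ (η ξ • gradAt η ξ), smul_smul, smul_dotProduct, smul_eq_mul]

/-- The Caccioppoli inequality away from the pole. -/
theorem FundSol.caccioppoli (hv : FundSol W T q v Dv) (hT : 0 < T) (hlam : 0 < lam)
    {η : E d → ℝ} (hη : IsTestFun d η) (hq : q ∉ tsupport η) {c ω V : ℝ}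
    (hω : ∀ ξ ∈ tsupport η, |v ξ - c| ≤ ω) (hV : ∀ ξ ∈ tsupport η, |v ξ| ≤ V) :
    ∫ ξ, η ξ ^ 2 * (Dv ξ ⬝ᵥ Dv ξ) ≤ 4 / lam ^ 2 * (ω ^ 2 * ∫ ξ, gradAt η ξ ⬝ᵥ gradAt η ξ) +
      2 / (lam * T) * (V * ω * ∫ ξ, η ξ ^ 2) := by
  set ζ : E d → ℝ := fun ξ => η ξ * η ξ with hζdef
  have hζ : IsTestFun d ζ := hη.mul hη
  have hsub : tsupport ζ ⊆ tsupport η := tsupport_mul_subset_left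
  have hqζ : q ∉ tsupport ζ := fun h => hq (hsub h)
  have hK := hη.2.isCompact
  have hζ0 : ∀ ξ ∉ tsupport η, ζ ξ = 0 := fun ξ hξ =>
    image_eq_zero_of_notMem_tsupport fun h => hξ (hsub h)
  have hgζ0 : ∀ ξ ∉ tsupport η, gradAt ζ ξ = 0 := fun ξ hξ =>
    gradAt_eq_zero_of_notMem_tsupport fun h => hξ (hsub h)
  have e1 := hv.test hv.toPuncturedH1 hζ hqζ hqζ
  have e2 := hv.eqn ζ hζ
  rw [image_eq_zero_of_notMem_tsupport hqζ] at e2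
  have i1 : Integrable fun ξ => ζ ξ * (v ξ * v ξ) :=
    integrable_mul_of_support hK hζ.continuous hζ0
      (integrableOn_mul (hv.memLp hK hq) (hv.memLp hK hq))
  have i2 : Integrable fun ξ => ζ ξ * (Dv ξ ⬝ᵥ (W.A ξ *ᵥ Dv ξ)) :=
    integrable_mul_of_support hK hζ.continuous hζ0
      (hv.integrableOn_dot_flux hv.toPuncturedH1 W hK hq hq)
  have i3 := hv.integrable_gradAt_flux hv.toPuncturedH1 W hζ hK hgζ0 hq hq
  have i4 : Integrable fun ξ => T⁻¹ * v ξ * ζ ξ := by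
    simpa only [mul_assoc] using (hζ.integrable_mul hv.locInt).const_mul T⁻¹
  have i5 := hv.integrable_gradAt_dot_flux W hζ hK hgζ0 hq
  have i6 : Integrable fun ξ => T⁻¹ * (ζ ξ * (v ξ * v ξ)) + ζ ξ * (Dv ξ ⬝ᵥ (W.A ξ *ᵥ Dv ξ)) +
      v ξ * (gradAt ζ ξ ⬝ᵥ (W.A ξ *ᵥ Dv ξ)) := ((i1.const_mul _).add i2).add i3
  have i7 : Integrable fun ξ => c * (T⁻¹ * v ξ * ζ ξ + gradAt ζ ξ ⬝ᵥ (W.A ξ *ᵥ Dv ξ)) :=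
    (i4.add i5).const_mul c
  have i8 : Integrable fun ξ => η ξ ^ 2 * (Dv ξ ⬝ᵥ Dv ξ) := by
    simpa only [hζdef, sq] using
      integrable_mul_of_support hK hζ.continuous hζ0 (hv.sqInt _ hK hq)
  have i9 := hη.integrable_gradAt_sq
  have i10 : Integrable fun ξ => η ξ ^ 2 := by
    simpa only [hζdef, sq] using hζ.continuous.integrable_of_hasCompactSupport hζ.2
  have i11 : Integrable fun ξ => 2 / lam * (ω ^ 2 * (gradAt η ξ ⬝ᵥ gradAt η ξ)) +
      T⁻¹ * (V * ω * η ξ ^ 2) :=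
    ((i9.const_mul _).const_mul _).add ((i10.const_mul _).const_mul _)
  have i12 : Integrable fun ξ => (T⁻¹ * (ζ ξ * (v ξ * v ξ)) +
      ζ ξ * (Dv ξ ⬝ᵥ (W.A ξ *ᵥ Dv ξ)) + v ξ * (gradAt ζ ξ ⬝ᵥ (W.A ξ *ᵥ Dv ξ))) -
      c * (T⁻¹ * v ξ * ζ ξ + gradAt ζ ξ ⬝ᵥ (W.A ξ *ᵥ Dv ξ)) := i6.sub i7
  have key : ∫ ξ, lam / 2 * (η ξ ^ 2 * (Dv ξ ⬝ᵥ Dv ξ)) ≤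
      ∫ ξ, ((T⁻¹ * (ζ ξ * (v ξ * v ξ)) + ζ ξ * (Dv ξ ⬝ᵥ (W.A ξ *ᵥ Dv ξ)) +
      v ξ * (gradAt ζ ξ ⬝ᵥ (W.A ξ *ᵥ Dv ξ))) -
      c * (T⁻¹ * v ξ * ζ ξ + gradAt ζ ξ ⬝ᵥ (W.A ξ *ᵥ Dv ξ)) +
      (2 / lam * (ω ^ 2 * (gradAt η ξ ⬝ᵥ gradAt η ξ)) + T⁻¹ * (V * ω * η ξ ^ 2))) := by
    refine integral_mono (i8.const_mul _) (i12.add i11) fun ξ => ?_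
    by_cases hξ : ξ ∈ tsupport η
    · have hy := young_lower_bound (η := η ξ) (e := v ξ - c) hlam (dotProduct_self_nonneg' (Dv ξ))
        (dotProduct_self_nonneg' (gradAt η ξ)) ((W.elliptic ξ).2 (Dv ξ))
        (W.abs_dotProduct_mulVec_le ξ _ _)
      have hω' := hω ξ hξ
      have hV' := hV ξ hξ
      have h1 : (v ξ - c) ^ 2 * (gradAt η ξ ⬝ᵥ gradAt η ξ)
          ≤ ω ^ 2 * (gradAt η ξ ⬝ᵥ gradAt η ξ) :=
        mul_le_mul_of_nonneg_right (sq_le_sq' (abs_le.1 hω').1 (abs_le.1 hω').2)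
          (dotProduct_self_nonneg' _)
      have h2 : |v ξ * (v ξ - c)| ≤ V * ω := by
        rw [abs_mul]
        exact mul_le_mul hV' hω' (abs_nonneg _) ((abs_nonneg _).trans hV')
      have h3 : 0 ≤ T⁻¹ * (η ξ ^ 2 * (V * ω + v ξ * (v ξ - c))) := by
        have := (abs_le.1 h2).1
        have h4 : 0 ≤ V * ω + v ξ * (v ξ - c) := by linarith
        positivity
      have h5 : 2 / lam * ((v ξ - c) ^ 2 * (gradAt η ξ ⬝ᵥ gradAt η ξ)) ≤
          2 / lam * (ω ^ 2 * (gradAt η ξ ⬝ᵥ gradAt η ξ)) := by gcongr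
      simp only [hζdef, gradAt_mul_self hη]
      nlinarith
    · have h0 := image_eq_zero_of_notMem_tsupport hξ
      simp [hζ0 ξ hξ, hgζ0 ξ hξ, h0, gradAt_eq_zero_of_notMem_tsupport hξ]
  rw [integral_add i12 i11, integral_sub i6 i7, e1, integral_const_mul c, e2,
    integral_add ((i9.const_mul _).const_mul _) ((i10.const_mul _).const_mul _),
    integral_const_mul, integral_const_mul, integral_const_mul, integral_const_mul,
    integral_const_mul] at key
  have h9 : ∫ ξ, η ξ ^ 2 * (Dv ξ ⬝ᵥ Dv ξ) = 2 / lam *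
      (lam / 2 * ∫ ξ, η ξ ^ 2 * (Dv ξ ⬝ᵥ Dv ξ)) := by field_simp
  rw [h9]
  refine (mul_le_mul_of_nonneg_left key (by positivity)).trans (le_of_eq ?_)
  field_simp
  ring

end

section

variable {d : ℕ} {lam : ℝ} {x y : E d} {u v : E d → ℝ} {Du Dv : E d → Fin d → ℝ}
  {W W₂ : CoeffField d lam} {c C T : ℝ}

/-- The singular factor of the Green function bound. -/
def profile (d : ℕ) (T ρ : ℝ) : ℝ :=
  if d = 2 then Real.log (2 + √T / ρ) else (ρ ^ (d - 2))⁻¹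

theorem profile_nonneg {ρ : ℝ} (hρ : 0 < ρ) : 0 ≤ profile d T ρ := by
  unfold profile
  split_ifs
  · refine Real.log_nonneg ?_
    have : 0 ≤ √T / ρ := by positivity
    linarith
  · positivity

theorem gBound_le (hd : 2 ≤ d) (hc : 0 < c) {ρ t : ℝ} (hρ : 0 < ρ) (h : ρ ≤ t) :
    gBound d c T t ≤ Real.exp (-(c * ρ) / √T) * profile d T ρ := by
  have ht : 0 < t := hρ.trans_le h
  unfold gBound profile
  refine mul_le_mul ?_ ?_ ?_ (Real.exp_nonneg _)
  · rw [Real.exp_le_exp]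
    gcongr
  · split_ifs with h2
    · gcongr
    · obtain ⟨e, rfl⟩ := Nat.exists_eq_add_of_le hd
      have : t ^ ((2 : ℝ) - ((2 + e : ℕ) : ℝ)) = (t ^ e)⁻¹ := by
        rw [← Real.rpow_natCast, ← Real.rpow_neg ht.le]
        congr 1; push_cast; ring
      rw [this, Nat.add_sub_cancel_left]
      gcongr
  · split_ifs
    · refine Real.log_nonneg ?_
      have : 0 ≤ √T / t := by positivity
      linarith
    · positivity

theorem GreenBd.abs_le (h : GreenBd c C T x u Du) (hd : 2 ≤ d) (hc : 0 < c) (hC : 0 < C)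
    {ρ : ℝ} (hρ : 0 < ρ) {ξ : E d} (hξ : ρ ≤ dist ξ x) :
    |u ξ| ≤ C * (Real.exp (-(c * ρ) / √T) * profile d T ρ) := by
  have hne : ξ ≠ x := dist_pos.1 (hρ.trans_le hξ)
  exact (h.bound ξ hne).trans (mul_le_mul_of_nonneg_left (gBound_le hd hc hρ hξ) hC.le)

theorem GreenBd.abs_le_profile (h : GreenBd c C T x u Du) (hd : 2 ≤ d) (hc : 0 < c)
    (hC : 0 < C) {ρ : ℝ} (hρ : 0 < ρ) {ξ : E d} (hξ : ρ ≤ dist ξ x) :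
    |u ξ| ≤ C * profile d T ρ := by
  refine (h.abs_le hd hc hC hρ hξ).trans (mul_le_mul_of_nonneg_left ?_ hC.le)
  refine mul_le_of_le_one_left (profile_nonneg hρ) (Real.exp_le_one_iff.2 ?_)
  exact div_nonpos_of_nonpos_of_nonneg (by nlinarith) (Real.sqrt_nonneg _)

theorem tsupport_logCut_subset {r : ℝ} (hr : 0 < r) (m : ℕ) :
    tsupport (logCut x r m) ⊆ closedBall x (3 / 2 * r) := by
  refine closure_minimal (fun ξ hξ => ?_) isClosed_closedBall
  by_contra hc
  exact hξ (logCut_eq_zero hr (not_le.1 hc).le)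

/-- The closed shell carrying the gradient of the logarithmic cutoff. -/
def dyadicShell (x : E d) (r : ℝ) (m : ℕ) : Set (E d) :=
  {ξ | r / 2 ^ m ≤ dist ξ x ∧ dist ξ x ≤ 3 / 2 * r}

theorem isCompact_dyadicShell (x : E d) (r : ℝ) (m : ℕ) : IsCompact (dyadicShell x r m) := by
  refine (isCompact_closedBall x (3 / 2 * r)).of_isClosed_subset ?_ fun ξ hξ => hξ.2
  exact IsClosed.inter (isClosed_le continuous_const (continuous_id.dist continuous_const))
    (isClosed_le (continuous_id.dist continuous_const) continuous_const)

theorem gradAt_logCut_of_notMem_dyadicShell {r : ℝ} (hr : 0 < r) {m : ℕ} {ξ : E d}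
    (h : ξ ∉ dyadicShell x r m) : gradAt (logCut x r m) ξ = 0 := by
  refine gradAt_logCut_eq_zero hr ?_
  by_contra! hc
  exact h hc

theorem notMem_dyadicShell_self {r : ℝ} (hr : 0 < r) (m : ℕ) : x ∉ dyadicShell x r m := by
  rintro ⟨h, -⟩
  rw [dist_self] at h
  have : 0 < r / 2 ^ m := by positivity
  linarith

theorem GreenBd.integral_shell_le (h : GreenBd c C T x u Du) (hd : 2 ≤ d) (hc : 0 < c)
    (hDu : ∀ i, LocallyIntegrable fun ξ => Du ξ i) {r : ℝ} (hr : 0 < r) (m : ℕ) :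
    ∫ ξ in dyadicShell x r m, Du ξ ⬝ᵥ Du ξ ≤
      (2 * m + 4) * (C ^ 2 / (2 / 5 * (r / 2 ^ m)) ^ (d - 2)) := by
  have h1 := (h.shell hd hc hDu (2 * m + 4) (R := 2 / 5 * (r / 2 ^ m)) (by positivity)
    (S := dyadicShell x r m) ?_).2
  · push_cast at h1; exact h1
  rintro ξ ⟨h1, h2⟩
  have h0 : 0 < r / 2 ^ m := by positivity
  refine ⟨by linarith, h2.trans_lt ?_⟩
  have h3 : (3 / 2 : ℝ) ^ (2 * m + 4) = (9 / 8) ^ m * 2 ^ m * (81 / 16) := by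
    rw [pow_add, pow_mul, ← mul_pow]; norm_num
  have h4 : (1 : ℝ) ≤ (9 / 8) ^ m := one_le_pow₀ (by norm_num)
  rw [h3]
  have h5 : (9 / 8 : ℝ) ^ m * 2 ^ m * (81 / 16) * (2 / 5 * (r / 2 ^ m))
      = (9 / 8) ^ m * (81 / 40 * r) := by field_simp; ring
  rw [h5]
  nlinarith

theorem two_pow_pow_le {m : ℕ} (hdm : d = 2 ∨ m = 1) :
    ((2 : ℝ) ^ m) ^ (d - 2) ≤ 2 ^ (d - 2) := by
  rcases hdm with rfl | rfl <;> simp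

theorem FundSol.sq_integral_pole_main_le (hu : FundSol W T x u Du)
    (hub : GreenBd c C T x u Du) (hv : FundSol W₂ T y v Dv) (hd : 2 ≤ d) (hc : 0 < c)
    {K : ℝ} (hK : 0 < K) (hKb : ∀ (p : E d) (r : ℝ), 0 < r → ∀ m : ℕ,
      ∫ ξ, gradAt (logCut p r m) ξ ⬝ᵥ gradAt (logCut p r m) ξ ≤ K * r ^ (d - 2) / m)
    {r ε : ℝ} (hr : 0 < r) {m : ℕ} (hm : 1 ≤ m) (hdm : d = 2 ∨ m = 1)
    (hy : 3 / 2 * r < dist y x) (hε : ∀ ξ ∈ closedBall x (3 / 2 * r), |v ξ - v x| ≤ ε) :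
    (∫ ξ, (v ξ - v x) * (gradAt (logCut x r m) ξ ⬝ᵥ (W.A ξ *ᵥ Du ξ))) ^ 2 ≤
      6 * K * C ^ 2 * 5 ^ (d - 2) * ε ^ 2 := by
  have hη := isTestFun_logCut x hr m
  have hyS : y ∉ dyadicShell x r m := fun h => by linarith [h.2]
  have hm' : (1 : ℝ) ≤ m := by exact_mod_cast hm
  refine (hu.sq_integral_gradAt_flux_le hv.toPuncturedH1 W hη (isCompact_dyadicShell x r m)
    (fun ξ hξ => gradAt_logCut_of_notMem_dyadicShell hr hξ) (notMem_dyadicShell_self hr m)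
    hyS _).trans ?_
  have h1 := integral_sq_mul_gradAt_sq_le (g := fun ξ => v ξ - v x) hη (M := ε) fun ξ hξ =>
    hε ξ (tsupport_logCut_subset hr m (by
      by_contra hc; exact hξ (gradAt_eq_zero_of_notMem_tsupport hc)))
  have h2 := hub.integral_shell_le hd hc hu.locIntGrad hr m
  have h3 := hKb x r hr m
  have h4 : 0 ≤ ∫ ξ in dyadicShell x r m, Du ξ ⬝ᵥ Du ξ :=
    integral_nonneg fun ξ => dotProduct_self_nonneg' _
  have h5 : (2 * (m : ℝ) + 4) / m ≤ 6 := by rw [div_le_iff₀ (by positivity)]; linarith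
  calc _ ≤ (ε ^ 2 * (K * r ^ (d - 2) / m)) *
        ((2 * m + 4) * (C ^ 2 / (2 / 5 * (r / 2 ^ m)) ^ (d - 2))) :=
        mul_le_mul (h1.trans (by gcongr)) h2 h4 (by positivity)
    _ = ((2 * m + 4) / m) * K * C ^ 2 * ((5 / 2) ^ (d - 2) * ((2 : ℝ) ^ m) ^ (d - 2)) * ε ^ 2 := by
        rw [mul_pow, div_pow r, div_pow 2, div_pow 5]
        field_simp
    _ ≤ 6 * K * C ^ 2 * ((5 / 2) ^ (d - 2) * 2 ^ (d - 2)) * ε ^ 2 := by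
        have := two_pow_pow_le (d := d) hdm
        gcongr
    _ = _ := by rw [← mul_pow]; norm_num

theorem FundSol.sq_integral_pole_error_le (hu : FundSol W T x u Du)
    (hub : GreenBd c C T x u Du) (hv : FundSol W₂ T y v Dv) (hd : 2 ≤ d) (hc : 0 < c)
    (hC : 0 < C) (hT : 0 < T) (hlam : 0 < lam)
    {K : ℝ} (hK : 0 < K) (hKb : ∀ (p : E d) (r : ℝ), 0 < r → ∀ m : ℕ,
      ∫ ξ, gradAt (logCut p r m) ξ ⬝ᵥ gradAt (logCut p r m) ξ ≤ K * r ^ (d - 2) / m)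
    {r ε P : ℝ} (hr : 0 < r) {m : ℕ} (hm : 1 ≤ m) (hdm : d = 2 ∨ m = 1) (hε0 : 0 ≤ ε)
    (hε1 : ε ≤ 1) (hy : 3 / 2 * (2 ^ (m + 1) * r) < dist y x)
    (hε : ∀ ξ ∈ closedBall x (3 / 2 * (2 ^ (m + 1) * r)), |v ξ - v x| ≤ ε)
    (hP0 : 0 ≤ P)
    (hP : profile d T (r / 2 ^ m) ^ 2 * (r ^ (d - 2) / m) ≤ P * m / r ^ (d - 2))
    (hms : m * (2 ^ (m + 1) * r) ^ 2 ≤ 1) :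
    (∫ ξ, u ξ * (gradAt (logCut x r m) ξ ⬝ᵥ (W₂.A ξ *ᵥ Dv ξ))) ^ 2 ≤
      C ^ 2 * K * P * 4 ^ (d - 2) * (4 / lam ^ 2 * K +
        2 / (lam * T) * ((|v x| + 1) * (2 ^ d * (volume (ball (0 : E d) 1)).toReal))) * ε := by
  set s := 2 ^ (m + 1) * r with hs
  set V := (volume (ball (0 : E d) 1)).toReal with hV
  have hV0 : 0 ≤ V := ENNReal.toReal_nonneg
  have hs0 : 0 < s := by positivity
  have hm' : (1 : ℝ) ≤ m := by exact_mod_cast hm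
  have hrs : 2 * r ≤ s := by
    rw [hs, pow_succ]
    have : (1 : ℝ) ≤ 2 ^ m := one_le_pow₀ (by norm_num)
    nlinarith
  have hη := isTestFun_logCut x hr m
  have hη₂ := isTestFun_logCut x hs0 m
  have hyS : y ∉ dyadicShell x r m := fun h => by linarith [h.2]
  have hyS₂ : y ∉ tsupport (logCut x s m) := fun h => by
    have := mem_closedBall.1 (tsupport_logCut_subset hs0 m h); linarith
  have h1 := hv.sq_integral_gradAt_flux_le hu.toPuncturedH1 W₂ hη (isCompact_dyadicShell x r m)
    (fun ξ hξ => gradAt_logCut_of_notMem_dyadicShell hr hξ) hyS (notMem_dyadicShell_self hr m) 0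
  simp only [sub_zero] at h1
  refine h1.trans ?_
  have h2 : ∫ ξ, u ξ ^ 2 * (gradAt (logCut x r m) ξ ⬝ᵥ gradAt (logCut x r m) ξ) ≤
      C ^ 2 * K * (P * m / r ^ (d - 2)) := by
    refine (integral_sq_mul_gradAt_sq_le hη (M := C * profile d T (r / 2 ^ m)) fun ξ hξ => ?_).trans
      ?_
    · have : ξ ∈ dyadicShell x r m := by
        by_contra hc; exact hξ (gradAt_logCut_of_notMem_dyadicShell hr hc)
      exact hub.abs_le_profile hd hc hC (by positivity) this.1
    · calc _ ≤ (C * profile d T (r / 2 ^ m)) ^ 2 * (K * r ^ (d - 2) / m) := by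
            gcongr; exact hKb x r hr m
        _ = C ^ 2 * K * (profile d T (r / 2 ^ m) ^ 2 * (r ^ (d - 2) / m)) := by ring
        _ ≤ _ := by gcongr
  have h3 := hv.caccioppoli hT hlam hη₂ hyS₂ (c := v x) (ω := ε) (V := |v x| + 1)
    (fun ξ hξ => hε ξ (tsupport_logCut_subset hs0 m hξ)) fun ξ hξ => by
      have h4 := hε ξ (tsupport_logCut_subset hs0 m hξ)
      have h5 := abs_sub_abs_le_abs_sub (v ξ) (v x)
      linarith
  have h4 : ∫ ξ in dyadicShell x r m, Dv ξ ⬝ᵥ Dv ξ ≤ ∫ ξ, logCut x s m ξ ^ 2 * (Dv ξ ⬝ᵥ Dv ξ) := by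
    rw [← integral_indicator (isCompact_dyadicShell x r m).measurableSet]
    have hi := integrable_mul_of_support (ζ := fun ξ => logCut x s m ξ ^ 2) hη₂.2.isCompact
      (hη₂.continuous.pow 2)
      (fun ξ hξ => by simp [image_eq_zero_of_notMem_tsupport hξ]) (hv.sqInt _ hη₂.2 hyS₂)
    refine integral_mono_of_nonneg (Eventually.of_forall fun ξ =>
      Set.indicator_nonneg (fun _ _ => dotProduct_self_nonneg' _) ξ) hi
      (Eventually.of_forall fun ξ => ?_)
    by_cases hξ : ξ ∈ dyadicShell x r m
    · simp only [Set.indicator_of_mem hξ]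
      rw [logCut_eq_one hs0 hm, one_pow, one_mul]
      refine hξ.2.trans ?_
      have : s / 2 ^ m = 2 * r := by rw [hs, pow_succ]; field_simp
      linarith
    · simp only [Set.indicator_of_notMem hξ]
      exact mul_nonneg (sq_nonneg _) (dotProduct_self_nonneg' _)
  have h5 : ∫ ξ, logCut x s m ξ ^ 2 ≤ (2 * s) ^ d * V := by
    have hsub : ∀ ξ ∉ ball x (2 * s), logCut x s m ξ ^ 2 = 0 := by
      intro ξ hξ
      rw [logCut_eq_zero hs0 (by rw [mem_ball, not_lt] at hξ; linarith)]; simp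
    rw [← setIntegral_eq_integral_of_forall_compl_eq_zero hsub]
    calc ∫ ξ in ball x (2 * s), logCut x s m ξ ^ 2 ≤ ∫ ξ in ball x (2 * s), (1 : ℝ) := by
          refine integral_mono_of_nonneg (Eventually.of_forall fun ξ => sq_nonneg _)
            (integrableOn_const measure_ball_lt_top.ne) (Eventually.of_forall fun ξ => ?_)
          exact pow_le_one₀ logCut_nonneg logCut_le_one
      _ = (2 * s) ^ d * V := by
          rw [setIntegral_const, measureReal_def, Measure.addHaar_ball_of_pos _ _ (by positivity),
            ENNReal.toReal_mul, ENNReal.toReal_ofReal (by positivity), finrank_euclideanSpace_fin,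
            smul_eq_mul, mul_one]
  have h6 : ∫ ξ in dyadicShell x r m, Dv ξ ⬝ᵥ Dv ξ ≤ 4 / lam ^ 2 * (ε ^ 2 * (K * s ^ (d - 2) / m)) +
      2 / (lam * T) * ((|v x| + 1) * ε * ((2 * s) ^ d * V)) := by
    refine h4.trans (h3.trans ?_)
    gcongr
    exact hKb x s hs0 m
  have h7 : s ^ (d - 2) ≤ 4 ^ (d - 2) * r ^ (d - 2) := by
    rw [hs, pow_succ, mul_pow, mul_pow]
    have := two_pow_pow_le (d := d) hdm
    calc _ ≤ (2 : ℝ) ^ (d - 2) * 2 ^ (d - 2) * r ^ (d - 2) := by gcongr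
      _ = _ := by rw [← mul_pow]; norm_num
  have h8 : (2 * s) ^ d * m = 2 ^ d * s ^ (d - 2) * (m * s ^ 2) := by
    obtain ⟨e, rfl⟩ := Nat.exists_eq_add_of_le hd
    rw [Nat.add_sub_cancel_left, mul_pow, pow_add s]; ring
  have h9 : ε ^ 2 ≤ ε := by nlinarith
  calc _ ≤ (C ^ 2 * K * (P * m / r ^ (d - 2))) *
      (4 / lam ^ 2 * (ε ^ 2 * (K * s ^ (d - 2) / m)) +
      2 / (lam * T) * ((|v x| + 1) * ε * ((2 * s) ^ d * V))) :=
        mul_le_mul h2 h6 (integral_nonneg fun ξ => dotProduct_self_nonneg' _) (by positivity)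
    _ = (C ^ 2 * K * P / r ^ (d - 2)) * (4 / lam ^ 2 * (ε ^ 2 * (K * s ^ (d - 2))) +
      2 / (lam * T) * ((|v x| + 1) * ε * ((2 * s) ^ d * m * V))) := by field_simp
    _ = (C ^ 2 * K * P / r ^ (d - 2)) * s ^ (d - 2) * (4 / lam ^ 2 * (ε ^ 2 * K) +
      2 / (lam * T) * ((|v x| + 1) * ε * (2 ^ d * (m * s ^ 2) * V))) := by rw [h8]; ring
    _ ≤ (C ^ 2 * K * P / r ^ (d - 2)) * (4 ^ (d - 2) * r ^ (d - 2)) * (4 / lam ^ 2 * (ε * K) +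
      2 / (lam * T) * ((|v x| + 1) * ε * (2 ^ d * 1 * V))) := by gcongr
    _ = _ := by field_simp

end

theorem tendsto_zero_of_sq {a : ℕ → ℝ} (h : Tendsto (fun N => a N ^ 2) atTop (𝓝 0)) :
    Tendsto a atTop (𝓝 0) := by
  rw [tendsto_zero_iff_abs_tendsto_zero]
  simpa [Real.sqrt_sq_eq_abs, Function.comp_def] using h.sqrt

theorem tendsto_zero_of_sq_le {a : ℕ → ℝ} {B : ℝ}
    (h : ∀ ε, 0 < ε → ε ≤ 1 → ∀ᶠ N in atTop, a N ^ 2 ≤ B * ε) : Tendsto a atTop (𝓝 0) := by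
  refine tendsto_zero_of_sq (Metric.tendsto_nhds.2 fun δ hδ => ?_)
  have hB : 0 < |B| + 1 := by positivity
  filter_upwards [h (min 1 (δ / (|B| + 1))) (by positivity) (min_le_left _ _)] with N hN
  rw [Real.dist_0_eq_abs, abs_of_nonneg (sq_nonneg _)]
  calc a N ^ 2 ≤ B * min 1 (δ / (|B| + 1)) := hN
    _ ≤ |B| * (δ / (|B| + 1)) := by
      refine mul_le_mul (le_abs_self B) (min_le_right _ _) (by positivity) (abs_nonneg _)
    _ < (|B| + 1) * (δ / (|B| + 1)) := by gcongr; linarith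
    _ = δ := by field_simp

section

variable {d : ℕ} {lam : ℝ} {x y : E d} {u v : E d → ℝ} {Du Dv : E d → Fin d → ℝ}
  {W W₂ : CoeffField d lam} {c C T r₀ : ℝ}

/-- The number of dyadic scales used in the cutoff near a pole. -/
def poleIdx (d N : ℕ) : ℕ := if d = 2 then N + 1 else 1

theorem one_le_poleIdx (d N : ℕ) : 1 ≤ poleIdx d N := by unfold poleIdx; split_ifs <;> omega

theorem poleIdx_le (d N : ℕ) : poleIdx d N ≤ N + 1 := by unfold poleIdx; split_ifs <;> omega

theorem dim_eq_two_or_poleIdx (d N : ℕ) : d = 2 ∨ poleIdx d N = 1 := by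
  unfold poleIdx; split_ifs <;> omega

theorem two_pow_poleIdx_mul_le (hr₀ : 0 < r₀) (N : ℕ) :
    2 ^ (poleIdx d N + 1) * (r₀ / 4 ^ N) ≤ 4 * r₀ / 2 ^ N := by
  have h1 : (2 : ℝ) ^ (poleIdx d N + 1) ≤ 2 ^ (N + 2) :=
    pow_le_pow_right₀ (by norm_num) (by have := poleIdx_le d N; omega)
  have h2 : (4 : ℝ) ^ N = 2 ^ N * 2 ^ N := by rw [← mul_pow]; norm_num
  calc 2 ^ (poleIdx d N + 1) * (r₀ / 4 ^ N) ≤ 2 ^ (N + 2) * (r₀ / 4 ^ N) := by gcongr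
    _ = 4 * r₀ / 2 ^ N := by rw [h2, pow_add]; field_simp; ring

theorem poleIdx_mul_sq_le_one (hr₀ : 0 < r₀) (hr₀' : r₀ ≤ 1 / 4) (N : ℕ) :
    (poleIdx d N : ℝ) * (2 ^ (poleIdx d N + 1) * (r₀ / 4 ^ N)) ^ 2 ≤ 1 := by
  have h1 : (poleIdx d N : ℝ) ≤ 2 ^ N := by
    exact_mod_cast (poleIdx_le d N).trans Nat.lt_two_pow_self
  have h2 := two_pow_poleIdx_mul_le (d := d) hr₀ N
  have h3 : (1 : ℝ) ≤ 2 ^ N := one_le_pow₀ (by norm_num)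
  have h4 : 4 * r₀ / 2 ^ N ≤ 1 / 2 ^ N := by gcongr; linarith
  calc (poleIdx d N : ℝ) * (2 ^ (poleIdx d N + 1) * (r₀ / 4 ^ N)) ^ 2
      ≤ 2 ^ N * (1 / 2 ^ N) ^ 2 := by
        gcongr
        exact h2.trans h4
    _ = 1 / 2 ^ N := by field_simp
    _ ≤ 1 := by rw [div_le_one (by positivity)]; exact h3

theorem exists_profile_sq_le (d : ℕ) (T : ℝ) (hr₀ : 0 < r₀) : ∃ P : ℝ, 0 ≤ P ∧ ∀ N : ℕ,
    profile d T (r₀ / 4 ^ N / 2 ^ poleIdx d N) ^ 2 * ((r₀ / 4 ^ N) ^ (d - 2) / poleIdx d N) ≤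
      P * poleIdx d N / (r₀ / 4 ^ N) ^ (d - 2) := by
  by_cases hd : d = 2
  · subst hd
    set A := 2 + 2 * √T / r₀ with hA
    have hA2 : 2 ≤ A := by
      have : 0 ≤ 2 * √T / r₀ := by positivity
      linarith
    set B := Real.log A + Real.log 8 with hB
    have hB0 : 0 ≤ Real.log 8 := Real.log_nonneg (by norm_num)
    have hA0 : 0 ≤ Real.log A := Real.log_nonneg (by linarith)
    refine ⟨B ^ 2, sq_nonneg _, fun N => ?_⟩
    have h1 : profile 2 T (r₀ / 4 ^ N / 2 ^ poleIdx 2 N) ≤ B * (N + 1) := by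
      simp only [profile, poleIdx, if_true]
      have h2 : 2 + √T / (r₀ / 4 ^ N / 2 ^ (N + 1)) ≤ A * 8 ^ N := by
        have h3 : (8 : ℝ) ^ N = 4 ^ N * 2 ^ N := by rw [← mul_pow]; norm_num
        have h4 : √T / (r₀ / 4 ^ N / 2 ^ (N + 1)) = 2 * √T / r₀ * 8 ^ N := by
          rw [h3, pow_succ]; field_simp
        have h5 : (1 : ℝ) ≤ 8 ^ N := one_le_pow₀ (by norm_num)
        rw [h4, hA]; linarith
      have h6 := Real.log_le_log (by positivity) h2
      rw [Real.log_mul (by positivity) (by positivity), Real.log_pow] at h6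
      have : (0 : ℝ) ≤ N := N.cast_nonneg
      rw [hB]; nlinarith
    have h0 := profile_nonneg (d := 2) (T := T) (ρ := r₀ / 4 ^ N / 2 ^ poleIdx 2 N) (by positivity)
    have hidx : (poleIdx 2 N : ℝ) = N + 1 := by simp [poleIdx]
    rw [hidx]
    simp only [Nat.sub_self, pow_zero, div_one]
    calc _ ≤ (B * (N + 1)) ^ 2 * (1 / ((N : ℝ) + 1)) := by gcongr
      _ = _ := by field_simp
  · refine ⟨4 ^ (d - 2), by positivity, fun N => ?_⟩
    simp only [profile, poleIdx, hd, if_false, pow_one, Nat.cast_one, div_one, mul_one]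
    have h4 : (4 : ℝ) ^ (d - 2) = (2 ^ (d - 2)) ^ 2 := by
      rw [← pow_mul, mul_comm, pow_mul]; norm_num
    rw [div_pow _ 2, h4]
    refine le_of_eq ?_
    have : 0 < r₀ / 4 ^ N := by positivity
    field_simp

/-- The cutoff used near a pole. -/
def poleCut (x : E d) (r₀ : ℝ) (N : ℕ) : E d → ℝ := logCut x (r₀ / 4 ^ N) (poleIdx d N)

theorem tendsto_div_pow_atTop (a : ℝ) {b : ℝ} (hb : 1 < b) :
    Tendsto (fun N : ℕ => a / b ^ N) atTop (𝓝 0) :=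
  tendsto_const_nhds.div_atTop (tendsto_pow_atTop_atTop_of_one_lt hb)

theorem LocallyIntegrable.tendsto_integral_mul_poleCut (hd : 2 ≤ d) (hu : LocallyIntegrable u)
    (x : E d) (hr₀ : 0 < r₀) :
    Tendsto (fun N => ∫ ξ, u ξ * poleCut x r₀ N ξ) atTop (𝓝 0) := by
  have : Nonempty (Fin d) := ⟨⟨0, by omega⟩⟩
  have hr (N : ℕ) : 0 < r₀ / 4 ^ N := by positivity
  have hχ := isTestFun_cut x (r := 2 * r₀) (by positivity)
  rw [show (0 : ℝ) = ∫ ξ : E d, (0 : ℝ) by simp]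
  refine tendsto_integral_of_dominated_convergence (fun ξ => ‖u ξ * cut x (2 * r₀) ξ‖)
    (fun N => hu.aestronglyMeasurable.mul
      (isTestFun_logCut x (hr N) _).continuous.aestronglyMeasurable)
    (hχ.integrable_mul hu).norm (fun N => Eventually.of_forall fun ξ => ?_) ?_
  · rw [norm_mul, norm_mul]
    refine mul_le_mul_of_nonneg_left ?_ (norm_nonneg _)
    by_cases hξ : dist ξ x ≤ 2 * r₀
    · rw [cut_eq_one (by positivity) hξ, poleCut, Real.norm_of_nonneg logCut_nonneg]
      simpa using logCut_le_one
    · rw [poleCut, logCut_eq_zero (hr N)]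
      · simp
      · have : r₀ / 4 ^ N ≤ r₀ := div_le_self hr₀.le (one_le_pow₀ (by norm_num))
        push Not at hξ; linarith
  · have hne : ∀ᵐ ξ : E d, ξ ≠ x := by
      simp [ae_iff]
    filter_upwards [hne] with ξ hξ
    refine tendsto_const_nhds.congr' ?_
    have h1 := (tendsto_div_pow_atTop r₀ (by norm_num : (1 : ℝ) < 4)).eventually
      (gt_mem_nhds (show 0 < 2 / 3 * dist ξ x by have := dist_pos.2 hξ; positivity))
    filter_upwards [h1] with N hN
    rw [poleCut, logCut_eq_zero (hr N) (by linarith), mul_zero]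

/-- The boundary term at a pole recovers the value of the other solution. -/
theorem FundSol.tendsto_pole (hu : FundSol W T x u Du) (hub : GreenBd c C T x u Du)
    (hv : FundSol W₂ T y v Dv) (hd : 2 ≤ d) (hc : 0 < c) (hC : 0 < C) (hT : 0 < T)
    (hlam : 0 < lam) (hr₀ : 0 < r₀) (hr₀' : r₀ ≤ 1 / 4) (hy : 6 * r₀ < dist y x) :
    Tendsto (fun N => (∫ ξ, v ξ * (gradAt (poleCut x r₀ N) ξ ⬝ᵥ (W.A ξ *ᵥ Du ξ))) -
      ∫ ξ, u ξ * (gradAt (poleCut x r₀ N) ξ ⬝ᵥ (W₂.A ξ *ᵥ Dv ξ))) atTop (𝓝 (v x)) := by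
  obtain ⟨K, hK, hKb⟩ := exists_integral_gradAt_logCut_le d hd
  obtain ⟨P, hP0, hP⟩ := exists_profile_sq_le d T hr₀
  have hr (N : ℕ) : 0 < r₀ / 4 ^ N := by positivity
  have hyx : y ≠ x := dist_pos.1 (by linarith)
  have hs (N : ℕ) : 2 * (r₀ / 4 ^ N) ≤ 2 ^ (poleIdx d N + 1) * (r₀ / 4 ^ N) := by
    have : (1 : ℝ) ≤ 2 ^ (poleIdx d N) := one_le_pow₀ (by norm_num)
    have := hr N
    rw [pow_succ]; nlinarith
  have hys (N : ℕ) : 3 / 2 * (2 ^ (poleIdx d N + 1) * (r₀ / 4 ^ N)) < dist y x := by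
    have h1 := two_pow_poleIdx_mul_le (d := d) hr₀ N
    have h2 : 4 * r₀ / 2 ^ N ≤ 4 * r₀ := div_le_self (by positivity) (one_le_pow₀ (by norm_num))
    linarith
  have hcont : ∀ ε, 0 < ε → ∀ᶠ N : ℕ in atTop,
      ∀ ξ ∈ closedBall x (3 / 2 * (2 ^ (poleIdx d N + 1) * (r₀ / 4 ^ N))), |v ξ - v x| ≤ ε := by
    intro ε hε
    have h1 : ContinuousAt v x := hv.cont.continuousAt (isOpen_compl_singleton.mem_nhds hyx.symm)
    obtain ⟨δ, hδ, h2⟩ := Metric.continuousAt_iff.1 h1 ε hε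
    filter_upwards [(tendsto_div_pow_atTop (4 * r₀) (by norm_num : (1 : ℝ) < 2)).eventually
      (gt_mem_nhds (show 0 < 2 / 3 * δ by positivity))] with N hN ξ hξ
    have h3 := two_pow_poleIdx_mul_le (d := d) hr₀ N
    exact (h2 (x := ξ) ((mem_closedBall.1 hξ).trans_lt (by linarith))).le
  have hX : Tendsto (fun N => ∫ ξ, (v ξ - v x) * (gradAt (poleCut x r₀ N) ξ ⬝ᵥ
      (W.A ξ *ᵥ Du ξ))) atTop (𝓝 0) := by
    refine tendsto_zero_of_sq_le (B := 6 * K * C ^ 2 * 5 ^ (d - 2)) fun ε hε hε1 => ?_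
    filter_upwards [hcont ε hε] with N hN
    refine (hu.sq_integral_pole_main_le hub hv hd hc hK hKb (hr N) (one_le_poleIdx d N)
      (dim_eq_two_or_poleIdx d N) (by have := hys N; have := hs N; have := hr N; linarith)
      fun ξ hξ => hN ξ (closedBall_subset_closedBall ?_ hξ)).trans ?_
    · have := hs N; have := hr N; linarith
    · have : ε ^ 2 ≤ ε := by nlinarith
      gcongr
  have hY : Tendsto (fun N => ∫ ξ, u ξ * (gradAt (poleCut x r₀ N) ξ ⬝ᵥ
      (W₂.A ξ *ᵥ Dv ξ))) atTop (𝓝 0) := by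
    refine tendsto_zero_of_sq_le (B := C ^ 2 * K * P * 4 ^ (d - 2) * (4 / lam ^ 2 * K +
      2 / (lam * T) * ((|v x| + 1) * (2 ^ d * (volume (ball (0 : E d) 1)).toReal))))
      fun ε hε hε1 => ?_
    filter_upwards [hcont ε hε] with N hN
    exact hu.sq_integral_pole_error_le hub hv hd hc hC hT hlam hK hKb (hr N)
      (one_le_poleIdx d N) (dim_eq_two_or_poleIdx d N) hε.le hε1 (hys N) hN hP0 (hP N)
      (poleIdx_mul_sq_le_one hr₀ hr₀' N)
  have hZ := LocallyIntegrable.tendsto_integral_mul_poleCut hd hu.locInt x hr₀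
  have hlim := (hX.add ((tendsto_const_nhds (x := (1 : ℝ))).sub (hZ.const_mul T⁻¹)
    |>.const_mul (v x))).sub hY
  simp only [mul_zero, sub_zero, mul_one, zero_add] at hlim
  refine hlim.congr fun N => ?_
  congr 1
  have hη : IsTestFun d (poleCut x r₀ N) := isTestFun_logCut x (hr N) _
  have hS := isCompact_dyadicShell x (r₀ / 4 ^ N) (poleIdx d N)
  have hgS : ∀ ξ ∉ dyadicShell x (r₀ / 4 ^ N) (poleIdx d N), gradAt (poleCut x r₀ N) ξ = 0 :=
    fun ξ hξ => gradAt_logCut_of_notMem_dyadicShell (hr N) hξ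
  have hxS := notMem_dyadicShell_self (x := x) (hr N) (poleIdx d N)
  have hyS : y ∉ dyadicShell x (r₀ / 4 ^ N) (poleIdx d N) := fun h => by
    have := hys N; have := hs N; have := hr N; linarith [h.2]
  have i1 := hu.integrable_gradAt_flux hv.toPuncturedH1 W hη hS hgS hxS hyS
  have i2 := hu.integrable_gradAt_dot_flux W hη hS hgS hxS
  have i3 := hη.integrable_mul hu.locInt
  have e1 := hu.eqn _ hη
  rw [show poleCut x r₀ N x = 1 from logCut_eq_one (hr N) (one_le_poleIdx d N)
    (by rw [dist_self]; positivity)] at e1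
  simp only [mul_assoc] at e1
  rw [integral_add (i3.const_mul _) i2, integral_const_mul] at e1
  simp only [sub_mul]
  rw [integral_sub i1 (i2.const_mul _), integral_const_mul, ← e1]
  ring

end

section

variable {d : ℕ} {lam : ℝ} {x p q : E d} {u f : E d → ℝ} {Du Df : E d → Fin d → ℝ}
  {c C c' C' T : ℝ}

/-- The cutoff at large distances. -/
def farCut (x : E d) (N : ℕ) : E d → ℝ := logCut x (N + 1) 1

theorem isTestFun_farCut (x : E d) (N : ℕ) : IsTestFun d (farCut x N) :=
  isTestFun_logCut x (by positivity) 1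

theorem farCut_eq_one {N : ℕ} {ξ : E d} (h : dist ξ x ≤ ((N : ℝ) + 1) / 2) :
    farCut x N ξ = 1 :=
  logCut_eq_one (by positivity) one_pos (by simpa using h)

theorem profile_le {ρ : ℝ} (hρ : 1 ≤ ρ) : profile d T ρ ≤ 2 + √T := by
  have h0 := Real.sqrt_nonneg T
  unfold profile
  split_ifs
  · have h1 : √T / ρ ≤ √T := div_le_self h0 hρ
    have h2 : 0 ≤ √T / ρ := by positivity
    have h3 := Real.log_le_sub_one_of_pos (x := 2 + √T / ρ) (by positivity)
    linarith
  · have : (ρ ^ (d - 2))⁻¹ ≤ 1 := inv_le_one_of_one_le₀ (one_le_pow₀ hρ)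
    linarith

theorem eventually_le_natCast (a : ℝ) : ∀ᶠ N : ℕ in atTop, a ≤ N :=
  tendsto_natCast_atTop_atTop.eventually_ge_atTop a

theorem GreenBd.tendsto_farCut (h : GreenBd c C T q f Df) (hd : 2 ≤ d) (hc : 0 < c) (hC : 0 < C)
    (hT : 0 < T) (x : E d) :
    Tendsto (fun N => ∫ ξ, f ξ ^ 2 * (gradAt (farCut x N) ξ ⬝ᵥ gradAt (farCut x N) ξ))
      atTop (𝓝 0) := by
  obtain ⟨K, hK, hKb⟩ := exists_integral_gradAt_logCut_le d hd
  have hT' : 0 < √T := Real.sqrt_pos.2 hT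
  set b : ℝ := c / (2 * √T) with hb
  have hb0 : 0 < b := by positivity
  have hlin : Tendsto (fun N : ℕ => b * ((N : ℝ) + 1)) atTop atTop :=
    (tendsto_atTop_add_const_right _ _ tendsto_natCast_atTop_atTop).const_mul_atTop hb0
  have hlim := ((Real.tendsto_pow_mul_exp_neg_atTop_nhds_zero (d - 2)).comp hlin).const_mul
    ((C * (2 + √T)) ^ 2 * K / b ^ (d - 2))
  rw [mul_zero] at hlim
  refine squeeze_zero' (Eventually.of_forall fun N => integral_nonneg fun ξ =>
    mul_nonneg (sq_nonneg _) (dotProduct_self_nonneg' _)) ?_ hlim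
  filter_upwards [eventually_le_natCast (4 * dist q x + 4)] with N hN
  have hq0 : 0 ≤ dist q x := dist_nonneg
  set L : ℝ := (N : ℝ) + 1 with hL
  have hL0 : 0 < L := by positivity
  have h1 := integral_sq_mul_gradAt_sq_le (g := f) (isTestFun_farCut x N)
    (M := C * (Real.exp (-(c * (L / 4)) / √T) * (2 + √T))) fun ξ hξ => by
      have hmem : ξ ∈ dyadicShell x L 1 := by
        by_contra hc
        exact hξ (gradAt_logCut_of_notMem_dyadicShell hL0 hc)
      have h2 := hmem.1
      have h3 := dist_triangle ξ q x
      refine (h.abs_le hd hc hC (ρ := L / 4) (by positivity) (by linarith)).trans ?_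
      have := profile_le (d := d) (T := T) (ρ := L / 4) (by linarith)
      gcongr
  refine h1.trans ?_
  have h4 := hKb x L hL0 1
  rw [Nat.cast_one, div_one] at h4
  refine (mul_le_mul_of_nonneg_left h4 (sq_nonneg _)).trans (le_of_eq ?_)
  have h5 : Real.exp (-(c * (L / 4)) / √T) ^ 2 = Real.exp (-(b * L)) := by
    rw [← Real.exp_nat_mul]
    congr 1
    rw [hb]; push_cast; field_simp; ring
  simp only [Function.comp_apply]
  rw [mul_pow, mul_pow, h5, mul_pow, ← hL, mul_pow]
  field_simp

theorem PuncturedH1.tendsto_far_flux (hu : PuncturedH1 p u Du) (hub : GreenBd c C T p u Du)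
    (hf : PuncturedH1 q f Df) (hfb : GreenBd c' C' T q f Df) (hd : 2 ≤ d) (hc : 0 < c)
    (hc' : 0 < c') (hC' : 0 < C') (hT : 0 < T) (W : CoeffField d lam) (x : E d) :
    Tendsto (fun N => ∫ ξ, f ξ * (gradAt (farCut x N) ξ ⬝ᵥ (W.A ξ *ᵥ Du ξ))) atTop (𝓝 0) := by
  have hlim := (hfb.tendsto_farCut hd hc' hC' hT x).mul_const (6 * C ^ 2)
  rw [zero_mul] at hlim
  refine tendsto_zero_of_sq (squeeze_zero' (Eventually.of_forall fun N => sq_nonneg _) ?_ hlim)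
  filter_upwards [eventually_le_natCast (4 * dist q x + 4),
    eventually_le_natCast (4 * dist p x + 4)] with N hN hN'
  have hq0 : 0 ≤ dist q x := dist_nonneg
  have hp0 : 0 ≤ dist p x := dist_nonneg
  set L : ℝ := (N : ℝ) + 1 with hL
  have hL0 : 0 < L := by positivity
  have hpS : p ∉ dyadicShell x L 1 := fun h => by linarith [h.1]
  have hqS : q ∉ dyadicShell x L 1 := fun h => by linarith [h.1]
  have h1 := hu.sq_integral_gradAt_flux_le hf W (isTestFun_farCut x N)
    (isCompact_dyadicShell x L 1)
    (fun ξ hξ => gradAt_logCut_of_notMem_dyadicShell hL0 hξ) hpS hqS 0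
  simp only [sub_zero] at h1
  refine h1.trans (mul_le_mul_of_nonneg_left ?_ (integral_nonneg fun ξ =>
    mul_nonneg (sq_nonneg _) (dotProduct_self_nonneg' _)))
  refine (hub.shell hd hc hu.locIntGrad 6 (R := L / 5) (by positivity) fun ξ hξ => ?_).2.trans ?_
  · have h2 := hξ.1
    have h3 := hξ.2
    have h4 := dist_triangle ξ p x
    have h5 := dist_triangle ξ x p
    rw [dist_comm x p] at h5
    constructor
    · linarith
    · norm_num; linarith
  · have : C ^ 2 / (L / 5) ^ (d - 2) ≤ C ^ 2 :=
      div_le_self (sq_nonneg _) (one_le_pow₀ (by linarith))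
    push_cast
    linarith

end

section

variable {d : ℕ} {lam : ℝ} {x y z : E d} {u v : E d → ℝ} {Du Dv : E d → Fin d → ℝ}
  {W W₂ W' : CoeffField d lam} {c C c' C' T R : ℝ}

theorem CoeffField.dotProduct_adjoint_mulVec (W : CoeffField d lam) (ξ : E d)
    (a b : Fin d → ℝ) : a ⬝ᵥ (W.adjoint.A ξ *ᵥ b) = b ⬝ᵥ (W.A ξ *ᵥ a) := by
  rw [show W.adjoint.A ξ = (W.A ξ)ᵀ from rfl, mulVec_transpose, dotProduct_comm,
    ← dotProduct_mulVec]

/-- Green's identity for two fundamental solutions, tested with a common cutoff. -/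
theorem FundSol.green_identity (hu : FundSol W T x u Du) (hv : FundSol W₂ T y v Dv)
    {ζ : E d → ℝ} (hζ : IsTestFun d ζ) (hx : x ∉ tsupport ζ) (hy : y ∉ tsupport ζ) :
    ∫ ξ, ζ ξ * (Dv ξ ⬝ᵥ (W.A ξ *ᵥ Du ξ) - Du ξ ⬝ᵥ (W₂.A ξ *ᵥ Dv ξ)) =
      (∫ ξ, u ξ * (gradAt ζ ξ ⬝ᵥ (W₂.A ξ *ᵥ Dv ξ))) -
        ∫ ξ, v ξ * (gradAt ζ ξ ⬝ᵥ (W.A ξ *ᵥ Du ξ)) := by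
  have hK := hζ.2.isCompact
  have hζ0 : ∀ ξ ∉ tsupport ζ, ζ ξ = 0 := fun ξ hξ => image_eq_zero_of_notMem_tsupport hξ
  have hgζ0 : ∀ ξ ∉ tsupport ζ, gradAt ζ ξ = 0 := fun ξ hξ => gradAt_eq_zero_of_notMem_tsupport hξ
  have e1 := hu.test hv.toPuncturedH1 hζ hx hy
  have e2 := hv.test hu.toPuncturedH1 hζ hy hx
  have i1 : Integrable fun ξ => ζ ξ * (u ξ * v ξ) :=
    integrable_mul_of_support hK hζ.continuous hζ0
      (integrableOn_mul (hu.memLp hK hx) (hv.memLp hK hy))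
  have i2 : Integrable fun ξ => ζ ξ * (Dv ξ ⬝ᵥ (W.A ξ *ᵥ Du ξ)) :=
    integrable_mul_of_support hK hζ.continuous hζ0
      (hu.integrableOn_dot_flux hv.toPuncturedH1 W hK hx hy)
  have i3 : Integrable fun ξ => ζ ξ * (Du ξ ⬝ᵥ (W₂.A ξ *ᵥ Dv ξ)) :=
    integrable_mul_of_support hK hζ.continuous hζ0
      (hv.integrableOn_dot_flux hu.toPuncturedH1 W₂ hK hy hx)
  have i4 := hu.integrable_gradAt_flux hv.toPuncturedH1 W hζ hK hgζ0 hx hy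
  have i5 := hv.integrable_gradAt_flux hu.toPuncturedH1 W₂ hζ hK hgζ0 hy hx
  simp only [mul_comm (v _) (u _)] at e2
  have i6 : Integrable fun ξ => T⁻¹ * (ζ ξ * (u ξ * v ξ)) +
      ζ ξ * (Dv ξ ⬝ᵥ (W.A ξ *ᵥ Du ξ)) := (i1.const_mul _).add i2
  have i7 : Integrable fun ξ => T⁻¹ * (ζ ξ * (u ξ * v ξ)) +
      ζ ξ * (Du ξ ⬝ᵥ (W₂.A ξ *ᵥ Dv ξ)) := (i1.const_mul _).add i3
  rw [integral_add i6 i4, integral_add (i1.const_mul _) i2] at e1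
  rw [integral_add i7 i5, integral_add (i1.const_mul _) i3] at e2
  simp only [mul_sub]
  rw [integral_sub i2 i3]
  linarith

/-- Representation of the difference of two Green functions. -/
theorem FundSol.representation (hu : FundSol W T x u Du) (hub : GreenBd c C T x u Du)
    (hv : FundSol W'.adjoint T y v Dv) (hvb : GreenBd c' C' T y v Dv) (hd : 2 ≤ d)
    (hc : 0 < c) (hC : 0 < C) (hc' : 0 < c') (hC' : 0 < C') (hT : 0 < T) (hlam : 0 < lam)
    (hag : agreesOff (ball z R) W W') (hx : R < dist x z) (hy : R < dist y z) (hyx : y ≠ x) :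
    ∫ ξ in ball z R, (Dv ξ ⬝ᵥ (W.A ξ *ᵥ Du ξ) - Du ξ ⬝ᵥ (W'.adjoint.A ξ *ᵥ Dv ξ)) =
      v x - u y := by
  have hdist := dist_pos.2 hyx
  obtain ⟨r₀, hr₀, hr1, hr2, hr3, hr4⟩ : ∃ r₀ : ℝ, 0 < r₀ ∧ r₀ ≤ 1 / 4 ∧ 7 * r₀ ≤ dist y x ∧
      2 * r₀ ≤ dist x z - R ∧ 2 * r₀ ≤ dist y z - R := by
    have h1 : 0 < dist x z - R := by linarith
    have h2 : 0 < dist y z - R := by linarith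
    obtain ⟨r₀, h0, h⟩ := exists_between (show (0 : ℝ) <
      min (min (1 / 4) (dist y x / 7)) (min ((dist x z - R) / 2) ((dist y z - R) / 2)) by
        positivity)
    simp only [lt_min_iff] at h
    exact ⟨r₀, h0, h.1.1.le, by linarith [h.1.2], by linarith [h.2.1], by linarith [h.2.2]⟩
  have hr (N : ℕ) : 0 < r₀ / 4 ^ N := by positivity
  have hrle (N : ℕ) : r₀ / 4 ^ N ≤ r₀ := div_le_self hr₀.le (one_le_pow₀ (by norm_num))
  have hA := hu.tendsto_pole hub hv hd hc hC hT hlam hr₀ hr1 (by linarith)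
  have hB := hv.tendsto_pole hvb hu hd hc' hC' hT hlam hr₀ hr1 (by rw [dist_comm]; linarith)
  have hF := hu.tendsto_far_flux hub hv.toPuncturedH1 hvb hd hc hc' hC' hT W x
  have hF' := hv.tendsto_far_flux hvb hu.toPuncturedH1 hub hd hc' hc hC hT W'.adjoint x
  have hlim := (hA.sub hB).add (hF'.sub hF)
  rw [sub_zero, add_zero] at hlim
  refine tendsto_nhds_unique (tendsto_const_nhds.congr' ?_) hlim
  filter_upwards [eventually_le_natCast (2 * (dist y x + dist x z + |R| + 1))] with N hN
  have hxz : 0 ≤ dist x z := dist_nonneg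
  have hR := le_abs_self R
  have hR' := abs_nonneg R
  have tZ := isTestFun_farCut x N
  have tP : IsTestFun d (poleCut x r₀ N) := isTestFun_logCut x (hr N) _
  have tQ : IsTestFun d (poleCut y r₀ N) := isTestFun_logCut y (hr N) _
  set ζ : E d → ℝ := fun ξ => farCut x N ξ - poleCut x r₀ N ξ - poleCut y r₀ N ξ with hζdef
  have hζ : IsTestFun d ζ := (tZ.sub tP).sub tQ
  have hZ1 : ∀ ξ, dist ξ x ≤ dist y x + dist x z + |R| + 1 → farCut x N ξ = 1 := fun ξ hξ =>
    farCut_eq_one (by linarith)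
  have hP0 : ∀ ξ, 3 / 2 * r₀ ≤ dist ξ x → poleCut x r₀ N ξ = 0 := fun ξ hξ =>
    logCut_eq_zero (hr N) (by have := hrle N; linarith)
  have hQ0 : ∀ ξ, 3 / 2 * r₀ ≤ dist ξ y → poleCut y r₀ N ξ = 0 := fun ξ hξ =>
    logCut_eq_zero (hr N) (by have := hrle N; linarith)
  have hρ : 0 < r₀ / 4 ^ N / 2 ^ poleIdx d N := by positivity
  have hρle : r₀ / 4 ^ N / 2 ^ poleIdx d N ≤ r₀ :=
    (div_le_self (hr N).le (one_le_pow₀ (by norm_num))).trans (hrle N)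
  have hxζ : x ∉ tsupport ζ := by
    rw [notMem_tsupport_iff_eventuallyEq]
    filter_upwards [ball_mem_nhds x hρ] with ξ hξ
    rw [mem_ball] at hξ
    have h1 : poleCut x r₀ N ξ = 1 := logCut_eq_one (hr N) (one_le_poleIdx d N) hξ.le
    have h2 := dist_triangle_left y x ξ
    simp only [hζdef, Pi.zero_apply]
    rw [h1, hZ1 ξ (by linarith), hQ0 ξ (by linarith)]
    ring
  have hyζ : y ∉ tsupport ζ := by
    rw [notMem_tsupport_iff_eventuallyEq]
    filter_upwards [ball_mem_nhds y hρ] with ξ hξ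
    rw [mem_ball] at hξ
    have h1 : poleCut y r₀ N ξ = 1 := logCut_eq_one (hr N) (one_le_poleIdx d N) hξ.le
    have h2 := dist_triangle_left y x ξ
    have h3 := dist_triangle ξ y x
    simp only [hζdef, Pi.zero_apply]
    rw [h1, hZ1 ξ (by linarith), hP0 ξ (by linarith)]
    ring
  have hone : ∀ ξ ∈ ball z R, ζ ξ = 1 := by
    intro ξ hξ
    rw [mem_ball] at hξ
    have h1 := dist_triangle_left x z ξ
    have h2 := dist_triangle_left y z ξ
    have h3 := dist_triangle_right ξ x z
    simp only [hζdef]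
    rw [hZ1 ξ (by linarith), hP0 ξ (by linarith), hQ0 ξ (by linarith)]
    ring
  have hgrad : ∀ ξ (a : Fin d → ℝ), gradAt ζ ξ ⬝ᵥ a = gradAt (farCut x N) ξ ⬝ᵥ a -
      gradAt (poleCut x r₀ N) ξ ⬝ᵥ a - gradAt (poleCut y r₀ N) ξ ⬝ᵥ a := fun ξ a => by
    rw [hζdef, gradAt_sub (tZ.sub tP) tQ, gradAt_sub tZ tP, sub_dotProduct, sub_dotProduct]
  have key := hu.green_identity hv hζ hxζ hyζ
  rw [← setIntegral_eq_integral_of_forall_compl_eq_zero (s := ball z R) (fun ξ hξ => by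
    rw [W'.dotProduct_adjoint_mulVec, hag ξ hξ, sub_self, mul_zero]),
    setIntegral_congr_fun measurableSet_ball (g := fun ξ => Dv ξ ⬝ᵥ (W.A ξ *ᵥ Du ξ) -
      Du ξ ⬝ᵥ (W'.adjoint.A ξ *ᵥ Dv ξ)) (fun ξ hξ => by simp only [hone ξ hξ, one_mul])] at key
  rw [key]
  have hsplit : ∀ {p q : E d} {f g : E d → ℝ} {Df Dg : E d → Fin d → ℝ} (V : CoeffField d lam),
      PuncturedH1 p f Df → PuncturedH1 q g Dg → (p = x ∧ q = y ∨ p = y ∧ q = x) →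
      ∫ ξ, g ξ * (gradAt ζ ξ ⬝ᵥ (V.A ξ *ᵥ Df ξ)) =
        (∫ ξ, g ξ * (gradAt (farCut x N) ξ ⬝ᵥ (V.A ξ *ᵥ Df ξ))) -
        (∫ ξ, g ξ * (gradAt (poleCut x r₀ N) ξ ⬝ᵥ (V.A ξ *ᵥ Df ξ))) -
        ∫ ξ, g ξ * (gradAt (poleCut y r₀ N) ξ ⬝ᵥ (V.A ξ *ᵥ Df ξ)) := by
    intro p q f g Df Dg V hf hg hpq
    have hxZ : x ∉ dyadicShell x ((N : ℝ) + 1) 1 := notMem_dyadicShell_self (by positivity) _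
    have hyZ : y ∉ dyadicShell x ((N : ℝ) + 1) 1 := fun h => by
      have := h.1; rw [pow_one] at this; linarith
    have hxP : x ∉ dyadicShell x (r₀ / 4 ^ N) (poleIdx d N) := notMem_dyadicShell_self (hr N) _
    have hyQ : y ∉ dyadicShell y (r₀ / 4 ^ N) (poleIdx d N) := notMem_dyadicShell_self (hr N) _
    have hyP : y ∉ dyadicShell x (r₀ / 4 ^ N) (poleIdx d N) := fun h => by
      have := h.2; have := hrle N; linarith
    have hxQ : x ∉ dyadicShell y (r₀ / 4 ^ N) (poleIdx d N) := fun h => by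
      have := h.2; rw [dist_comm] at this; have := hrle N; linarith
    have j1 := hf.integrable_gradAt_flux hg V tZ (isCompact_dyadicShell x ((N : ℝ) + 1) 1)
      (fun ξ hξ => gradAt_logCut_of_notMem_dyadicShell (by positivity) hξ)
      (by rcases hpq with ⟨rfl, rfl⟩ | ⟨rfl, rfl⟩ <;> assumption)
      (by rcases hpq with ⟨rfl, rfl⟩ | ⟨rfl, rfl⟩ <;> assumption)
    have j2 := hf.integrable_gradAt_flux hg V tP (isCompact_dyadicShell x (r₀ / 4 ^ N) _)
      (fun ξ hξ => gradAt_logCut_of_notMem_dyadicShell (hr N) hξ)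
      (by rcases hpq with ⟨rfl, rfl⟩ | ⟨rfl, rfl⟩ <;> assumption)
      (by rcases hpq with ⟨rfl, rfl⟩ | ⟨rfl, rfl⟩ <;> assumption)
    have j3 := hf.integrable_gradAt_flux hg V tQ (isCompact_dyadicShell y (r₀ / 4 ^ N) _)
      (fun ξ hξ => gradAt_logCut_of_notMem_dyadicShell (hr N) hξ)
      (by rcases hpq with ⟨rfl, rfl⟩ | ⟨rfl, rfl⟩ <;> assumption)
      (by rcases hpq with ⟨rfl, rfl⟩ | ⟨rfl, rfl⟩ <;> assumption)
    have j4 : Integrable fun ξ => g ξ * (gradAt (farCut x N) ξ ⬝ᵥ (V.A ξ *ᵥ Df ξ)) -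
        g ξ * (gradAt (poleCut x r₀ N) ξ ⬝ᵥ (V.A ξ *ᵥ Df ξ)) := j1.sub j2
    rw [← integral_sub j1 j2, ← integral_sub j4 j3]
    simp only [hgrad, mul_sub]
  rw [hsplit W hu.toPuncturedH1 hv.toPuncturedH1 (Or.inl ⟨rfl, rfl⟩),
    hsplit W'.adjoint hv.toPuncturedH1 hu.toPuncturedH1 (Or.inr ⟨rfl, rfl⟩)]
  ring

end

section

variable {d : ℕ} {lam : ℝ} {x y z : E d} {u u' v f g : E d → ℝ}
  {Du Du' Dv Df Dg : E d → Fin d → ℝ} {W W' : CoeffField d lam} {c C c' C' T R : ℝ}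

theorem dotProduct_sub_self_le (a b : Fin d → ℝ) :
    (a - b) ⬝ᵥ (a - b) ≤ 2 * (a ⬝ᵥ a) + 2 * (b ⬝ᵥ b) := by
  have h := dotProduct_self_nonneg' (a + b)
  simp only [add_dotProduct, dotProduct_add, sub_dotProduct, dotProduct_sub] at h ⊢
  linarith

theorem PuncturedH1.sub (hf : PuncturedH1 x f Df) (hg : PuncturedH1 x g Dg) :
    PuncturedH1 x (fun ξ => f ξ - g ξ) fun ξ => Df ξ - Dg ξ where
  weakGrad := hf.weakGrad.sub hg.weakGrad hf.locInt hf.locIntGrad hg.locInt hg.locIntGrad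
  cont := hf.cont.sub hg.cont
  locInt := hf.locInt.sub hg.locInt
  locIntGrad i := (hf.locIntGrad i).sub (hg.locIntGrad i)
  sqInt K hK hx := by
    have h1 : IntegrableOn (fun ξ => 2 * (Df ξ ⬝ᵥ Df ξ) + 2 * (Dg ξ ⬝ᵥ Dg ξ)) K :=
      ((hf.sqInt K hK hx).const_mul 2).add ((hg.sqInt K hK hx).const_mul 2)
    refine h1.mono' (aestronglyMeasurable_dotProduct_self fun i =>
      (hf.locIntGrad i).sub (hg.locIntGrad i)).restrict (Eventually.of_forall fun ξ => ?_)
    rw [Real.norm_of_nonneg (dotProduct_self_nonneg' _)]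
    exact dotProduct_sub_self_le _ _

theorem PuncturedH1.sqInt_ball (hf : PuncturedH1 x f Df) (hx : R < dist x z) :
    IntegrableOn (fun ξ => Df ξ ⬝ᵥ Df ξ) (ball z R) :=
  (hf.sqInt (closedBall z R) (isCompact_closedBall z R) fun h => by
    rw [mem_closedBall] at h; linarith).mono_set ball_subset_closedBall

theorem two_mul_sqrt_mul_sqrt_le {a b : ℝ} (ha : 0 ≤ a) (hb : 0 ≤ b) :
    2 * (√a * √b) ≤ a + b := by
  nlinarith [sq_nonneg (√a - √b), Real.sq_sqrt ha, Real.sq_sqrt hb]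

theorem FundSol.abs_sub_le (hu : FundSol W T x u Du) (hub : GreenBd c C T x u Du)
    (hv : FundSol W'.adjoint T y v Dv) (hvb : GreenBd c' C' T y v Dv) (hd : 2 ≤ d)
    (hc : 0 < c) (hC : 0 < C) (hc' : 0 < c') (hC' : 0 < C') (hT : 0 < T) (hlam : 0 < lam)
    (hag : agreesOff (ball z R) W W') (hx : R < dist x z) (hy : R < dist y z) (hyx : y ≠ x) :
    |v x - u y| ≤ (∫ ξ in ball z R, Dv ξ ⬝ᵥ Dv ξ) + ∫ ξ in ball z R, Du ξ ⬝ᵥ Du ξ := by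
  have iv := hv.sqInt_ball hy
  have iu := hu.sqInt_ball hx
  rw [← hu.representation hub hv hvb hd hc hC hc' hC' hT hlam hag hx hy hyx,
    ← integral_add iv iu, ← Real.norm_eq_abs]
  refine norm_integral_le_of_norm_le (iv.add iu) (Eventually.of_forall fun ξ => ?_)
  have h1 := W.abs_dotProduct_mulVec_le ξ (Dv ξ) (Du ξ)
  have h2 := W'.adjoint.abs_dotProduct_mulVec_le ξ (Du ξ) (Dv ξ)
  have h3 := two_mul_sqrt_mul_sqrt_le (dotProduct_self_nonneg' (Dv ξ))
    (dotProduct_self_nonneg' (Du ξ))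
  rw [Real.norm_eq_abs]
  refine (abs_sub _ _).trans ?_
  linarith

/-- The difference of two Green functions stays bounded near the common pole. -/
theorem exists_abs_sub_le_near_pole {G G' : E d → E d → ℝ}
    {DxG DyG DxG' DyG' : E d → E d → Fin d → ℝ}
    (hG : GreenProps W T c C G DxG DyG) (hG' : GreenProps W' T c' C' G' DxG' DyG') (hd : 2 ≤ d)
    (hc : 0 < c) (hC : 0 < C) (hc' : 0 < c') (hC' : 0 < C') (hT : 0 < T) (hlam : 0 < lam)
    (hag : agreesOff (ball z R) W W') {δ : ℝ} (hδ : 0 < δ) (hx : R + 2 * δ ≤ dist x z) :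
    ∃ M, ∀ y, y ≠ x → dist y x < δ → |G' y x - G y x| ≤ M := by
  obtain ⟨n, hn⟩ := pow_unbounded_of_one_lt ((dist x z + δ + |R|) / (δ / 2))
    (by norm_num : (1 : ℝ) < 3 / 2)
  rw [div_lt_iff₀ (by positivity)] at hn
  refine ⟨n * (C' ^ 2 / (δ / 2) ^ (d - 2)) + ∫ ξ in ball z R, DxG ξ x ⬝ᵥ DxG ξ x,
    fun y hyx hy => ?_⟩
  have h1 := dist_triangle_left x z y
  have hv := hG'.fundSol_right hd hc' y
  refine ((hG.fundSol_left hd hc x).abs_sub_le (hG.greenBd_left x) hv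
    (hG'.greenBd_right y) hd hc hC hc' hC' hT hlam hag (by linarith) (by linarith) hyx).trans ?_
  gcongr
  refine ((hG'.greenBd_right y).shell hd hc' hv.locIntGrad n (R := δ / 2) (by positivity)
    fun ξ hξ => ?_).2
  rw [mem_ball] at hξ
  have h2 := dist_triangle_left y z ξ
  have h3 := dist_triangle_right ξ y z
  have h4 := dist_triangle y x z
  have h5 := le_abs_self R
  exact ⟨by linarith, by linarith⟩

/-- The localized energy estimate for the difference of two fundamental solutions. -/
theorem FundSol.energy_sub_le (hu : FundSol W T x u Du) (hu' : FundSol W' T x u' Du')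
    (hT : 0 < T) (hlam : 0 < lam) (hag : agreesOff (ball z R) W W') {σ : E d → ℝ}
    (hσ : IsTestFun d σ) (hx : x ∉ tsupport σ) (hxz : R < dist x z)
    (hB : ∀ ξ ∈ ball z R, σ ξ = 1 ∧ gradAt σ ξ = 0) :
    lam / 2 * ∫ ξ in ball z R, (Du' ξ - Du ξ) ⬝ᵥ (Du' ξ - Du ξ) ≤
      2 / lam * (∫ ξ, (u' ξ - u ξ) ^ 2 * (gradAt σ ξ ⬝ᵥ gradAt σ ξ)) +
        2 / lam * ∫ ξ in ball z R, Du ξ ⬝ᵥ Du ξ := by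
  set w : E d → ℝ := fun ξ => u' ξ - u ξ with hwdef
  set Dw : E d → Fin d → ℝ := fun ξ => Du' ξ - Du ξ with hDwdef
  have hw : PuncturedH1 x w Dw := hu'.toPuncturedH1.sub hu.toPuncturedH1
  set ζ : E d → ℝ := fun ξ => σ ξ * σ ξ with hζdef
  have hζ : IsTestFun d ζ := hσ.mul hσ
  have hsub : tsupport ζ ⊆ tsupport σ := tsupport_mul_subset_left
  have hxζ : x ∉ tsupport ζ := fun h => hx (hsub h)
  have hK := hζ.2.isCompact
  have hζ0 : ∀ ξ ∉ tsupport ζ, ζ ξ = 0 := fun ξ hξ => image_eq_zero_of_notMem_tsupport hξ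
  have hgζ0 : ∀ ξ ∉ tsupport ζ, gradAt ζ ξ = 0 := fun ξ hξ =>
    gradAt_eq_zero_of_notMem_tsupport hξ
  have hint : ∀ {h : E d → ℝ} {Dh : E d → Fin d → ℝ} (V : CoeffField d lam),
      PuncturedH1 x h Dh → Integrable fun ξ => T⁻¹ * (ζ ξ * (h ξ * w ξ)) +
        ζ ξ * (Dw ξ ⬝ᵥ (V.A ξ *ᵥ Dh ξ)) + w ξ * (gradAt ζ ξ ⬝ᵥ (V.A ξ *ᵥ Dh ξ)) :=
    fun V hh => (((integrable_mul_of_support hK hζ.continuous hζ0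
      (integrableOn_mul (hh.memLp hK hxζ) (hw.memLp hK hxζ))).const_mul _).add
      (integrable_mul_of_support hK hζ.continuous hζ0
      (hh.integrableOn_dot_flux hw V hK hxζ hxζ))).add
      (hh.integrable_gradAt_flux hw V hζ hK hgζ0 hxζ hxζ)
  have i1 := hint W' hu'.toPuncturedH1
  have i2 := hint W hu.toPuncturedH1
  have i3 := hw.integrable_sq_mul_gradAt_sq hσ hσ.2.isCompact
    (fun ξ hξ => gradAt_eq_zero_of_notMem_tsupport hξ) hx
  have iw := hw.sqInt_ball hxz
  have iu := hu.sqInt_ball hxz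
  rw [← integrable_indicator_iff measurableSet_ball] at iw iu
  have key := integral_mono (μ := volume) (iw.const_mul (lam / 2))
    (((i1.sub i2).add (i3.const_mul (2 / lam))).add (iu.const_mul (2 / lam))) fun ξ => by
      have hyoung := young_lower_bound (η := σ ξ) (e := w ξ) hlam
        (dotProduct_self_nonneg' (Dw ξ)) (dotProduct_self_nonneg' (gradAt σ ξ))
        ((W'.elliptic ξ).2 (Dw ξ)) (W'.abs_dotProduct_mulVec_le ξ (gradAt σ ξ) (Dw ξ))
      have hmass : 0 ≤ T⁻¹ * (σ ξ * σ ξ * (w ξ * w ξ)) := by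
        have := mul_self_nonneg (σ ξ); have := mul_self_nonneg (w ξ); positivity
      have hq := dotProduct_self_nonneg' (Dw ξ)
      have hflux : ∀ a : Fin d → ℝ, a ⬝ᵥ (W'.A ξ *ᵥ Du' ξ) =
          a ⬝ᵥ (W'.A ξ *ᵥ Dw ξ) + a ⬝ᵥ (W'.A ξ *ᵥ Du ξ) := fun a => by
        rw [← dotProduct_add, ← mulVec_add, hDwdef, sub_add_cancel]
      have hu'w : u' ξ = w ξ + u ξ := by simp [hwdef]
      simp only [Pi.add_apply, Pi.sub_apply, hζdef, gradAt_mul_self hσ]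
      by_cases hξ : ξ ∈ ball z R
      · obtain ⟨h1, h2⟩ := hB ξ hξ
        have h3 := W.abs_dotProduct_mulVec_le ξ (Dw ξ) (Du ξ)
        have h4 := W'.abs_dotProduct_mulVec_le ξ (Dw ξ) (Du ξ)
        have h5 := (W'.elliptic ξ).2 (Dw ξ)
        have h6 := two_mul_sqrt_mul_sqrt_le (a := lam / 2 * (Dw ξ ⬝ᵥ Dw ξ))
          (b := 2 / lam * (Du ξ ⬝ᵥ Du ξ)) (by positivity)
          (mul_nonneg (by positivity) (dotProduct_self_nonneg' _))
        have h7 : √(lam / 2 * (Dw ξ ⬝ᵥ Dw ξ)) * √(2 / lam * (Du ξ ⬝ᵥ Du ξ)) =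
            √(Dw ξ ⬝ᵥ Dw ξ) * √(Du ξ ⬝ᵥ Du ξ) := by
          rw [← Real.sqrt_mul (by positivity), ← Real.sqrt_mul hq]
          congr 1; field_simp
        rw [h7] at h6
        rw [h1] at hmass
        rw [Set.indicator_of_mem hξ, Set.indicator_of_mem hξ, hflux, hu'w, h1, h2]
        simp only [zero_dotProduct, mul_zero, add_zero, one_mul]
        have := (abs_le.1 h3).2
        have := (abs_le.1 h4).1
        nlinarith
      · rw [Set.indicator_of_notMem hξ, Set.indicator_of_notMem hξ, hflux, hflux, hag ξ hξ, hu'w]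
        rw [hag ξ hξ] at hyoung
        have : 0 ≤ lam / 2 * (σ ξ ^ 2 * (Dw ξ ⬝ᵥ Dw ξ)) := by positivity
        simp only [mul_zero, add_zero]
        nlinarith
  rw [integral_add' ((i1.sub i2).add (i3.const_mul _)) (iu.const_mul _),
    integral_add' (i1.sub i2) (i3.const_mul _), integral_sub' i1 i2,
    hu'.test hw hζ hxζ hxζ, hu.test hw hζ hxζ hxζ, integral_const_mul, integral_const_mul,
    integral_const_mul, integral_indicator measurableSet_ball,
    integral_indicator measurableSet_ball] at key
  linarith

theorem integral_sq_sub_mul_gradAt_sq_le {M : ℝ} (hu : PuncturedH1 x u Du)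
    (hu' : PuncturedH1 x u' Du') {φ ψ : E d → ℝ} (hφ : IsTestFun d φ) (hψ : IsTestFun d ψ)
    {S S' : Set (E d)} (hS : IsCompact S) (hφS : ∀ ξ ∉ S, gradAt φ ξ = 0) (hxS : x ∉ S)
    (hS' : IsCompact S') (hψS : ∀ ξ ∉ S', gradAt ψ ξ = 0) (hxS' : x ∉ S')
    (hM : ∀ ξ ∈ S', |u' ξ - u ξ| ≤ M) :
    ∫ ξ, (u' ξ - u ξ) ^ 2 * (gradAt (fun ξ => φ ξ - ψ ξ) ξ ⬝ᵥ gradAt (fun ξ => φ ξ - ψ ξ) ξ) ≤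
      4 * (∫ ξ, u' ξ ^ 2 * (gradAt φ ξ ⬝ᵥ gradAt φ ξ)) +
        4 * (∫ ξ, u ξ ^ 2 * (gradAt φ ξ ⬝ᵥ gradAt φ ξ)) +
        2 * (M ^ 2 * ∫ ξ, gradAt ψ ξ ⬝ᵥ gradAt ψ ξ) := by
  have i1 := (hu'.integrable_sq_mul_gradAt_sq hφ hS hφS hxS).const_mul 4
  have i2 := (hu.integrable_sq_mul_gradAt_sq hφ hS hφS hxS).const_mul 4
  have i3 := ((hu'.sub hu).integrable_sq_mul_gradAt_sq hψ hS' hψS hxS').const_mul 2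
  have h1 := integral_sq_mul_gradAt_sq_le (g := fun ξ => u' ξ - u ξ) hψ (M := M)
    fun ξ hξ => hM ξ (by by_contra hc; exact hξ (hψS ξ hc))
  have key := integral_mono_of_nonneg (μ := volume) (f := fun ξ => (u' ξ - u ξ) ^ 2 *
      (gradAt (fun ξ => φ ξ - ψ ξ) ξ ⬝ᵥ gradAt (fun ξ => φ ξ - ψ ξ) ξ))
    (Eventually.of_forall fun ξ => mul_nonneg (sq_nonneg _) (dotProduct_self_nonneg' _))
    ((i1.add i2).add i3) (Eventually.of_forall fun ξ => by
      simp only [Pi.add_apply]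
      rw [gradAt_sub hφ hψ]
      have h2 := dotProduct_sub_self_le (gradAt φ ξ) (gradAt ψ ξ)
      have h3 := mul_le_mul_of_nonneg_left h2 (sq_nonneg (u' ξ - u ξ))
      have h4 : 0 ≤ (u' ξ + u ξ) ^ 2 * (gradAt φ ξ ⬝ᵥ gradAt φ ξ) :=
        mul_nonneg (sq_nonneg _) (dotProduct_self_nonneg' _)
      nlinarith)
  rw [integral_add' (i1.add i2) i3, integral_add' i1 i2, integral_const_mul, integral_const_mul,
    integral_const_mul] at key
  linarith

/-- The energy of the difference of two Green functions on the region where the coefficients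
differ is controlled by the energy of either of them. -/
theorem GreenProps.integral_sub_sq_le {G G' : E d → E d → ℝ}
    {DxG DyG DxG' DyG' : E d → E d → Fin d → ℝ}
    (hG : GreenProps W T c C G DxG DyG) (hG' : GreenProps W' T c' C' G' DxG' DyG') (hd : 2 ≤ d)
    (hc : 0 < c) (hC : 0 < C) (hc' : 0 < c') (hC' : 0 < C') (hT : 0 < T) (hlam : 0 < lam)
    (hag : agreesOff (ball z R) W W') (hx : R < dist x z) :
    lam / 2 * ∫ ξ in ball z R, (DxG' ξ x - DxG ξ x) ⬝ᵥ (DxG' ξ x - DxG ξ x) ≤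
      2 / lam * ∫ ξ in ball z R, DxG ξ x ⬝ᵥ DxG ξ x := by
  have hu := hG.fundSol_left hd hc x
  have hu' := hG'.fundSol_left hd hc' x
  obtain ⟨K, hK, hKb⟩ := exists_integral_gradAt_logCut_le d hd
  obtain ⟨δ, hδ, hδx⟩ : ∃ δ, 0 < δ ∧ R + 2 * δ = dist x z :=
    ⟨(dist x z - R) / 2, by linarith, by ring⟩
  obtain ⟨M, hM⟩ := exists_abs_sub_le_near_pole hG hG' hd hc hC hc' hC' hT hlam hag hδ hδx.le
  have hr : 0 < δ / 2 := by positivity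
  have hlim : Tendsto (fun N : ℕ => 2 / lam * (
      4 * (∫ ξ, G' ξ x ^ 2 * (gradAt (farCut x N) ξ ⬝ᵥ gradAt (farCut x N) ξ)) +
      4 * (∫ ξ, G ξ x ^ 2 * (gradAt (farCut x N) ξ ⬝ᵥ gradAt (farCut x N) ξ)) +
      2 * (M ^ 2 * (K * (δ / 2) ^ (d - 2) / N))) +
      2 / lam * ∫ ξ in ball z R, DxG ξ x ⬝ᵥ DxG ξ x) atTop
      (𝓝 (2 / lam * ∫ ξ in ball z R, DxG ξ x ⬝ᵥ DxG ξ x)) := by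
    have h1 := (hG'.greenBd_left x).tendsto_farCut hd hc' hC' hT x
    have h2 := (hG.greenBd_left x).tendsto_farCut hd hc hC hT x
    have h3 := tendsto_const_div_atTop_nhds_zero_nat (K * (δ / 2) ^ (d - 2))
    simpa using ((((h1.const_mul 4).add (h2.const_mul 4)).add
      ((h3.const_mul (M ^ 2)).const_mul 2)).const_mul (2 / lam)).add_const
      (2 / lam * ∫ ξ in ball z R, DxG ξ x ⬝ᵥ DxG ξ x)
  refine ge_of_tendsto hlim ?_
  filter_upwards [eventually_le_natCast (2 * (dist x z + |R| + δ)),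
    eventually_ge_atTop 1] with N hN hN1
  have hR := le_abs_self R
  have hR' := abs_nonneg R
  have hxz0 : 0 ≤ dist x z := dist_nonneg
  have tZ := isTestFun_farCut x N
  have tP := isTestFun_logCut x hr N
  have hB : ∀ ξ ∈ ball z R, farCut x N ξ - logCut x (δ / 2) N ξ = 1 ∧
      gradAt (fun ξ => farCut x N ξ - logCut x (δ / 2) N ξ) ξ = 0 := by
    intro ξ hξ
    rw [mem_ball] at hξ
    have h1 := dist_triangle_left x z ξ
    have h2 := dist_triangle_right ξ x z
    refine ⟨?_, ?_⟩
    · rw [farCut_eq_one (by linarith), logCut_eq_zero hr (by linarith), sub_zero]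
    · rw [gradAt_sub tZ tP, farCut,
        gradAt_logCut_eq_zero (by positivity) (Or.inl (by rw [pow_one]; linarith)),
        gradAt_logCut_eq_zero hr (Or.inr (by linarith)), sub_zero]
  have hxs : x ∉ tsupport fun ξ => farCut x N ξ - logCut x (δ / 2) N ξ := by
    rw [notMem_tsupport_iff_eventuallyEq]
    filter_upwards [ball_mem_nhds x (show 0 < δ / 2 / 2 ^ N by positivity)] with ξ hξ
    rw [mem_ball] at hξ
    have h1 : δ / 2 / 2 ^ N ≤ δ / 2 := div_le_self hr.le (one_le_pow₀ (by norm_num))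
    rw [farCut_eq_one (by linarith), logCut_eq_one hr hN1 hξ.le, sub_self, Pi.zero_apply]
  refine (hu.energy_sub_le hu' hT hlam hag (tZ.sub tP) hxs hx hB).trans ?_
  have h1 := integral_sq_sub_mul_gradAt_sq_le (M := M) hu.toPuncturedH1 hu'.toPuncturedH1 tZ tP
    (isCompact_dyadicShell x ((N : ℝ) + 1) 1)
    (fun ξ hξ => gradAt_logCut_of_notMem_dyadicShell (by positivity) hξ)
    (notMem_dyadicShell_self (by positivity) _) (isCompact_dyadicShell x (δ / 2) N)
    (fun ξ hξ => gradAt_logCut_of_notMem_dyadicShell hr hξ) (notMem_dyadicShell_self hr _)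
    fun ξ hξ => hM ξ (by rintro rfl; exact notMem_dyadicShell_self hr N hξ)
      (by have := hξ.2; linarith)
  have h2 := hKb x (δ / 2) hr N
  gcongr
  refine h1.trans ?_
  gcongr

theorem GreenProps.integral_sq_le {G G' : E d → E d → ℝ}
    {DxG DyG DxG' DyG' : E d → E d → Fin d → ℝ}
    (hG : GreenProps W T c C G DxG DyG) (hG' : GreenProps W' T c' C' G' DxG' DyG') (hd : 2 ≤ d)
    (hc : 0 < c) (hC : 0 < C) (hc' : 0 < c') (hC' : 0 < C') (hT : 0 < T) (hlam : 0 < lam)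
    (hag : agreesOff (ball z R) W W') (hx : R < dist x z) :
    ∫ ξ in ball z R, DxG' ξ x ⬝ᵥ DxG' ξ x ≤
      (8 / lam ^ 2 + 2) * ∫ ξ in ball z R, DxG ξ x ⬝ᵥ DxG ξ x := by
  have hu := (hG.fundSol_left hd hc x).toPuncturedH1
  have hu' := (hG'.fundSol_left hd hc' x).toPuncturedH1
  have i1 := ((hu'.sub hu).sqInt_ball hx).const_mul 2
  have i2 := (hu.sqInt_ball hx).const_mul 2
  have key := integral_mono (hu'.sqInt_ball hx) (i1.add i2) fun ξ => by
    have h := dotProduct_sub_self_le (DxG' ξ x - DxG ξ x) (-DxG ξ x)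
    rwa [sub_neg_eq_add, sub_add_cancel, neg_dotProduct_neg] at h
  rw [integral_add' i1 i2, integral_const_mul, integral_const_mul] at key
  have h1 := hG.integral_sub_sq_le hG' hd hc hC hc' hC' hT hlam hag hx
  have h2 := mul_le_mul_of_nonneg_left h1 (show 0 ≤ 4 / lam by positivity)
  have h3 : 4 / lam * (lam / 2 * ∫ ξ in ball z R, (DxG' ξ x - DxG ξ x) ⬝ᵥ (DxG' ξ x - DxG ξ x))
      = 2 * ∫ ξ in ball z R, (DxG' ξ x - DxG ξ x) ⬝ᵥ (DxG' ξ x - DxG ξ x) := by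
    field_simp; norm_num
  have h4 : 4 / lam * (2 / lam * ∫ ξ in ball z R, DxG ξ x ⬝ᵥ DxG ξ x) =
      8 / lam ^ 2 * ∫ ξ in ball z R, DxG ξ x ⬝ᵥ DxG ξ x := by
    field_simp; ring
  linarith

end

end GO

namespace GO

/-- Lemma: uniform control of the Green function gradient under local
modifications of the coefficients. If `Ã` coincides with `A` outside `B_R(z)` and
`|x−z| > R`, then `∫_{B_R(z)} |∇_y G_T(y,x;Ã)|² dy ≤ C ∫_{B_R(z)} |∇_y G_T(y,x;A)|² dy`. -/
theorem statement11 (d : ℕ) (hd : 2 ≤ d) (lam : ℝ) (hlam : 0 < lam) (hlam' : lam ≤ 1) :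
    ∀ R : ℝ, 1 ≤ R → ∃ C : ℝ, 0 < C ∧
      ∀ (T : ℝ), 0 < T →
      ∀ (W W' : CoeffField d lam) (z : E d), agreesOff (ball z R) W W' →
      ∀ (G : E d → E d → ℝ) (DxG DyG : E d → E d → Fin d → ℝ),
        IsGreenFunction W T G DxG DyG →
      ∀ (G' : E d → E d → ℝ) (DxG' DyG' : E d → E d → Fin d → ℝ),
        IsGreenFunction W' T G' DxG' DyG' →
      ∀ x : E d, R < dist x z →
        (∫⁻ y in ball z R, ENNReal.ofReal (DxG' y x ⬝ᵥ DxG' y x)) ≤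
          ENNReal.ofReal C * (∫⁻ y in ball z R, ENNReal.ofReal (DxG y x ⬝ᵥ DxG y x)) := by
  intro R _
  refine ⟨8 / lam ^ 2 + 2, by positivity, ?_⟩
  rintro T hT W W' z hag G DxG DyG ⟨c, C, hc, hC, hG⟩ G' DxG' DyG' ⟨c', C', hc', hC', hG'⟩ x hx
  rw [← ofReal_integral_eq_lintegral_ofReal ((hG'.fundSol_left hd hc' x).sqInt_ball hx)
      (Eventually.of_forall fun ξ => dotProduct_self_nonneg' _),
    ← ofReal_integral_eq_lintegral_ofReal ((hG.fundSol_left hd hc x).sqInt_ball hx)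
      (Eventually.of_forall fun ξ => dotProduct_self_nonneg' _),
    ← ENNReal.ofReal_mul (by positivity)]
  exact ENNReal.ofReal_le_ofReal
    (hG.integral_sq_le hG' hd hc hC hc' hC' hT hlam hag hx)

end GO
end
end
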